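/- Let ε > 0 be real. There exist δ = δ(ε) > 0 and C = C(ε) > 0 such that the following holds. Let q be a cube-free positive integer, χ a primitive Dirichlet character mod q, and ℓ a real number with q^ε ≤ ℓ ≤ q/2. Let I'_1, …, I'_J be pairwise disjoint intervals of integers contained in [1, q], each of length between ℓ and 2ℓ, and suppose ℓ · J^{1/2} ≥ q^{1/4 + ε/2}. Then |∑_{j=1}^{J} ∑_{n ∈ I'_j} χ(n)| ≤ C · ℓ · J · q^{−δ}. -/

import Mathlib

open Polynomial in
theorem pow_sub_dvd_hasseDeriv {R : Type*} [CommRing R] (g : R[X]) :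
    ∀ (e k : ℕ) (P : R[X]), g ^ e ∣ P → g ^ (e - k) ∣ hasseDeriv k P := by
  intro e
  induction e with
  | zero => intro k P _; simp
  | succ e ih =>
    rintro k P ⟨Q, rfl⟩
    rw [pow_succ', mul_assoc, hasseDeriv_mul]
    refine Finset.dvd_sum fun ij hij => ?_
    obtain ⟨i, j⟩ := ij
    rw [Finset.HasAntidiagonal.mem_antidiagonal] at hij
    dsimp only at hij ⊢
    have h := ih j (g ^ e * Q) (dvd_mul_right _ _)
    rcases Nat.eq_zero_or_pos i with rfl | hi
    · rw [hasseDeriv_zero']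
      refine (pow_dvd_pow g (show e + 1 - k ≤ (e - j) + 1 by omega)).trans ?_
      rw [pow_succ']
      exact mul_dvd_mul_left g h
    · exact ((pow_dvd_pow g (show e + 1 - k ≤ e - j by omega)).trans h).mul_left _

open Polynomial in
theorem eval_hasseDeriv_mul_X_pow_card {E : Type*} [Field E] [Fintype E] (P : E[X]) (x : E)
    (j k : ℕ) (hk : k < Fintype.card E) :
    (hasseDeriv k (P * X ^ (Fintype.card E * j))).eval x = (hasseDeriv k P).eval x * x ^ j := by
  obtain ⟨p, _⟩ := CharP.exists E
  obtain ⟨n, hp, hc⟩ := FiniteField.card E p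
  have := Fact.mk hp
  rw [← taylor_coeff, ← taylor_coeff, taylor_mul, taylor_X_pow, pow_mul]
  have h1 : (X + C x : E[X]) ^ Fintype.card E = X ^ Fintype.card E + C x := by
    conv_lhs => rw [hc]
    rw [add_pow_char_pow, ← hc, ← C_pow, FiniteField.pow_card]
  rw [h1]
  obtain ⟨W, hW⟩ := sub_dvd_pow_sub_pow (X ^ Fintype.card E + C x : E[X]) (C x) j
  rw [add_sub_cancel_right] at hW
  rw [eq_add_of_sub_eq hW, mul_add, coeff_add, ← C_pow, coeff_mul_C, mul_left_comm,
    coeff_X_pow_mul', if_neg (by omega), zero_add]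

open Polynomial in
theorem natDegree_le_of_pow_mul_eq_hasseDeriv {E : Type*} [Field E] {g T Q : E[X]} {e M k : ℕ}
    (hg : g ≠ 0) (hk : k ≤ M)
    (h : hasseDeriv k (g ^ (M + e) * T) = g ^ (M - k + e) * Q) :
    Q.natDegree ≤ T.natDegree + k * g.natDegree := by
  rcases eq_or_ne Q 0 with rfl | hQ
  · simp
  have h1 := natDegree_hasseDeriv_le (g ^ (M + e) * T) k
  rw [h, natDegree_mul (pow_ne_zero _ hg) hQ, natDegree_pow] at h1
  have h2 : (g ^ (M + e) * T).natDegree ≤ (M + e) * g.natDegree + T.natDegree := by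
    refine natDegree_mul_le.trans ?_
    rw [natDegree_pow]
  obtain ⟨c, rfl⟩ := Nat.exists_eq_add_of_le hk
  rw [Nat.add_sub_cancel_left] at h1
  have : (k + c + e) * g.natDegree = (c + e) * g.natDegree + k * g.natDegree := by ring
  omega

open Polynomial in
/-- The auxiliary polynomial of Stepanov's method. -/
noncomputable def stepanovPoly {E : Type*} [Field E] (g : E[X]) (M e₀ q : ℕ) {d J A : ℕ}
    (c : Fin d × Fin J × Fin A → E) : E[X] :=
  ∑ u : Fin d × Fin J × Fin A,
    g ^ (M + u.1 * e₀) * (C (c u) * X ^ (u.2.2 : ℕ)) * X ^ (q * (u.2.1 : ℕ))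

open Polynomial in
theorem exists_stepanovPoly_vanishing {E : Type*} [Field E] [Fintype E] (g : E[X]) (hg : g ≠ 0)
    (a : E) {M e₀ d J A : ℕ} (hM : M ≤ Fintype.card E)
    (hdim : M * (A + M * g.natDegree + J) < d * (J * A)) :
    ∃ c : Fin d × Fin J × Fin A → E, c ≠ 0 ∧
      ∀ x : E, g.eval x ^ e₀ = a → ∀ k < M,
        (hasseDeriv k (stepanovPoly g M e₀ (Fintype.card E) c)).eval x = 0 := by
  have hex : ∀ (i k t : ℕ), k ≤ M → ∃ Q : E[X],
      hasseDeriv k (g ^ (M + i * e₀) * X ^ t) = g ^ (M - k + i * e₀) * Q := by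
    intro i k t hk
    have h := pow_sub_dvd_hasseDeriv g (M + i * e₀) k (g ^ (M + i * e₀) * X ^ t)
      (dvd_mul_right _ _)
    rwa [show M + i * e₀ - k = M - k + i * e₀ by omega] at h
  have hex' : ∃ Q : ℕ → ℕ → ℕ → E[X], ∀ i k t, k ≤ M →
      hasseDeriv k (g ^ (M + i * e₀) * X ^ t) = g ^ (M - k + i * e₀) * Q i k t := by
    choose Q hQ using hex
    exact ⟨fun i k t => if h : k ≤ M then Q i k t h else 0, fun i k t hk => by
      simp only [dif_pos hk]; exact hQ i k t hk⟩
  obtain ⟨Q, hQ⟩ := hex'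
  have hdeg : ∀ i k t, k ≤ M → (Q i k t).natDegree ≤ t + k * g.natDegree := by
    intro i k t hk
    have := natDegree_le_of_pow_mul_eq_hasseDeriv hg hk (hQ i k t hk)
    rwa [natDegree_X_pow] at this
  let Φ : (Fin d × Fin J × Fin A → E) →ₗ[E] (Fin M → E[X]) :=
    LinearMap.pi fun k => ∑ u : Fin d × Fin J × Fin A,
      (LinearMap.toSpanSingleton E E[X] (C (a ^ (u.1 : ℕ)) * X ^ (u.2.1 : ℕ) *
        Q u.1 k u.2.2)) ∘ₗ (LinearMap.proj u)
  have hΦ : ∀ c k, Φ c k = ∑ u : Fin d × Fin J × Fin A,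
      c u • (C (a ^ (u.1 : ℕ)) * X ^ (u.2.1 : ℕ) * Q u.1 k u.2.2) := by
    intro c k
    simp [Φ]
  let Ψ : (Fin d × Fin J × Fin A → E) →ₗ[E] (Fin M → Fin (A + M * g.natDegree + J) → E) :=
    LinearMap.pi fun k => LinearMap.pi fun l => (lcoeff E l) ∘ₗ (LinearMap.proj k) ∘ₗ Φ
  have hker : LinearMap.ker Ψ ≠ ⊥ := by
    apply LinearMap.ker_ne_bot_of_finrank_lt
    simpa [Module.finrank_pi_fintype, Module.finrank_pi] using hdim
  obtain ⟨c, hc, hc0⟩ := Submodule.exists_mem_ne_zero_of_ne_bot hker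
  refine ⟨c, hc0, ?_⟩
  have hz : ∀ k : Fin M, Φ c k = 0 := by
    intro k
    ext l
    by_cases hl : l < A + M * g.natDegree + J
    · have h1 : Ψ c = 0 := hc
      have := congrFun (congrFun h1 k) ⟨l, hl⟩
      simpa [Ψ] using this
    · rw [coeff_zero]
      apply coeff_eq_zero_of_natDegree_lt
      refine lt_of_lt_of_le ?_ (not_lt.1 hl)
      rw [hΦ]
      have hpos : 0 < A + M * g.natDegree + J := by
        by_contra h0
        have hA : A = 0 := by omega
        simp [hA] at hdim
      refine lt_of_le_of_lt (natDegree_sum_le_of_forall_le (n := A + M * g.natDegree + J - 1)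
        _ _ fun u _ => ?_) (by omega)
      refine (natDegree_smul_le _ _).trans ?_
      refine natDegree_mul_le.trans ?_
      have h1 : (C (a ^ (u.1 : ℕ)) * X ^ (u.2.1 : ℕ) : E[X]).natDegree ≤ u.2.1 :=
        natDegree_C_mul_X_pow_le _ _
      have h2 := hdeg u.1 k u.2.2 k.2.le
      have h3 := u.2.1.2
      have h4 := u.2.2.2
      have h5 : (k : ℕ) * g.natDegree ≤ M * g.natDegree := Nat.mul_le_mul_right _ k.2.le
      omega
  intro x hx k hk
  have h1 := congrArg (eval x) (hz ⟨k, hk⟩)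
  rw [hΦ, eval_finsetSum, eval_zero] at h1
  rw [stepanovPoly, map_sum, eval_finsetSum]
  have : ∀ u : Fin d × Fin J × Fin A, (hasseDeriv k (g ^ (M + u.1 * e₀) *
      (C (c u) * X ^ (u.2.2 : ℕ)) * X ^ (Fintype.card E * (u.2.1 : ℕ)))).eval x =
      g.eval x ^ (M - k) *
        (c u • (C (a ^ (u.1 : ℕ)) * X ^ (u.2.1 : ℕ) * Q u.1 k u.2.2)).eval x := by
    intro u
    rw [eval_hasseDeriv_mul_X_pow_card _ _ _ _ (hk.trans_le hM), mul_left_comm, ← smul_eq_C_mul,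
      map_smul, hQ _ _ _ hk.le]
    simp only [eval_smul, eval_mul, eval_pow, eval_C, eval_X, smul_eq_mul]
    rw [pow_add, mul_comm (u.1 : ℕ) e₀, pow_mul, hx]
    ring
  rw [Finset.sum_congr rfl fun u _ => this u, ← Finset.mul_sum, h1, mul_zero]

open Polynomial in
theorem stepanovPoly_ne_zero {E : Type*} [Field E] (g : E[X]) (hg : g ≠ 0)
    {M e₀ d J A q : ℕ} (hq : d * e₀ + 1 = q) (hcop : Nat.Coprime g.natDegree d)
    (hA : d * A + d * g.natDegree < q)
    (c : Fin d × Fin J × Fin A → E) (hc : c ≠ 0) :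
    stepanovPoly g M e₀ q c ≠ 0 := by
  classical
  have hdeg : ∀ u, c u ≠ 0 → (g ^ (M + u.1 * e₀) *
      (C (c u) * X ^ (u.2.2 : ℕ)) * X ^ (q * (u.2.1 : ℕ))).natDegree =
      (M + u.1 * e₀) * g.natDegree + u.2.2 + q * u.2.1 ∧ (g ^ (M + u.1 * e₀) *
      (C (c u) * X ^ (u.2.2 : ℕ)) * X ^ (q * (u.2.1 : ℕ))) ≠ 0 := by
    intro u hu
    have h1 : (g ^ (M + u.1 * e₀)) ≠ 0 := pow_ne_zero _ hg
    have h2 : (C (c u) * X ^ (u.2.2 : ℕ)) ≠ 0 := mul_ne_zero (C_ne_zero.2 hu) (by simp)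
    have h3 : (X ^ (q * (u.2.1 : ℕ)) : E[X]) ≠ 0 := by simp
    refine ⟨?_, mul_ne_zero (mul_ne_zero h1 h2) h3⟩
    rw [natDegree_mul (mul_ne_zero h1 h2) h3, natDegree_mul h1 h2, natDegree_pow,
      natDegree_C_mul_X_pow _ _ hu, natDegree_X_pow]
  intro h0
  have hsum := degree_sum_eq_of_disjoint (fun u : Fin d × Fin J × Fin A =>
    g ^ (M + u.1 * e₀) * (C (c u) * X ^ (u.2.2 : ℕ)) * X ^ (q * (u.2.1 : ℕ))) Finset.univ ?_
  · change degree (stepanovPoly g M e₀ q c) = _ at hsum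
    rw [h0, degree_zero] at hsum
    obtain ⟨u, hu⟩ := Function.ne_iff.1 hc
    have h1 := Finset.le_sup (f := fun u : Fin d × Fin J × Fin A => degree
      (g ^ (M + u.1 * e₀) * (C (c u) * X ^ (u.2.2 : ℕ)) * X ^ (q * (u.2.1 : ℕ))))
      (Finset.mem_univ u)
    rw [← hsum, le_bot_iff, degree_eq_bot] at h1
    exact (hdeg u hu).2 h1
  · rintro u ⟨-, hu⟩ v ⟨-, hv⟩ huv hEq
    apply huv
    have hu' : c u ≠ 0 := by rintro h; simp [h] at hu
    have hv' : c v ≠ 0 := by rintro h; simp [h] at hv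
    have hn := natDegree_eq_of_degree_eq hEq
    rw [(hdeg u hu').1, (hdeg v hv').1] at hn
    obtain ⟨i, j, t⟩ := u
    obtain ⟨i', j', t'⟩ := v
    dsimp only at hn
    generalize g.natDegree = m at *
    have e1 : (q : ℤ) * (m * ((i : ℤ) - i') + d * ((j : ℤ) - j')) =
        m * ((i : ℤ) - i') - d * ((t : ℤ) - t') := by
      zify at hn hq
      linear_combination (d : ℤ) * hn - (m : ℤ) * ((i : ℤ) - i') * hq
    have hi := i.2
    have hi' := i'.2
    have ht := t.2
    have ht' := t'.2
    have b1 : |(m : ℤ) * ((i : ℤ) - i') - d * ((t : ℤ) - t')| < q := by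
      have c1 : |(m : ℤ) * ((i : ℤ) - i')| ≤ m * d := by
        rw [abs_mul, Nat.abs_cast]
        refine mul_le_mul_of_nonneg_left ?_ (by positivity)
        rw [abs_le]; omega
      have c2 : |(d : ℤ) * ((t : ℤ) - t')| ≤ d * A := by
        rw [abs_mul, Nat.abs_cast]
        refine mul_le_mul_of_nonneg_left ?_ (by positivity)
        rw [abs_le]; omega
      have c3 := abs_sub (m * ((i : ℤ) - i')) (d * ((t : ℤ) - t'))
      zify at hA
      linarith
    have e2 : (m : ℤ) * ((i : ℤ) - i') + d * ((j : ℤ) - j') = 0 := by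
      by_contra hne
      rw [← e1, abs_mul, Nat.abs_cast] at b1
      have := Int.one_le_abs hne
      nlinarith
    rw [e2, mul_zero] at e1
    have hdvd : (d : ℤ) ∣ ((i : ℤ) - i') := by
      have h1 : (d : ℤ) ∣ m * ((i : ℤ) - i') := ⟨-((j : ℤ) - j'), by linear_combination e2⟩
      exact (Nat.isCoprime_iff_coprime.2 hcop).symm.dvd_of_dvd_mul_left h1
    have hii : (i : ℤ) - i' = 0 := by
      apply Int.eq_zero_of_abs_lt_dvd hdvd
      rw [abs_lt]; omega
    rw [hii] at e1 e2
    have hd : (d : ℤ) ≠ 0 := by omega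
    have hjj : (j : ℤ) - j' = 0 := by
      rcases mul_eq_zero.1 (show (d : ℤ) * ((j : ℤ) - j') = 0 by linear_combination e2) with h | h
      · exact absurd h hd
      · exact h
    have htt : (t : ℤ) - t' = 0 := by
      rcases mul_eq_zero.1 (show (d : ℤ) * ((t : ℤ) - t') = 0 by linear_combination e1) with h | h
      · exact absurd h hd
      · exact h
    ext
    · dsimp only; omega
    · dsimp only; omega
    · dsimp only; omega

open Polynomial in
theorem card_mul_le_natDegree_of_hasseDeriv_eq_zero {E : Type*} [Field E] [DecidableEq E]
    (R : E[X]) (hR : R ≠ 0) (s : Finset E) (M : ℕ)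
    (h : ∀ x ∈ s, ∀ k < M, (hasseDeriv k R).eval x = 0) : s.card * M ≤ R.natDegree := by
  have hm : ∀ x ∈ s, M ≤ R.roots.count x := by
    intro x hx
    rw [count_roots, le_rootMultiplicity_iff hR]
    have h1 : X ^ M ∣ taylor x R := by
      rw [X_pow_dvd_iff]
      intro k hk
      rw [taylor_coeff, h x hx k hk]
    obtain ⟨W, hW⟩ := h1
    refine ⟨taylor (-x) W, ?_⟩
    have h2 := congrArg (taylor (-x)) hW
    rw [taylor_taylor, neg_add_cancel, taylor_zero, taylor_mul, taylor_X_pow] at h2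
    rw [h2, C_neg, sub_eq_add_neg]
  calc s.card * M = ∑ x ∈ s, M := by simp
    _ ≤ ∑ x ∈ s, R.roots.count x := Finset.sum_le_sum hm
    _ ≤ ∑ x ∈ s ∪ R.roots.toFinset, R.roots.count x :=
        Finset.sum_le_sum_of_subset Finset.subset_union_left
    _ = R.roots.card := by
        refine Multiset.sum_count_eq_card fun a ha => ?_
        simp only [Finset.mem_union, Multiset.mem_toFinset]
        exact Or.inr ha
    _ ≤ R.natDegree := card_roots' R

open Polynomial in
theorem natDegree_stepanovPoly_le {E : Type*} [Field E] (g : E[X])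
    {M e₀ d J A q : ℕ} (hq : d * e₀ ≤ q) (c : Fin d × Fin J × Fin A → E) :
    (stepanovPoly g M e₀ q c).natDegree ≤ M * g.natDegree + q * g.natDegree + A + q * J := by
  refine natDegree_sum_le_of_forall_le _ _ fun u _ => ?_
  refine natDegree_mul_le.trans ?_
  have h1 : (g ^ (M + u.1 * e₀) * (C (c u) * X ^ (u.2.2 : ℕ))).natDegree ≤
      (M + u.1 * e₀) * g.natDegree + u.2.2 := by
    refine natDegree_mul_le.trans (add_le_add natDegree_pow_le (natDegree_C_mul_X_pow_le _ _))
  rw [natDegree_X_pow]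
  have h2 := u.2.2.2
  have h3 : q * (u.2.1 : ℕ) ≤ q * J := Nat.mul_le_mul_left _ u.2.1.2.le
  have h4 : (u.1 : ℕ) * e₀ ≤ q := (Nat.mul_le_mul_right _ u.1.2.le).trans hq
  have h5 := Nat.mul_le_mul_right g.natDegree h4
  have h6 := add_mul M (u.1 * e₀) g.natDegree
  omega

open Polynomial in
theorem card_pow_eq_mul_le {E : Type*} [Field E] [Fintype E] [DecidableEq E] (g : E[X])
    {M e₀ d J A : ℕ} (hq : d * e₀ + 1 = Fintype.card E) (hcop : Nat.Coprime g.natDegree d)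
    (hg : g ≠ 0) (hA : d * A + d * g.natDegree < Fintype.card E)
    (hM : M ≤ Fintype.card E) (hdim : M * (A + M * g.natDegree + J) < d * (J * A)) (a : E) :
    (Finset.univ.filter fun x : E => g.eval x ^ e₀ = a).card * M ≤
      M * g.natDegree + Fintype.card E * g.natDegree + A + Fintype.card E * J := by
  obtain ⟨c, hc, hv⟩ := exists_stepanovPoly_vanishing g hg a hM hdim
  refine (card_mul_le_natDegree_of_hasseDeriv_eq_zero _
    (stepanovPoly_ne_zero g hg hq hcop hA c hc) _ M fun x hx k hk => ?_).trans
    (natDegree_stepanovPoly_le g (by omega) c)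
  exact hv x (by simpa using hx) k hk

theorem stepanov_dimension_lt {d m q M J A : ℕ} (hMc : 2 * m + 5 + 1 ≤ M) (hM : M * M ≤ q)
    (hA : q ≤ 2 * (d * A)) (hJd : M + d * (2 * m + 5 - 1) ≤ d * J)
    (hJ : J ≤ M + (2 * m + 5)) : M * (A + M * m + J) < d * (J * A) := by
  rw [show 2 * m + 5 - 1 = 2 * m + 4 by omega] at hJd
  have h1 : (M + d * (2 * m + 4)) * A ≤ d * (J * A) := by
    rw [← mul_assoc]; exact Nat.mul_le_mul_right _ hJd
  have h2 : (M + d * (2 * m + 4)) * A = M * A + 2 * (d * A) * (m + 2) := by ring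
  have h3 : M * (A + M * m + J) = M * A + (M * M) * m + M * J := by ring
  have h4 : (M * M) * m ≤ q * m := Nat.mul_le_mul_right _ hM
  have h5 : q * (m + 2) ≤ 2 * (d * A) * (m + 2) := Nat.mul_le_mul_right _ hA
  have h6 : M * J ≤ M * (M + (2 * m + 5)) := Nat.mul_le_mul_left _ hJ
  have h7 : M * (2 * m + 5 + 1) ≤ M * M := Nat.mul_le_mul_left _ hMc
  have h8 : M * (M + (2 * m + 5)) + M = M * M + M * (2 * m + 5 + 1) := by ring
  have h9 : q * (m + 2) = q * m + 2 * q := by ring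
  rw [h3]
  rw [h2] at h1
  linarith

open Polynomial in
theorem exists_card_pow_eq_le (d m : ℕ) (hd : 0 < d) (hcop : Nat.Coprime m d) :
    ∃ C : ℝ, 0 < C ∧ ∀ (E : Type) [Field E] [Fintype E] [DecidableEq E] (g : E[X]) (e₀ : ℕ) (a : E),
      d * e₀ + 1 = Fintype.card E → g ≠ 0 → g.natDegree = m →
      ((Finset.univ.filter fun x : E => g.eval x ^ e₀ = a).card : ℝ) ≤
        (Fintype.card E : ℝ) / d + C * √(Fintype.card E) := by
  set c₀ := 2 * m + 5 with hc₀
  set q₀ := 2 * (1 + d * m) + (c₀ + 1) ^ 2 + 4 with hq₀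
  refine ⟨q₀ + 10 * (m + 1 + c₀), by positivity, ?_⟩
  intro E _ _ _ g e₀ a hq hg hm
  set q := Fintype.card E with hqdef
  have hq1 : 1 ≤ q := by omega
  have hsq1 : (1 : ℝ) ≤ √q := by rw [Real.one_le_sqrt]; exact_mod_cast hq1
  rcases lt_or_ge q q₀ with hlt | hge
  · have h1 : ((Finset.univ.filter fun x : E => g.eval x ^ e₀ = a).card : ℝ) ≤ q := by
      exact_mod_cast Finset.card_le_univ _
    have h2 : (q : ℝ) ≤ q₀ := by exact_mod_cast hlt.le
    have h3 : (0 : ℝ) ≤ q / d := by positivity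
    have h4 : (q₀ : ℝ) ≤ (q₀ + 10 * (m + 1 + c₀) : ℝ) := by
      have : (0 : ℝ) ≤ 10 * (m + 1 + c₀) := by positivity
      linarith
    have h5 : (q₀ : ℝ) ≤ (q₀ + 10 * (m + 1 + c₀) : ℝ) * √q := by nlinarith
    linarith
  set M := Nat.sqrt q with hMdef
  have hM1 : M * M ≤ q := Nat.sqrt_le q
  have hM2 : q ≤ M * M + 2 * M := by have := Nat.sqrt_le_add q; rw [← hMdef] at this; omega
  have hMc : c₀ + 1 ≤ M := by
    rw [hMdef, Nat.le_sqrt]; nlinarith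
  set J := M / d + c₀ with hJ
  set A := e₀ - m with hA
  have he : 1 + d * m ≤ d * e₀ := by omega
  have hme : m < e₀ := by
    by_contra h
    have := Nat.mul_le_mul_left d (not_lt.1 h)
    omega
  have hdA : d * A + d * m = d * e₀ := by
    rw [← mul_add]; congr 1; omega
  have hJd : M + d * (c₀ - 1) ≤ d * J := by
    have h1 := Nat.div_add_mod M d
    have h2 := Nat.mod_lt M hd
    have h3 : d * J = d * (M / d) + d * c₀ := by rw [hJ, mul_add]
    have h4 : d * c₀ = d * (c₀ - 1) + d := by rw [← Nat.mul_succ]; congr 1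
    omega
  have hAd2 : q ≤ 2 * (d * A) := by omega
  have hdim : M * (A + M * g.natDegree + J) < d * (J * A) := by
    rw [hm]
    exact stepanov_dimension_lt hMc hM1 hAd2 hJd (by rw [hJ]; gcongr; exact Nat.div_le_self _ _)
  have key := card_pow_eq_mul_le g (M := M) (e₀ := e₀) (d := d) (J := J) (A := A) hq (hm ▸ hcop) hg
    (by rw [hm]; omega) (Nat.sqrt_le_self q) hdim a
  rw [hm, ← hqdef] at key
  generalize (Finset.univ.filter fun x : E => g.eval x ^ e₀ = a).card = N at key ⊢
  have hMpos : 0 < M := by omega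
  have hMR : (0 : ℝ) < M := by exact_mod_cast hMpos
  have hdR : (0 : ℝ) < d := by exact_mod_cast hd
  have hJR : (J : ℝ) ≤ M / d + c₀ := by
    rw [hJ]; push_cast
    gcongr
    exact Nat.cast_div_le
  have hAq : A ≤ q := by
    have : e₀ ≤ d * e₀ := Nat.le_mul_of_pos_left _ hd
    omega
  have hqM : (q : ℝ) ≤ M * (M + 2) := by
    have : q ≤ M * (M + 2) := by nlinarith
    exact_mod_cast this
  have hMs : (M : ℝ) ≤ √q := Real.nat_sqrt_le_real_sqrt
  have key' : (N : ℝ) * M ≤ M * m + q * m + q + q * (M / d + c₀) := by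
    have : (N : ℝ) * M ≤ M * m + q * m + A + q * J := by exact_mod_cast key
    have h2 : (A : ℝ) ≤ q := by exact_mod_cast hAq
    have h3 : (q : ℝ) * J ≤ q * (M / d + c₀) := by gcongr
    linarith
  have hfin : (N : ℝ) ≤ m + (M + 2) * (m + 1 + c₀) + q / d := by
    rw [← mul_le_mul_iff_left₀ hMR]
    have h1 : (q : ℝ) * (m + 1 + c₀) ≤ M * (M + 2) * (m + 1 + c₀) := by gcongr
    have h2 : (q : ℝ) * (M / d + c₀) = q / d * M + q * c₀ := by ring
    nlinarith
  have h9 : (m : ℝ) + (M + 2) * (m + 1 + c₀) ≤ (q₀ + 10 * (m + 1 + c₀)) * √q := by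
    have h1 : (M + 2 : ℝ) ≤ 3 * √q := by linarith
    have h2 : (M + 2 : ℝ) * (m + 1 + c₀) ≤ 3 * √q * (m + 1 + c₀) := by gcongr
    have h3 : (m : ℝ) ≤ (m + 1 + c₀) * √q := by
      have : (0 : ℝ) ≤ c₀ := by positivity
      have : (0 : ℝ) ≤ m := by positivity
      nlinarith
    have h4 : (0 : ℝ) ≤ (q₀ : ℝ) * √q := by positivity
    have h5 : (0 : ℝ) ≤ (m + 1 + c₀ : ℝ) * √q := by positivity
    nlinarith
  linarith

noncomputable instance galoisFieldFintype (p : ℕ) [Fact p.Prime] (n : ℕ) :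
    Fintype (GaloisField p n) := Fintype.ofFinite _

theorem card_galoisField (p : ℕ) [Fact p.Prime] {n : ℕ} (hn : n ≠ 0) :
    Fintype.card (GaloisField p n) = p ^ n := by
  rw [Fintype.card_eq_nat_card, GaloisField.card p n hn]

open Polynomial in
theorem exists_norm_charSum_norm_le (p : ℕ) [Fact p.Prime] (f : (ZMod p)[X]) (hf : f ≠ 0)
    (hcop : Nat.Coprime f.natDegree (p - 1)) (χ : MulChar (ZMod p) ℂ) (hχ : χ ≠ 1) :
    ∃ C : ℝ, ∀ n : ℕ, n ≠ 0 →
      ‖∑ x : GaloisField p n, χ (Algebra.norm (ZMod p) (aeval x f))‖ ≤ C * √p ^ n := by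
  classical
  have hp : p.Prime := Fact.out
  have hd : 0 < p - 1 := by have := hp.two_le; omega
  obtain ⟨C, hC, hS⟩ := exists_card_pow_eq_le (p - 1) f.natDegree hd hcop
  refine ⟨(p - 1 : ℕ) * C + f.natDegree, fun n hn => ?_⟩
  set E := GaloisField p n
  have hcard : Fintype.card E = p ^ n := card_galoisField p hn
  set q : ℝ := (Fintype.card E : ℝ) with hq
  have hsq : √p ^ n = √q := by
    rw [hq, hcard, Nat.cast_pow, Real.sqrt_eq_rpow, Real.sqrt_eq_rpow, ← Real.rpow_natCast,
      ← Real.rpow_natCast, ← Real.rpow_mul (by positivity), ← Real.rpow_mul (by positivity),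
      mul_comm]
  have hq1 : 1 ≤ √q := by
    rw [Real.one_le_sqrt, hq, hcard]; exact_mod_cast Nat.one_le_pow _ _ hp.pos
  let g : E[X] := f.map (algebraMap (ZMod p) E)
  have hg : g ≠ 0 := (Polynomial.map_ne_zero_iff (algebraMap (ZMod p) E).injective).2 hf
  have hgd : g.natDegree = f.natDegree := natDegree_map _
  have he : (p - 1) * ((Nat.card E - 1) / (Nat.card (ZMod p) - 1)) + 1 = Fintype.card E := by
    rw [← Fintype.card_eq_nat_card, hcard, Nat.card_zmod, Nat.mul_div_cancel']
    · exact Nat.sub_add_cancel (Nat.one_le_pow _ _ hp.pos)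
    · simpa using Nat.sub_dvd_pow_sub_pow p 1 n
  let N : ZMod p → ℕ := fun a =>
    (Finset.univ.filter fun x : E => Algebra.norm (ZMod p) (aeval x f) = a).card
  have hN : ∀ a, (N a : ℝ) ≤ q / (p - 1 : ℕ) + C * √q := by
    intro a
    refine le_trans (le_of_eq ?_) (hS E g _ (algebraMap (ZMod p) E a) he hg hgd)
    refine congrArg _ (congrArg Finset.card (Finset.filter_congr fun x _ => ?_))
    rw [← (algebraMap (ZMod p) E).injective.eq_iff, FiniteField.algebraMap_norm_eq_pow,
      eval_map_algebraMap]
  have hN0 : N 0 ≤ f.natDegree := by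
    calc N 0 ≤ g.roots.toFinset.card := by
          refine Finset.card_le_card fun x hx => ?_
          simp only [Finset.mem_filter, Finset.mem_univ, true_and, Algebra.norm_eq_zero_iff] at hx
          rw [Multiset.mem_toFinset, mem_roots hg, IsRoot, eval_map_algebraMap, hx]
      _ ≤ g.roots.card := Multiset.toFinset_card_le _
      _ ≤ f.natDegree := hgd ▸ card_roots' g
  have hsumN : ∑ a, (N a : ℝ) = q := by
    rw [hq, ← Finset.card_univ, Finset.card_eq_sum_card_fiberwise
      (f := fun x : E => Algebra.norm (ZMod p) (aeval x f)) (t := Finset.univ) (by simp)]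
    push_cast
    rfl
  have hS1 : ∑ x : E, χ (Algebra.norm (ZMod p) (aeval x f)) = ∑ a, χ a * N a := by
    rw [← Finset.sum_fiberwise_of_maps_to (s := Finset.univ) (t := Finset.univ)
      (g := fun x : E => Algebra.norm (ZMod p) (aeval x f)) (by simp)]
    refine Finset.sum_congr rfl fun a _ => ?_
    rw [Finset.sum_congr rfl (g := fun _ => χ a) fun x hx => by
      rw [(Finset.mem_filter.1 hx).2]]
    rw [Finset.sum_const, nsmul_eq_mul, mul_comm]
  set U : ℝ := q / (p - 1 : ℕ) + C * √q with hU
  have hS2 : ∑ a, χ a * N a = - ∑ a, χ a * ((U - N a : ℝ) : ℂ) := by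
    push_cast
    simp only [mul_sub, Finset.sum_sub_distrib, ← Finset.sum_mul]
    rw [MulChar.sum_eq_zero_of_ne_one hχ]
    ring
  rw [hS1, hS2, norm_neg, hsq]
  calc ‖∑ a, χ a * ((U - N a : ℝ) : ℂ)‖
      = ‖∑ a ∈ Finset.univ.erase 0, χ a * ((U - N a : ℝ) : ℂ)‖ := by
        rw [← Finset.add_sum_erase _ _ (Finset.mem_univ (0 : ZMod p)), MulChar.map_zero, zero_mul,
          zero_add]
    _ ≤ ∑ a ∈ Finset.univ.erase (0 : ZMod p), (U - N a) := by
        refine (norm_sum_le _ _).trans (Finset.sum_le_sum fun a ha => ?_)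
        rw [norm_mul, Complex.norm_real, Real.norm_of_nonneg (by linarith [hN a])]
        refine mul_le_of_le_one_left (by linarith [hN a]) ?_
        exact DirichletCharacter.norm_le_one (n := p) χ a
    _ = (p - 1 : ℕ) * U - (q - N 0) := by
        rw [Finset.sum_sub_distrib, Finset.sum_const, Finset.card_erase_of_mem (Finset.mem_univ _),
          Finset.card_univ, ZMod.card, nsmul_eq_mul, ← hsumN,
          ← Finset.add_sum_erase _ _ (Finset.mem_univ (0 : ZMod p)), add_sub_cancel_left]
    _ = (p - 1 : ℕ) * C * √q + N 0 := by
        have : ((p - 1 : ℕ) : ℝ) ≠ 0 := by exact_mod_cast hd.ne'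
        rw [hU]; field_simp; ring
    _ ≤ ((p - 1 : ℕ) * C + f.natDegree) * √q := by
        have h1 : (N 0 : ℝ) ≤ f.natDegree := by exact_mod_cast hN0
        have h2 : (0 : ℝ) ≤ f.natDegree := by positivity
        nlinarith

open Polynomial in
theorem finite_monic_natDegree_eq {K : Type*} [Field K] [Finite K] (n : ℕ) :
    {g : K[X] | g.Monic ∧ g.natDegree = n}.Finite := by
  refine Set.Finite.of_injOn (f := fun g (i : Fin (n + 1)) => g.coeff i) (t := Set.univ)
    (fun _ _ => Set.mem_univ _) ?_ Set.finite_univ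
  rintro g ⟨-, hg⟩ h ⟨-, hh⟩ heq
  ext i
  rcases lt_or_ge i (n + 1) with hi | hi
  · exact congrFun heq ⟨i, hi⟩
  · rw [coeff_eq_zero_of_natDegree_lt (by omega), coeff_eq_zero_of_natDegree_lt (by omega)]

open Polynomial in
/-- The monic polynomials of degree `n` over a finite field. -/
noncomputable def monicsOfDegree (K : Type*) [Field K] [Finite K] (n : ℕ) : Finset K[X] :=
  (finite_monic_natDegree_eq (K := K) n).toFinset

open Polynomial in
theorem mem_monicsOfDegree {K : Type*} [Field K] [Finite K] {n : ℕ} {g : K[X]} :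
    g ∈ monicsOfDegree K n ↔ g.Monic ∧ g.natDegree = n := by
  simp [monicsOfDegree]

open Polynomial in
theorem card_minpoly_eq (p : ℕ) [Fact p.Prime] {k : ℕ} (hk : k ≠ 0) {P : (ZMod p)[X]}
    (hP : Irreducible P) (hm : P.Monic) [DecidableEq (ZMod p)[X]] :
    (Finset.univ.filter fun x : GaloisField p k => minpoly (ZMod p) x = P).card =
      if P.natDegree ∣ k then P.natDegree else 0 := by
  classical
  split_ifs with hdvd
  · have h1 := (hP.natDegree_dvd_iff_dvd_X_pow_card_pow_sub_X (n := k)).1 hdvd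
    have hfin : Module.finrank (ZMod p) (GaloisField p k) = k := GaloisField.finrank p hk
    have hne : (X ^ Nat.card (ZMod p) ^ k - X : (ZMod p)[X]) ≠ 0 :=
      FiniteField.X_pow_card_pow_sub_X_ne_zero _ hk Finite.one_lt_card
    have hsplit : (P.map (algebraMap (ZMod p) (GaloisField p k))).Splits := by
      refine Splits.of_dvd ?_ ?_ (map_dvd (algebraMap _ (GaloisField p k)) h1)
      · have := FiniteField.isSplittingField_sub (GaloisField p k) (ZMod p)
        rw [card_galoisField p hk] at this
        rw [Nat.card_zmod]
        exact this.splits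
      · exact map_ne_zero hne
    rw [← card_rootSet_eq_natDegree (PerfectField.separable_of_irreducible hP) hsplit,
      Fintype.card_subtype]
    refine congrArg Finset.card (Finset.filter_congr fun x _ => ?_)
    rw [mem_rootSet]
    constructor
    · rintro rfl
      exact ⟨hP.ne_zero, minpoly.aeval _ _⟩
    · rintro ⟨-, h⟩
      exact (minpoly.eq_of_irreducible_of_monic hP h hm).symm
  · rw [Finset.card_eq_zero, Finset.filter_eq_empty_iff]
    rintro x - rfl
    apply hdvd
    have := minpoly.degree_dvd (K := ZMod p) (Algebra.IsIntegral.isIntegral x)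
    rwa [GaloisField.finrank p hk] at this

open Polynomial in
/-- The monic polynomial of degree `k` whose roots are the conjugates of `x`, each with the
multiplicity of a characteristic polynomial. -/
noncomputable def conjPoly (p : ℕ) [Fact p.Prime] (k : ℕ) (x : GaloisField p k) : (ZMod p)[X] :=
  minpoly (ZMod p) x ^ (k / (minpoly (ZMod p) x).natDegree)

open Polynomial in
theorem minpoly_natDegree_dvd (p : ℕ) [Fact p.Prime] {k : ℕ} (hk : k ≠ 0) (x : GaloisField p k) :
    (minpoly (ZMod p) x).natDegree ∣ k := by
  have := minpoly.degree_dvd (K := ZMod p) (Algebra.IsIntegral.isIntegral x)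
  rwa [GaloisField.finrank p hk] at this

open Polynomial in
theorem conjPoly_mem (p : ℕ) [Fact p.Prime] {k : ℕ} (hk : k ≠ 0) (x : GaloisField p k) :
    conjPoly p k x ∈ monicsOfDegree (ZMod p) k := by
  rw [mem_monicsOfDegree, conjPoly, natDegree_pow]
  exact ⟨(minpoly.monic (Algebra.IsIntegral.isIntegral x)).pow _,
    Nat.div_mul_cancel (minpoly_natDegree_dvd p hk x)⟩

open Polynomial in
theorem sum_card_conjPoly_dvd (p : ℕ) [Fact p.Prime] {n : ℕ} {g : (ZMod p)[X]}
    (hg : g ∈ monicsOfDegree (ZMod p) n)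
    [DecidableRel ((· ∣ ·) : (ZMod p)[X] → (ZMod p)[X] → Prop)] :
    ∑ k ∈ Finset.Icc 1 n,
      (Finset.univ.filter fun x : GaloisField p k => conjPoly p k x ∣ g).card = n := by
  classical
  rw [mem_monicsOfDegree] at hg
  obtain ⟨hgm, hgn⟩ := hg
  have hg0 := hgm.ne_zero
  have hF : ∀ P ∈ UniqueFactorizationMonoid.normalizedFactors g, Irreducible P ∧ P.Monic := by
    intro P hP
    have hirr := UniqueFactorizationMonoid.irreducible_of_normalized_factor P hP
    refine ⟨hirr, ?_⟩
    have := UniqueFactorizationMonoid.normalize_normalized_factor P hP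
    rw [← this]
    exact monic_normalize hirr.ne_zero
  have hcount : ∀ P ∈ UniqueFactorizationMonoid.normalizedFactors g, ∀ j,
      P ^ j ∣ g ↔ j ≤ (UniqueFactorizationMonoid.normalizedFactors g).count P := by
    intro P hP j
    rw [pow_dvd_iff_le_emultiplicity,
      UniqueFactorizationMonoid.emultiplicity_eq_count_normalizedFactors (hF P hP).1 hg0,
      (hF P hP).2.normalize_eq_self, Nat.cast_le]
  have h1 : ∀ k ∈ Finset.Icc 1 n,
      (Finset.univ.filter fun x : GaloisField p k => conjPoly p k x ∣ g).card =
      ∑ P ∈ (UniqueFactorizationMonoid.normalizedFactors g).toFinset,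
        if P.natDegree ∣ k ∧ P ^ (k / P.natDegree) ∣ g then P.natDegree else 0 := by
    intro k hk
    have hk0 : k ≠ 0 := by rw [Finset.mem_Icc] at hk; omega
    rw [Finset.card_eq_sum_card_fiberwise (f := fun x : GaloisField p k => minpoly (ZMod p) x)
      (t := (UniqueFactorizationMonoid.normalizedFactors g).toFinset)]
    · refine Finset.sum_congr rfl fun P hP => ?_
      rw [Multiset.mem_toFinset] at hP
      rw [Finset.filter_filter]
      by_cases hPg : P ^ (k / P.natDegree) ∣ g
      · simp only [hPg, and_true]
        rw [← card_minpoly_eq p hk0 (hF P hP).1 (hF P hP).2]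
        refine congrArg Finset.card (Finset.filter_congr fun x _ => ?_)
        constructor
        · exact fun h => h.2
        · rintro rfl
          exact ⟨hPg, rfl⟩
      · rw [if_neg (fun h => hPg h.2), Finset.card_eq_zero, Finset.filter_eq_empty_iff]
        rintro x - ⟨h, rfl⟩
        exact hPg h
    · intro x hx
      rw [Finset.mem_coe, Finset.mem_filter] at hx
      rw [Finset.mem_coe, Multiset.mem_toFinset,
        UniqueFactorizationMonoid.mem_normalizedFactors_iff' hg0]
      have hxint := Algebra.IsIntegral.isIntegral (R := ZMod p) x
      refine ⟨minpoly.irreducible hxint, (minpoly.monic hxint).normalize_eq_self, ?_⟩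
      refine (dvd_pow_self _ ?_).trans hx.2
      exact (Nat.div_pos (Nat.le_of_dvd (Nat.pos_of_ne_zero hk0) (minpoly_natDegree_dvd p hk0 x))
        (minpoly.natDegree_pos hxint)).ne'
  rw [Finset.sum_congr rfl h1, Finset.sum_comm]
  have h2 : ∀ P ∈ (UniqueFactorizationMonoid.normalizedFactors g).toFinset,
      (∑ k ∈ Finset.Icc 1 n,
        if P.natDegree ∣ k ∧ P ^ (k / P.natDegree) ∣ g then P.natDegree else 0) =
      (UniqueFactorizationMonoid.normalizedFactors g).count P * P.natDegree := by
    intro P hP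
    rw [Multiset.mem_toFinset] at hP
    have hpos : 0 < P.natDegree := (hF P hP).1.natDegree_pos
    rw [← Finset.sum_filter, Finset.sum_const, smul_eq_mul]
    congr 1
    rw [← Nat.add_sub_cancel (n := Multiset.count P _) (m := 1), ← Nat.card_Icc, eq_comm]
    refine Finset.card_bij (fun j _ => j * P.natDegree) ?_ ?_ ?_
    · intro j hj
      rw [Finset.mem_Icc] at hj
      have hd := (hcount P hP j).2 hj.2
      rw [Finset.mem_filter, Finset.mem_Icc, Nat.mul_div_cancel _ hpos]
      refine ⟨⟨Nat.mul_pos hj.1 hpos, ?_⟩, dvd_mul_left _ _, hd⟩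
      have := natDegree_le_of_dvd hd hg0
      rwa [natDegree_pow, hgn] at this
    · intro a _ b _ h
      exact Nat.eq_of_mul_eq_mul_right hpos h
    · intro k hk
      rw [Finset.mem_filter, Finset.mem_Icc] at hk
      refine ⟨k / P.natDegree, ?_, Nat.div_mul_cancel hk.2.1⟩
      rw [Finset.mem_Icc]
      exact ⟨Nat.div_pos (Nat.le_of_dvd (by omega) hk.2.1) hpos, (hcount P hP _).1 hk.2.2⟩
  rw [Finset.sum_congr rfl h2, ← hgn]
  have h3 : g = (UniqueFactorizationMonoid.normalizedFactors g).prod := by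
    have := UniqueFactorizationMonoid.prod_normalizedFactors_eq hg0
    rw [this, hgm.normalize_eq_self]
  conv_rhs => rw [h3]
  rw [natDegree_multiset_prod_of_monic _ fun P hP => (hF P hP).2, Finset.sum_multiset_map_count]
  rfl

open Polynomial in
/-- The logarithmic derivative of the Euler product, compared coefficientwise. -/
theorem mul_sum_monicsOfDegree (p : ℕ) [Fact p.Prime] (ψ : (ZMod p)[X] →* ℂ) (n : ℕ) :
    (n : ℂ) * ∑ g ∈ monicsOfDegree (ZMod p) n, ψ g =
      ∑ k ∈ Finset.Icc 1 n, (∑ x : GaloisField p k, ψ (conjPoly p k x)) *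
        ∑ h ∈ monicsOfDegree (ZMod p) (n - k), ψ h := by
  classical
  have h1 : ∀ k ∈ Finset.Icc 1 n, (∑ x : GaloisField p k, ψ (conjPoly p k x)) *
        ∑ h ∈ monicsOfDegree (ZMod p) (n - k), ψ h =
      ∑ g ∈ monicsOfDegree (ZMod p) n, ψ g *
        (Finset.univ.filter fun x : GaloisField p k => conjPoly p k x ∣ g).card := by
    intro k hk
    rw [Finset.mem_Icc] at hk
    have h2 : ∀ x : GaloisField p k, ψ (conjPoly p k x) *
        ∑ h ∈ monicsOfDegree (ZMod p) (n - k), ψ h =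
        ∑ g ∈ monicsOfDegree (ZMod p) n, if conjPoly p k x ∣ g then ψ g else 0 := by
      intro x
      obtain ⟨hm, hd⟩ := mem_monicsOfDegree.1 (conjPoly_mem p (by omega : k ≠ 0) x)
      rw [Finset.mul_sum, ← Finset.sum_filter]
      refine Finset.sum_bij (fun h _ => conjPoly p k x * h) ?_ ?_ ?_ ?_
      · intro h hh
        rw [mem_monicsOfDegree] at hh
        rw [Finset.mem_filter, mem_monicsOfDegree]
        refine ⟨⟨hm.mul hh.1, ?_⟩, dvd_mul_right _ _⟩
        rw [hm.natDegree_mul hh.1, hd, hh.2]; omega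
      · intro a _ b _ hab
        exact mul_left_cancel₀ hm.ne_zero hab
      · intro g hg
        rw [Finset.mem_filter, mem_monicsOfDegree] at hg
        obtain ⟨⟨hgm, hgd⟩, h, rfl⟩ := hg
        have hhm : h.Monic := hm.of_mul_monic_left hgm
        refine ⟨h, ?_, rfl⟩
        rw [mem_monicsOfDegree]
        rw [hm.natDegree_mul hhm] at hgd
        exact ⟨hhm, by omega⟩
      · intro h _
        rw [map_mul]
    rw [Finset.sum_mul, Finset.sum_congr rfl fun x _ => h2 x, Finset.sum_comm]
    refine Finset.sum_congr rfl fun g _ => ?_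
    rw [← Finset.sum_filter, Finset.sum_const, nsmul_eq_mul, mul_comm]
  rw [Finset.sum_congr rfl h1, Finset.sum_comm, Finset.mul_sum]
  refine Finset.sum_congr rfl fun g hg => ?_
  rw [← Finset.mul_sum, mul_comm]
  congr 1
  have := sum_card_conjPoly_dvd p hg
  exact_mod_cast this.symm

open Polynomial in
theorem norm_sub_algebraMap_eq_eval_conjPoly (p : ℕ) [Fact p.Prime] {k : ℕ} (hk : k ≠ 0)
    (x : GaloisField p k) (b : ZMod p) :
    Algebra.norm (ZMod p) (x - algebraMap (ZMod p) _ b) = (-1) ^ k * (conjPoly p k x).eval b := by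
  have hxint : ∀ y : GaloisField p k, IsIntegral (ZMod p) y :=
    fun y => Algebra.IsIntegral.isIntegral y
  set y := x - algebraMap (ZMod p) (GaloisField p k) b with hy
  have hmin : minpoly (ZMod p) y = (minpoly (ZMod p) x).comp (X + C b) :=
    minpoly.sub_algebraMap x b
  have hdeg : (minpoly (ZMod p) y).natDegree = (minpoly (ZMod p) x).natDegree := by
    rw [hmin, natDegree_comp, natDegree_X_add_C, mul_one]
  have hfr : Module.finrank (IntermediateField.adjoin (ZMod p) {y}) (GaloisField p k) =
      k / (minpoly (ZMod p) x).natDegree := by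
    have h1 := Module.finrank_mul_finrank (ZMod p) (IntermediateField.adjoin (ZMod p) {y})
      (GaloisField p k)
    rw [IntermediateField.adjoin.finrank (hxint y), GaloisField.finrank p hk, hdeg] at h1
    exact (Nat.div_eq_of_eq_mul_right (minpoly.natDegree_pos (hxint x)) h1.symm).symm
  have hgen := Algebra.PowerBasis.norm_gen_eq_coeff_zero_minpoly
    (IntermediateField.adjoin.powerBasis (hxint y))
  rw [IntermediateField.adjoin.powerBasis_gen, IntermediateField.adjoin.powerBasis_dim,
    IntermediateField.minpoly_gen, hdeg, hmin, coeff_zero_eq_eval_zero] at hgen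
  rw [Algebra.norm_eq_norm_adjoin, hfr, hgen, conjPoly, mul_pow, ← pow_mul,
    Nat.mul_div_cancel' (minpoly_natDegree_dvd p hk x), eval_pow, eval_comp]
  simp

open Polynomial in
/-- The completely multiplicative function `g ↦ χ (∏ g(b i) ^ n i)` on polynomials. -/
noncomputable def resultantChar {p : ℕ} [Fact p.Prime] {ι : Type*} [Fintype ι] (b : ι → ZMod p)
    (n : ι → ℕ) (χ : MulChar (ZMod p) ℂ) : (ZMod p)[X] →* ℂ :=
  χ.toMonoidHom.comp (∏ i, (evalRingHom (b i)).toMonoidHom ^ n i)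

open Polynomial in
theorem resultantChar_apply {p : ℕ} [Fact p.Prime] {ι : Type*} [Fintype ι] (b : ι → ZMod p)
    (n : ι → ℕ) (χ : MulChar (ZMod p) ℂ) (g : (ZMod p)[X]) :
    resultantChar b n χ g = χ (∏ i, g.eval (b i) ^ n i) := by
  simp [resultantChar, MonoidHom.finsetProd_apply]

open Polynomial in
theorem exists_sum_resultantChar_conjPoly_le {p : ℕ} [Fact p.Prime] {ι : Type*} [Fintype ι]
    (b : ι → ZMod p) (n : ι → ℕ) (hcop : Nat.Coprime (∑ i, n i) (p - 1))
    (χ : MulChar (ZMod p) ℂ) (hχ : χ ≠ 1) :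
    ∃ C : ℝ, ∀ k : ℕ, k ≠ 0 →
      ‖∑ x : GaloisField p k, resultantChar b n χ (conjPoly p k x)‖ ≤ C * √p ^ k := by
  have hm : ∀ i ∈ Finset.univ, ((X - C (b i) : (ZMod p)[X]) ^ n i).Monic :=
    fun i _ => (monic_X_sub_C _).pow _
  have hdeg : (∏ i, (X - C (b i) : (ZMod p)[X]) ^ n i).natDegree = ∑ i, n i := by
    rw [natDegree_prod_of_monic _ _ hm]
    simp
  obtain ⟨M, hC⟩ := exists_norm_charSum_norm_le p (∏ i, (X - C (b i) : (ZMod p)[X]) ^ n i)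
    (monic_prod_of_monic _ _ hm).ne_zero (by rwa [hdeg]) χ hχ
  refine ⟨M, fun k hk => ?_⟩
  have h1 : ∀ x : GaloisField p k,
      χ (Algebra.norm (ZMod p) (aeval x (∏ i, (X - C (b i) : (ZMod p)[X]) ^ n i))) =
      χ (((-1) ^ k) ^ ∑ i, n i) * resultantChar b n χ (conjPoly p k x) := by
    intro x
    rw [resultantChar_apply, ← map_mul, map_prod, map_prod, ← Finset.prod_pow_eq_pow_sum,
      ← Finset.prod_mul_distrib]
    congr 1
    refine Finset.prod_congr rfl fun i _ => ?_
    rw [map_pow, map_pow, map_sub, aeval_X, aeval_C, norm_sub_algebraMap_eq_eval_conjPoly p hk,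
      mul_pow]
  have h2 := hC k hk
  rw [Finset.sum_congr rfl fun x _ => h1 x, ← Finset.mul_sum, norm_mul] at h2
  have h3 : ‖χ (((-1) ^ k) ^ ∑ i, n i)‖ = 1 := by
    rw [map_pow, map_pow, norm_pow, norm_pow]
    have := DirichletCharacter.unit_norm_eq_one (n := p) χ (-1)
    simp only [Units.val_neg, Units.val_one] at this
    rw [this]; simp
  rwa [h3, one_mul] at h2

theorem exists_pow_sum_ne_one {p : ℕ} [Fact p.Prime] {ι : Type*} [Fintype ι] [DecidableEq ι]
    (b : ι → ZMod p) (n : ι → ℕ) (hcop : Nat.Coprime (∑ i, n i) (p - 1))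
    (χ : MulChar (ZMod p) ℂ) (hχ : χ ≠ 1) :
    ∃ b₀ ∈ Finset.univ.image b, ∃ v : (ZMod p)ˣ,
      χ v ^ (∑ i ∈ Finset.univ.filter fun i => b i = b₀, n i) ≠ 1 := by
  by_contra! h
  apply hχ
  ext v
  rw [MulChar.one_apply_coe]
  have h1 : χ v ^ (∑ i, n i) = 1 := by
    rw [← Finset.sum_fiberwise_of_maps_to (s := Finset.univ) (t := Finset.univ.image b) (g := b)
      (fun i _ => Finset.mem_image_of_mem _ (Finset.mem_univ i)), ← Finset.prod_pow_eq_pow_sum]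
    exact Finset.prod_eq_one fun b₀ hb => h b₀ hb v
  have h2 : χ v ^ (p - 1) = 1 := by
    rw [← map_pow, ← Units.val_pow_eq_pow_val, ZMod.units_pow_card_sub_one_eq_one]
    simp
  rw [← orderOf_dvd_iff_pow_eq_one] at h1 h2
  exact orderOf_eq_one_iff.1 (Nat.dvd_one.1 (hcop ▸ Nat.dvd_gcd h1 h2))

open Polynomial in
theorem sum_monicsOfDegree_resultantChar_eq_zero {p : ℕ} [Fact p.Prime] {ι : Type*} [Fintype ι]
    (b : ι → ZMod p) (n : ι → ℕ) (hcop : Nat.Coprime (∑ i, n i) (p - 1))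
    (χ : MulChar (ZMod p) ℂ) (hχ : χ ≠ 1) {d : ℕ} (hd : Fintype.card ι ≤ d) :
    ∑ g ∈ monicsOfDegree (ZMod p) d, resultantChar b n χ g = 0 := by
  classical
  obtain ⟨b₀, hb₀, v, hv⟩ := exists_pow_sum_ne_one b n hcop χ hχ
  set s := Finset.univ.image b with hs
  set E := ∑ i ∈ Finset.univ.filter fun i => b i = b₀, n i with hE
  set l : (ZMod p)[X] := Lagrange.basis s id b₀ with hl
  have hl1 : l.eval b₀ = 1 := Lagrange.eval_basis_self (Set.injOn_id _) hb₀
  have hl0 : ∀ c ∈ s, c ≠ b₀ → l.eval c = 0 := fun c hc hcb =>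
    Lagrange.eval_basis_of_ne (v := id) (Ne.symm hcb) hc
  have hldeg : l.degree < d := by
    rw [hl, Lagrange.degree_basis (Set.injOn_id _) hb₀]
    have h1 : s.card ≤ Fintype.card ι := Finset.card_image_le
    have h2 : 0 < s.card := Finset.card_pos.2 ⟨_, hb₀⟩
    exact_mod_cast (by omega : s.card - 1 < d)
  let φ : (ZMod p) → (ZMod p)[X] → (ZMod p)[X] := fun w g => g + C ((w - 1) * g.eval b₀) * l
  have hφmem : ∀ w, ∀ g ∈ monicsOfDegree (ZMod p) d, φ w g ∈ monicsOfDegree (ZMod p) d := by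
    intro w g hg
    rw [mem_monicsOfDegree] at hg ⊢
    have hlt : (C ((w - 1) * g.eval b₀) * l).degree < g.degree := by
      rw [degree_eq_natDegree hg.1.ne_zero, hg.2]
      refine lt_of_le_of_lt ?_ hldeg
      rw [← smul_eq_C_mul]
      exact degree_smul_le _ _
    refine ⟨hg.1.add_of_left hlt, ?_⟩
    rw [natDegree_add_eq_left_of_degree_lt hlt, hg.2]
  have hφ0 : ∀ w g, (φ w g).eval b₀ = w * g.eval b₀ := by
    intro w g
    simp only [φ, eval_add, eval_mul, eval_C, hl1]
    ring
  have hφc : ∀ w g, ∀ c ∈ s, c ≠ b₀ → (φ w g).eval c = g.eval c := by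
    intro w g c hc hcb
    simp [φ, hl0 c hc hcb]
  have hinv : ∀ w w' : ZMod p, w' * w = 1 → ∀ g, φ w' (φ w g) = g := by
    intro w w' hw g
    have : φ w' (φ w g) = φ w g + C ((w' - 1) * (φ w g).eval b₀) * l := rfl
    rw [this, hφ0]
    simp only [φ]
    rw [add_assoc, ← add_mul, ← C_add]
    have : (w - 1) * eval b₀ g + (w' - 1) * (w * eval b₀ g) = 0 := by
      linear_combination eval b₀ g * hw
    rw [this]; simp
  have hψ : ∀ g, resultantChar b n χ (φ v g) = χ v ^ E * resultantChar b n χ g := by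
    intro g
    rw [resultantChar_apply, resultantChar_apply, ← map_pow, ← map_mul]
    congr 1
    rw [hE, ← Finset.prod_pow_eq_pow_sum, Finset.prod_filter, ← Finset.prod_mul_distrib]
    refine Finset.prod_congr rfl fun i _ => ?_
    split_ifs with hi
    · rw [hi, hφ0, mul_pow]
    · rw [hφc _ _ _ (Finset.mem_image_of_mem _ (Finset.mem_univ i)) hi, one_mul]
  have hsum : ∑ g ∈ monicsOfDegree (ZMod p) d, resultantChar b n χ g =
      χ v ^ E * ∑ g ∈ monicsOfDegree (ZMod p) d, resultantChar b n χ g := by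
    rw [Finset.mul_sum, eq_comm]
    refine Finset.sum_bij' (fun g _ => φ v g) (fun g _ => φ (v⁻¹ : (ZMod p)ˣ) g)
      (hφmem _) (hφmem _) (fun g _ => hinv _ _ v.inv_mul g) (fun g _ => hinv _ _ v.mul_inv g)
      fun g _ => (hψ g).symm
  have : (1 - χ v ^ E) * ∑ g ∈ monicsOfDegree (ZMod p) d, resultantChar b n χ g = 0 := by
    linear_combination hsum
  exact (mul_eq_zero.1 this).resolve_left (sub_ne_zero.2 (Ne.symm hv))

open Polynomial in
theorem hasSum_coeff_mul_pow (P : ℂ[X]) (u : ℂ) :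
    HasSum (fun n => P.coeff n * u ^ n) (P.eval u) := by
  rw [eval_eq_sum_range]
  refine hasSum_sum_of_ne_finset_zero fun n hn => ?_
  rw [Finset.mem_range, not_lt] at hn
  rw [coeff_eq_zero_of_natDegree_lt (by omega), zero_mul]

open Polynomial in
theorem coeff_X_mul_derivative (P : ℂ[X]) (n : ℕ) :
    (X * derivative P).coeff n = n * P.coeff n := by
  cases n with
  | zero => simp
  | succ n => rw [coeff_X_mul, coeff_derivative]; push_cast; ring

open Polynomial in
theorem norm_eval_X_mul_derivative_le (P : ℂ[X]) (S : ℕ → ℂ) {M ρ r : ℝ} (hρ : 0 ≤ ρ)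
    (hr : 0 ≤ r) (hρr : ρ * r < 1)
    (hrec : ∀ n : ℕ, (n : ℂ) * P.coeff n = ∑ k ∈ Finset.Icc 1 n, S k * P.coeff (n - k))
    (hS : ∀ k, k ≠ 0 → ‖S k‖ ≤ M * ρ ^ k) {u : ℂ} (hu : ‖u‖ ≤ r) :
    ‖(X * derivative P).eval u‖ ≤ (∑' k, |M| * (ρ * r) ^ k) * ‖P.eval u‖ := by
  have hgeo : Summable fun k : ℕ => |M| * (ρ * r) ^ k :=
    (summable_geometric_of_lt_one (by positivity) hρr).mul_left _
  set f : ℕ → ℂ := fun k => (if k = 0 then 0 else S k) * u ^ k with hf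
  have hfn : ∀ k, ‖f k‖ ≤ |M| * (ρ * r) ^ k := by
    intro k
    simp only [hf]
    split_ifs with hk
    · rw [zero_mul, norm_zero]; positivity
    · rw [norm_mul, norm_pow, mul_pow, ← mul_assoc]
      gcongr
      refine (hS k hk).trans ?_
      gcongr
      exact le_abs_self M
  have hfs : Summable fun k => ‖f k‖ := hgeo.of_nonneg_of_le (fun _ => norm_nonneg _) hfn
  have hgs : Summable fun n => ‖P.coeff n * u ^ n‖ := by
    refine summable_of_ne_finset_zero (s := Finset.range (P.natDegree + 1)) fun n hn => ?_
    rw [Finset.mem_range, not_lt] at hn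
    rw [coeff_eq_zero_of_natDegree_lt (by omega), zero_mul, norm_zero]
  have hprod := tsum_mul_tsum_eq_tsum_sum_antidiagonal_of_summable_norm hfs hgs
  have hanti : ∀ n, ∑ kl ∈ Finset.HasAntidiagonal.antidiagonal n,
      f kl.1 * (P.coeff kl.2 * u ^ kl.2) =
      (X * derivative P).coeff n * u ^ n := by
    intro n
    rw [coeff_X_mul_derivative, hrec, Finset.sum_mul,
      Finset.Nat.sum_antidiagonal_eq_sum_range_succ
        (fun i j => f i * (P.coeff j * u ^ j)),
      Finset.range_eq_Ico, Finset.sum_eq_sum_Ico_succ_bot (by omega)]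
    simp only [hf, if_true, zero_mul, zero_add]
    refine Finset.sum_congr (by ext; simp) fun k hk => ?_
    rw [Finset.mem_Icc] at hk
    rw [if_neg (by omega)]
    conv_rhs => rw [← Nat.add_sub_cancel' hk.2, pow_add, Nat.add_sub_cancel_left]
    ring
  rw [tsum_congr hanti, (hasSum_coeff_mul_pow P u).tsum_eq,
    (hasSum_coeff_mul_pow _ u).tsum_eq] at hprod
  rw [← hprod, norm_mul]
  gcongr
  exact tsum_of_norm_bounded hgeo.hasSum hfn

open Polynomial Topology in
theorem one_le_norm_root_mul (P : ℂ[X]) (S : ℕ → ℂ) {M ρ : ℝ} (hρ : 0 < ρ)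
    (h0 : P.coeff 0 = 1)
    (hrec : ∀ n : ℕ, (n : ℂ) * P.coeff n = ∑ k ∈ Finset.Icc 1 n, S k * P.coeff (n - k))
    (hS : ∀ k, k ≠ 0 → ‖S k‖ ≤ M * ρ ^ k) {u : ℂ} (hu : P.IsRoot u) : 1 ≤ ‖u‖ * ρ := by
  by_contra! hlt
  have hP : P ≠ 0 := by rintro rfl; simp at h0
  have hu0 : u ≠ 0 := by
    rintro rfl
    rw [IsRoot, ← coeff_zero_eq_eval_zero, h0] at hu
    exact one_ne_zero hu
  obtain ⟨r, hr1, hr2⟩ : ∃ r, ‖u‖ < r ∧ r < ρ⁻¹ :=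
    exists_between (by rwa [lt_inv_comm₀ (norm_pos_iff.2 hu0) hρ,
      lt_inv_comm₀ hρ (norm_pos_iff.2 hu0),
      ← one_div, lt_div_iff₀ hρ])
  have hr0 : 0 ≤ r := (norm_nonneg u).trans hr1.le
  have hρr : ρ * r < 1 := by
    have := mul_lt_mul_of_pos_left hr2 hρ
    rwa [mul_inv_cancel₀ hρ.ne'] at this
  set K := ∑' k, |M| * (ρ * r) ^ k
  obtain ⟨G, hG, hGd⟩ := exists_eq_pow_rootMultiplicity_mul_and_not_dvd P hP u
  obtain ⟨m, hm⟩ : ∃ m, P.rootMultiplicity u = m + 1 :=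
    Nat.exists_eq_succ_of_ne_zero ((rootMultiplicity_pos hP).2 hu).ne'
  rw [hm] at hG
  rw [dvd_iff_isRoot, IsRoot] at hGd
  set Q : ℂ[X] := X * ((m + 1 : ℂ[X]) * G + (X - C u) * derivative G) with hQ
  have hder : X * derivative P = (X - C u) ^ m * Q := by
    rw [hG, hQ]
    simp only [derivative_mul, derivative_pow, derivative_sub, derivative_X, derivative_C,
      map_natCast]
    push_cast
    ring
  have hbd : ∀ᶠ z in 𝓝[≠] u, ‖Q.eval z‖ ≤ K * (‖z - u‖ * ‖G.eval z‖) := by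
    have hball : ∀ᶠ z in 𝓝[≠] u, ‖z‖ < r :=
      (continuous_norm.continuousAt.eventually_lt_const hr1).filter_mono nhdsWithin_le_nhds
    filter_upwards [hball, self_mem_nhdsWithin] with z hz hzu
    have h1 := norm_eval_X_mul_derivative_le P S hρ.le hr0 hρr hrec hS hz.le
    have hpos : 0 < ‖z - u‖ ^ m := pow_pos (norm_pos_iff.2 (sub_ne_zero.2 hzu)) _
    rw [hder, hG] at h1
    simp only [eval_mul, eval_pow, eval_sub, eval_X, eval_C, norm_mul, norm_pow] at h1
    refine le_of_mul_le_mul_left ?_ hpos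
    refine h1.trans (le_of_eq ?_)
    ring
  have hlim1 : Filter.Tendsto (fun z => ‖Q.eval z‖) (𝓝[≠] u) (𝓝 ‖Q.eval u‖) :=
    (Q.continuous.norm.tendsto u).mono_left nhdsWithin_le_nhds
  have hlim2 : Filter.Tendsto (fun z => K * (‖z - u‖ * ‖G.eval z‖)) (𝓝[≠] u)
      (𝓝 (K * (‖u - u‖ * ‖G.eval u‖))) := by
    refine Filter.Tendsto.mono_left ?_ nhdsWithin_le_nhds
    have hc : Continuous fun z => K * (‖z - u‖ * ‖G.eval z‖) :=
      continuous_const.mul ((continuous_id.sub continuous_const).norm.mul G.continuous.norm)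
    exact hc.tendsto u
  have hle := le_of_tendsto_of_tendsto hlim1 hlim2 hbd
  rw [sub_self, norm_zero, zero_mul, mul_zero, norm_le_zero_iff, hQ] at hle
  simp only [eval_mul, eval_add, eval_sub, eval_X, eval_C, sub_self, zero_mul, add_zero,
    eval_natCast, eval_one] at hle
  have : (m + 1 : ℂ) ≠ 0 := by exact_mod_cast Nat.succ_ne_zero m
  exact (mul_ne_zero hu0 (mul_ne_zero this hGd)) hle

open Polynomial in
theorem norm_coeff_one_le (P : ℂ[X]) (S : ℕ → ℂ) {M ρ : ℝ} (hρ : 0 < ρ)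
    (h0 : P.coeff 0 = 1)
    (hrec : ∀ n : ℕ, (n : ℂ) * P.coeff n = ∑ k ∈ Finset.Icc 1 n, S k * P.coeff (n - k))
    (hS : ∀ k, k ≠ 0 → ‖S k‖ ≤ M * ρ ^ k) : ‖P.coeff 1‖ ≤ P.natDegree * ρ := by
  have hP : P ≠ 0 := by rintro rfl; simp at h0
  have hev : P.eval 0 = 1 := by rw [← coeff_zero_eq_eval_zero, h0]
  have h1 : P.coeff 1 = (P.roots.map fun z ↦ 1 / (0 - z)).sum := by
    rw [← (IsAlgClosed.splits P).eval_derivative_div_eval_of_ne_zero (x := 0) (by simp [hev]),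
      hev, div_one, ← coeff_zero_eq_eval_zero, coeff_derivative]
    simp
  rw [h1]
  refine (norm_multiset_sum_le _).trans ?_
  rw [Multiset.map_map]
  refine (Multiset.sum_le_card_nsmul _ ρ ?_).trans ?_
  · intro y hy
    rw [Multiset.mem_map] at hy
    obtain ⟨z, hz, rfl⟩ := hy
    have h2 := one_le_norm_root_mul P S hρ h0 hrec hS (mem_roots'.1 hz).2
    have hz0 : 0 < ‖z‖ := by
      by_contra! h
      have := mul_nonpos_of_nonpos_of_nonneg h hρ.le
      linarith
    simp only [Function.comp, zero_sub, norm_div, norm_one, norm_neg]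
    rw [div_le_iff₀ hz0]
    linarith
  · rw [Multiset.card_map, nsmul_eq_mul]
    gcongr
    exact card_roots' P

open Polynomial in
/-- **Weil's bound** for multiplicative character sums of products of linear factors, when the
degree is coprime to `p - 1`. -/
theorem norm_sum_mulChar_prod_le {p : ℕ} [Fact p.Prime] {ι : Type*} [Fintype ι]
    (b : ι → ZMod p) (n : ι → ℕ) (hcop : Nat.Coprime (∑ i, n i) (p - 1))
    (χ : MulChar (ZMod p) ℂ) (hχ : χ ≠ 1) :
    ‖∑ x : ZMod p, χ (∏ i, (x - b i) ^ n i)‖ ≤ Fintype.card ι * √p := by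
  classical
  have hp : 0 < p := (Fact.out : p.Prime).pos
  set A : ℕ → ℂ := fun d => ∑ g ∈ monicsOfDegree (ZMod p) d, resultantChar b n χ g with hA
  have hA0 : A 0 = 1 := by
    have : monicsOfDegree (ZMod p) 0 = {1} := by
      ext g
      rw [mem_monicsOfDegree, Finset.mem_singleton]
      exact ⟨fun h => h.1.natDegree_eq_zero.1 h.2, by rintro rfl; simp⟩
    simp [hA, this]
  set P : ℂ[X] := ∑ d ∈ Finset.range (Fintype.card ι), monomial d (A d) with hP
  have hcoeff : ∀ d, P.coeff d = A d := by
    intro d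
    rw [hP, finsetSum_coeff]
    simp only [coeff_monomial, Finset.sum_ite_eq', Finset.mem_range]
    split_ifs with h
    · rfl
    · exact (sum_monicsOfDegree_resultantChar_eq_zero b n hcop χ hχ (not_lt.1 h)).symm
  have hdeg : P.natDegree ≤ Fintype.card ι := by
    rw [natDegree_le_iff_coeff_eq_zero]
    intro d hd
    rw [hcoeff]
    exact sum_monicsOfDegree_resultantChar_eq_zero b n hcop χ hχ hd.le
  obtain ⟨M, hM⟩ := exists_sum_resultantChar_conjPoly_le b n hcop χ hχ
  have hmain := norm_coeff_one_le P
    (fun k => ∑ x : GaloisField p k, resultantChar b n χ (conjPoly p k x)) (M := M) (ρ := √p)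
    (by positivity) (by rw [hcoeff, hA0])
    (fun d => by simp only [hcoeff, hA]; exact mul_sum_monicsOfDegree p _ d) hM
  have hA1 : A 1 = χ ((-1) ^ ∑ i, n i) * ∑ x : ZMod p, χ (∏ i, (x - b i) ^ n i) := by
    rw [Finset.mul_sum, hA]
    refine Finset.sum_bij' (fun g _ => - g.coeff 0) (fun x _ => X - C x) ?_ ?_ ?_ ?_ ?_
    · intro g _; exact Finset.mem_univ _
    · intro x _
      rw [mem_monicsOfDegree]
      exact ⟨monic_X_sub_C x, natDegree_X_sub_C x⟩
    · intro g hg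
      rw [mem_monicsOfDegree] at hg
      conv_rhs => rw [hg.1.eq_X_add_C hg.2]
      simp
    · intro x _; simp
    · intro g hg
      rw [mem_monicsOfDegree] at hg
      rw [resultantChar_apply, ← map_mul]
      congr 1
      rw [← Finset.prod_pow_eq_pow_sum, ← Finset.prod_mul_distrib]
      refine Finset.prod_congr rfl fun i _ => ?_
      rw [← mul_pow]
      conv_lhs => rw [hg.1.eq_X_add_C hg.2]
      simp only [eval_add, eval_X, eval_C]
      ring
  have h3 : ‖χ ((-1) ^ ∑ i, n i)‖ = 1 := by
    rw [map_pow, norm_pow]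
    have := DirichletCharacter.unit_norm_eq_one (n := p) χ (-1)
    simp only [Units.val_neg, Units.val_one] at this
    rw [this, one_pow]
  rw [hcoeff, hA1, norm_mul, h3, one_mul] at hmain
  refine hmain.trans ?_
  gcongr

theorem norm_sum_mulChar_prod_add_le {p : ℕ} [Fact p.Prime] {ι : Type*} [Fintype ι]
    (a : ι → ZMod p) (n : ι → ℕ) (χ : MulChar (ZMod p) ℂ) (hχ : χ ≠ 1) (i₀ : ι)
    (hn₀ : n i₀ ≠ 0) (hcop : Nat.Coprime (n i₀) (p - 1)) (hdvd : p - 1 ∣ ∑ i, n i)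
    (ha : ∀ j, j ≠ i₀ → a j ≠ a i₀) :
    ‖∑ x : ZMod p, χ (∏ i, (x + a i) ^ n i)‖ ≤ Fintype.card ι * √p := by
  classical
  have hp : p.Prime := Fact.out
  set d : ι → ZMod p := fun i => a i - a i₀ with hd
  have hd0 : ∀ j, j ≠ i₀ → d j ≠ 0 := fun j hj => sub_ne_zero.2 (ha j hj)
  set c : ZMod p := ∏ j : {j // j ≠ i₀}, d j ^ n j with hc
  have hsplit : ∑ i, n i = n i₀ + ∑ j : {j // j ≠ i₀}, n j := by
    rw [Fintype.sum_eq_add_sum_subtype_ne n i₀]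
  set b : {j // j ≠ i₀} → ZMod p := fun j => -(d j)⁻¹ with hb
  set W : ZMod p → ℂ := fun y => χ (∏ j : {j // j ≠ i₀}, (y - b j) ^ n j) with hW
  have hcop' : Nat.Coprime (∑ j : {j // j ≠ i₀}, n j) (p - 1) := by
    obtain ⟨t, ht⟩ := hdvd
    rw [hsplit] at ht
    refine Nat.Coprime.symm ?_
    have hg : Nat.gcd (p - 1) (∑ j : {j // j ≠ i₀}, n j) ∣ n i₀ := by
      refine (Nat.dvd_add_left (Nat.gcd_dvd_right (p - 1) (∑ j : {j // j ≠ i₀}, n j))).1 ?_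
      rw [ht]
      exact (Nat.gcd_dvd_left _ _).mul_right _
    exact Nat.eq_one_of_dvd_coprimes hcop hg (Nat.gcd_dvd_left _ _)
  have hweil := norm_sum_mulChar_prod_le b (fun j => n j) hcop' χ hχ
  have hcard : (Fintype.card {j // j ≠ i₀} : ℝ) = Fintype.card ι - 1 := by
    rw [Fintype.card_subtype_compl, Fintype.card_subtype_eq,
      Nat.cast_sub (Fintype.card_pos_iff.2 ⟨i₀⟩), Nat.cast_one]
  have hkey : ∑ x : ZMod p, χ (∏ i, (x + a i) ^ n i) = χ c * (∑ y, W y - W 0) := by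
    have h1 : χ (∏ i, (-a i₀ + a i) ^ n i) = 0 := by
      rw [Finset.prod_eq_zero (Finset.mem_univ i₀) (by rw [neg_add_cancel, zero_pow hn₀])]
      exact χ.map_zero
    rw [← Finset.add_sum_erase _ _ (Finset.mem_univ (-a i₀)), h1, zero_add,
      ← Finset.add_sum_erase _ W (Finset.mem_univ 0), add_sub_cancel_left, Finset.mul_sum]
    refine Finset.sum_bij' (fun x _ => (x + a i₀)⁻¹) (fun y _ => y⁻¹ - a i₀) ?_ ?_ ?_ ?_ ?_
    · intro x hx
      rw [Finset.mem_erase] at hx ⊢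
      refine ⟨inv_ne_zero fun h => hx.1 ?_, Finset.mem_univ _⟩
      exact eq_neg_of_add_eq_zero_left h
    · intro y hy
      rw [Finset.mem_erase] at hy ⊢
      refine ⟨fun h => inv_ne_zero hy.1 ?_, Finset.mem_univ _⟩
      linear_combination h
    · intro x _; simp
    · intro y _; simp
    · intro x hx
      rw [Finset.mem_erase] at hx
      have hy : x + a i₀ ≠ 0 := fun h => hx.1 (eq_neg_of_add_eq_zero_left h)
      set y := (x + a i₀)⁻¹ with hydef
      have hy0 : y ≠ 0 := inv_ne_zero hy
      simp only [hW, hc]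
      rw [← map_mul, ← Finset.prod_mul_distrib]
      congr 1
      have h2 : y ^ (∑ i, n i) = 1 := by
        obtain ⟨t, ht⟩ := hdvd
        rw [ht, pow_mul, ZMod.pow_card_sub_one_eq_one hy0, one_pow]
      rw [← mul_one (∏ i, (x + a i) ^ n i), ← h2, ← Finset.prod_pow_eq_pow_sum,
        ← Finset.prod_mul_distrib,
        Fintype.prod_eq_mul_prod_subtype_ne (fun i => (x + a i) ^ n i * y ^ n i) i₀]
      have h3 : (x + a i₀) ^ n i₀ * y ^ n i₀ = 1 := by
        rw [← mul_pow, hydef, mul_inv_cancel₀ hy, one_pow]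
      rw [h3, one_mul]
      refine Finset.prod_congr rfl fun j _ => ?_
      rw [← mul_pow, ← mul_pow]
      congr 1
      have h4 : x = y⁻¹ - a i₀ := by rw [hydef, inv_inv]; ring
      have h5 := hd0 j j.2
      rw [h4, hb]
      simp only
      rw [sub_neg_eq_add, mul_add, mul_inv_cancel₀ h5, hd]
      simp only
      field_simp
      ring
  have hle1 : ∀ z : ZMod p, ‖χ z‖ ≤ 1 := fun z => DirichletCharacter.norm_le_one (n := p) χ z
  have hsqrt : 1 ≤ √(p : ℝ) := Real.one_le_sqrt.2 (by exact_mod_cast hp.one_lt.le)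
  rw [hkey, norm_mul]
  calc ‖χ c‖ * ‖∑ y, W y - W 0‖ ≤ 1 * (‖∑ y, W y‖ + ‖W 0‖) := by
        gcongr
        · exact hle1 _
        · exact norm_sub_le _ _
    _ ≤ 1 * ((Fintype.card ι - 1) * √p + 1) := by
        gcongr
        · rw [← hcard]; exact hweil
        · exact hle1 _
    _ ≤ Fintype.card ι * √p := by linarith

/-- The complete sum `∑ₓ ∏ᵢ χ^{±}(x + mᵢ)`, where `σ i` tells whether the `i`-th factor is
`χ` or its conjugate. -/
noncomputable def shiftSum {q : ℕ} [NeZero q] (χ : DirichletCharacter ℂ q) {ι : Type*} [Fintype ι]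
    (σ : ι → Bool) (m : ι → ℤ) : ℂ :=
  ∑ x : ZMod q, ∏ i, if σ i then χ (x + m i) else star (χ (x + m i))

theorem norm_shiftSum_le {q : ℕ} [NeZero q] (χ : DirichletCharacter ℂ q) {ι : Type*} [Fintype ι]
    (σ : ι → Bool) (m : ι → ℤ) : ‖shiftSum χ σ m‖ ≤ q := by
  refine (norm_sum_le_of_le _ (f := fun x : ZMod q => ∏ i, if σ i then χ (x + m i) else
    star (χ (x + m i))) (n := fun _ => 1) fun x _ => ?_).trans (by simp [ZMod.card])
  rw [norm_prod]
  refine Finset.prod_le_one (fun _ _ => norm_nonneg _) fun i _ => ?_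
  split_ifs
  · exact χ.norm_le_one _
  · rw [norm_star]; exact χ.norm_le_one _

theorem norm_shiftSum_prime_le {p : ℕ} [Fact p.Prime] (χ : DirichletCharacter ℂ p) (hχ : χ ≠ 1)
    {ι : Type*} [Fintype ι] (σ : ι → Bool) (hσ : ∑ i, (if σ i then 1 else -1 : ℤ) = 0)
    (m : ι → ℤ) (i₀ : ι) (hm : ∀ j, j ≠ i₀ → (m j : ZMod p) ≠ m i₀) :
    ‖shiftSum χ σ m‖ ≤ Fintype.card ι * √p := by
  have hp : p.Prime := Fact.out
  have hp2 : p ≠ 2 := by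
    rintro rfl
    apply hχ
    ext u
    rw [Subsingleton.elim u 1]; simp
  have hp3 : 3 ≤ p := by have := hp.two_le; omega
  have hstar : ∀ z : ZMod p, star (χ z) = χ (z ^ (p - 2)) := by
    intro z
    by_cases hz : z = 0
    · subst hz
      rw [zero_pow (by omega)]
      have : χ 0 = 0 := MulChar.map_zero χ
      rw [this, star_zero]
    · have h1 : χ z * χ (z ^ (p - 2)) = 1 := by
        rw [← map_mul, ← pow_succ', show p - 2 + 1 = p - 1 by omega,
          ZMod.pow_card_sub_one_eq_one hz, map_one]
      have h2 : ‖χ z‖ = 1 := by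
        have := χ.unit_norm_eq_one (Units.mk0 z hz)
        simpa using this
      have h3 : χ z ≠ 0 := by rw [← norm_pos_iff, h2]; exact one_pos
      have h4 : χ z * star (χ z) = 1 := by
        rw [Complex.star_def, Complex.mul_conj, Complex.normSq_eq_norm_sq, h2]; simp
      exact mul_left_cancel₀ h3 (h4.trans h1.symm)
  set n : ι → ℕ := fun i => if σ i then 1 else p - 2 with hn
  have hsum : shiftSum χ σ m = ∑ x : ZMod p, χ (∏ i, (x + m i) ^ n i) := by
    refine Finset.sum_congr rfl fun x _ => ?_
    rw [map_prod]
    refine Finset.prod_congr rfl fun i _ => ?_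
    simp only [hn]
    split_ifs
    · rw [pow_one]
    · exact hstar _
  rw [hsum]
  refine norm_sum_mulChar_prod_add_le _ n χ hχ i₀ ?_ ?_ ?_ hm
  · simp only [hn]; split_ifs <;> omega
  · simp only [hn]
    split_ifs
    · exact Nat.coprime_one_left _
    · rw [show p - 1 = p - 2 + 1 by omega]
      exact Nat.coprime_self_add_right.2 (Nat.coprime_one_right _)
  · zify
    rw [Int.natCast_sub hp.one_lt.le, ← Int.modEq_zero_iff_dvd]
    have h1 : ∀ i, (n i : ℤ) ≡ (if σ i then 1 else -1) [ZMOD (p - (1 : ℕ))] := by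
      intro i
      simp only [hn]
      split_ifs
      · rfl
      · rw [Int.modEq_iff_dvd, Nat.cast_sub hp.two_le]
        exact ⟨-1, by push_cast; ring⟩
    rw [← hσ]
    exact Int.ModEq.sum fun i _ => h1 i

theorem isUnit_iff_castHom_ne_zero {p : ℕ} [Fact p.Prime] (x : ZMod (p ^ 2)) :
    IsUnit x ↔ ZMod.castHom (dvd_pow_self p two_ne_zero) (ZMod p) x ≠ 0 := by
  have hp : p.Prime := Fact.out
  have : NeZero (p ^ 2) := ⟨pow_ne_zero _ hp.ne_zero⟩
  obtain ⟨n, rfl⟩ := ZMod.natCast_zmod_surjective x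
  rw [map_natCast, ZMod.isUnit_iff_coprime, Nat.coprime_pow_right_iff two_pos, Ne,
    ZMod.natCast_eq_zero_iff, Nat.coprime_comm, hp.coprime_iff_not_dvd]

theorem card_filter_castHom_mem_le {p : ℕ} [Fact p.Prime] [NeZero (p ^ 2)]
    [DecidableEq (ZMod p)] (R : Finset (ZMod p)) :
    (Finset.univ.filter fun x : ZMod (p ^ 2) =>
      ZMod.castHom (dvd_pow_self p two_ne_zero) (ZMod p) x ∈ R).card ≤ p * R.card := by
  classical
  have hp : p.Prime := Fact.out
  refine Finset.card_le_mul_card_image_of_maps_to (f := ZMod.castHom (dvd_pow_self p two_ne_zero)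
    (ZMod p)) (fun x hx => (Finset.mem_filter.1 hx).2) p fun c _ => ?_
  calc _ ≤ (Finset.univ : Finset (Fin p)).card := by
        refine Finset.card_le_card_of_injOn
          (fun x => ⟨x.val / p, Nat.div_lt_of_lt_mul (by rw [← sq]; exact x.val_lt)⟩)
          (fun _ _ => Finset.mem_coe.2 (Finset.mem_univ _)) ?_
        intro x hx y hy hxy
        rw [Finset.mem_coe, Finset.mem_filter] at hx hy
        have h1 := hx.2.trans hy.2.symm
        rw [← ZMod.natCast_zmod_val x, ← ZMod.natCast_zmod_val y, map_natCast, map_natCast,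
          ZMod.natCast_eq_natCast_iff'] at h1
        have h2 : x.val / p = y.val / p := congrArg Fin.val hxy
        apply ZMod.val_injective
        rw [← Nat.div_add_mod x.val p, ← Nat.div_add_mod y.val p, h1, h2]
    _ = p := by simp

open Polynomial in
theorem exists_finset_sum_inv_eq_zero {K : Type*} [Field K] {ι : Type*} [Fintype ι]
    (ε a : ι → K) (i₀ : ι) (hε : ε i₀ ≠ 0) (ha : ∀ j, j ≠ i₀ → a j ≠ a i₀) :
    ∃ R : Finset K, R.card ≤ Fintype.card ι ∧
      ∀ x, (∀ i, x + a i ≠ 0) → ∑ i, ε i * (x + a i)⁻¹ = 0 → x ∈ R := by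
  classical
  set P : K[X] := ∑ i, C (ε i) * ∏ j ∈ Finset.univ.erase i, (X + C (a j)) with hP
  have hev : ∀ x, P.eval x = ∑ i, ε i * ∏ j ∈ Finset.univ.erase i, (x + a j) := by
    intro x
    simp [hP, eval_finsetSum, eval_prod]
  have hP0 : P ≠ 0 := by
    intro h
    have h1 := hev (-a i₀)
    rw [h, eval_zero, Finset.sum_eq_single i₀] at h1
    · refine mul_ne_zero hε (Finset.prod_ne_zero_iff.2 fun j hj => ?_) h1.symm
      rw [neg_add_eq_sub]
      exact sub_ne_zero.2 (ha j (Finset.ne_of_mem_erase hj))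
    · intro i _ hi
      rw [Finset.prod_eq_zero (Finset.mem_erase.2 ⟨Ne.symm hi, Finset.mem_univ i₀⟩)
        (neg_add_cancel _), mul_zero]
    · exact fun h => absurd (Finset.mem_univ _) h
  refine ⟨P.roots.toFinset, ?_, fun x hx h => ?_⟩
  · refine (Multiset.toFinset_card_le _).trans ((card_roots' P).trans ?_)
    refine natDegree_sum_le_of_forall_le _ _ fun i _ => ?_
    refine (natDegree_C_mul_le _ _).trans ?_
    rw [natDegree_prod_of_monic _ _ fun j _ => monic_X_add_C _]
    simp
  · rw [Multiset.mem_toFinset, mem_roots hP0, IsRoot, hev]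
    have h2 : ∀ i, ε i * ∏ j ∈ Finset.univ.erase i, (x + a j) =
        (ε i * (x + a i)⁻¹) * ∏ j, (x + a j) := by
      intro i
      rw [← Finset.mul_prod_erase _ _ (Finset.mem_univ i), mul_assoc, inv_mul_cancel_left₀ (hx i)]
    rw [Finset.sum_congr rfl fun i _ => h2 i, ← Finset.sum_mul, h, zero_mul]

theorem norm_shiftSum_prime_sq_le {p : ℕ} [Fact p.Prime] [NeZero (p ^ 2)]
    (χ : DirichletCharacter ℂ (p ^ 2)) {t₀ : ZMod (p ^ 2)}
    (ht₀ : χ (1 + (p : ZMod (p ^ 2)) * t₀) ≠ 1)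
    {ι : Type*} [Fintype ι] (σ : ι → Bool)
    (m : ι → ℤ) (i₀ : ι) (hm : ∀ j, j ≠ i₀ → (m j : ZMod p) ≠ m i₀) :
    ‖shiftSum χ σ m‖ ≤ Fintype.card ι * p := by
  classical
  have hp : p.Prime := Fact.out
  set φ := ZMod.castHom (dvd_pow_self p two_ne_zero) (ZMod p) with hφ
  have hpp : (p : ZMod (p ^ 2)) * p = 0 := by
    rw [← sq]; exact_mod_cast ZMod.natCast_self (p ^ 2)
  set g : ZMod (p ^ 2) → ℂ := fun t => χ (1 + (p : ZMod (p ^ 2)) * t) with hg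
  have hgadd : ∀ s t, g (s + t) = g s * g t := by
    intro s t
    simp only [hg]
    rw [← map_mul]
    congr 1
    linear_combination - s * t * hpp
  have hg0 : g 0 = 1 := by simp [hg]
  have hgsum : ∀ (s : Finset ι) (h : ι → ZMod (p ^ 2)), g (∑ i ∈ s, h i) = ∏ i ∈ s, g (h i) := by
    intro s h
    induction s using Finset.induction_on with
    | empty => simp [hg0]
    | insert i s hi ih => rw [Finset.sum_insert hi, Finset.prod_insert hi, hgadd, ih]
  have hgu : ∀ t, IsUnit (1 + p * t : ZMod (p ^ 2)) := by
    intro t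
    rw [isUnit_iff_castHom_ne_zero]
    simp
  have hg1 : ∀ t, ‖g t‖ = 1 := fun t => by
    obtain ⟨u, hu⟩ := hgu t
    simp only [hg]
    rw [← hu, χ.unit_norm_eq_one]
  have hgstar : ∀ t, star (g t) = g (-t) := by
    intro t
    have h3 : g t ≠ 0 := by rw [← norm_pos_iff, hg1]; exact one_pos
    have h4 : g t * star (g t) = 1 := by
      rw [Complex.star_def, Complex.mul_conj, Complex.normSq_eq_norm_sq, hg1]; simp
    refine mul_left_cancel₀ h3 (h4.trans ?_)
    rw [← hgadd, add_neg_cancel, hg0]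
  set f : ZMod (p ^ 2) → ℂ := fun x =>
    ∏ i, if σ i then χ (x + (m i : ZMod (p ^ 2))) else star (χ (x + (m i : ZMod (p ^ 2)))) with hf
  set l : ZMod (p ^ 2) → ZMod (p ^ 2) := fun x =>
    ∑ i, (if σ i then 1 else -1) * (x + (m i : ZMod (p ^ 2)))⁻¹ with hl
  have hf0 : ∀ x, (∃ i, ¬ IsUnit (x + m i : ZMod (p ^ 2))) → f x = 0 := by
    rintro x ⟨i, hi⟩
    refine Finset.prod_eq_zero (Finset.mem_univ i) ?_
    have : χ (x + (m i : ZMod (p ^ 2))) = 0 := χ.map_nonunit hi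
    rw [this]; simp
  have hshift : ∀ x t, f (x + p * t) = f x * g (t * l x) := by
    intro x t
    by_cases hx : ∃ i, ¬ IsUnit (x + m i : ZMod (p ^ 2))
    · rw [hf0 x hx, zero_mul]
      obtain ⟨i, hi⟩ := hx
      refine (hf0 _ ⟨i, ?_⟩)
      rw [isUnit_iff_castHom_ne_zero] at hi ⊢
      simpa using hi
    · push Not at hx
      simp only [hf, hl, Finset.mul_sum]
      rw [hgsum, ← Finset.prod_mul_distrib]
      refine Finset.prod_congr rfl fun i _ => ?_
      have h1 : χ (x + (p : ZMod (p ^ 2)) * t + (m i : ZMod (p ^ 2)))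
          = χ (x + (m i : ZMod (p ^ 2))) * g (t * (x + m i)⁻¹) := by
        simp only [hg]
        rw [← map_mul]
        congr 1
        have := ZMod.mul_inv_of_unit _ (hx i)
        linear_combination -p * t * this
      split_ifs
      · rw [h1, one_mul]
      · rw [h1, star_mul, hgstar, mul_comm]
        congr 2
        ring
  have hinner : ∀ x, IsUnit (l x) → ∑ t, g (t * l x) = 0 := by
    intro x hx
    have h1 : ∑ t, g (t * l x) = g t₀ * ∑ t, g (t * l x) := by
      rw [Finset.mul_sum]
      rw [← Equiv.sum_comp (Equiv.addLeft (t₀ * (l x)⁻¹)) (fun t => g (t * l x))]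
      refine Finset.sum_congr rfl fun t _ => ?_
      rw [Equiv.coe_addLeft, add_mul, hgadd, mul_assoc, ZMod.inv_mul_of_unit _ hx, mul_one]
    have : (1 - g t₀) * ∑ t, g (t * l x) = 0 := by linear_combination h1
    exact (mul_eq_zero.1 this).resolve_left (sub_ne_zero.2 (Ne.symm ht₀))
  obtain ⟨R, hRc, hR⟩ := exists_finset_sum_inv_eq_zero
    (fun i => if σ i then (1 : ZMod p) else -1) (fun i => (m i : ZMod p)) i₀
    (by split_ifs <;> simp) hm
  have hcardq : (Fintype.card (ZMod (p ^ 2)) : ℝ) = (p : ℝ) ^ 2 := by rw [ZMod.card]; simp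
  have hterm : ∀ x, ‖f x * ∑ t, g (t * l x)‖ ≤ if φ x ∈ R then (p : ℝ) ^ 2 else 0 := by
    intro x
    by_cases hx : ∃ i, ¬ IsUnit (x + m i : ZMod (p ^ 2))
    · rw [hf0 x hx, zero_mul, norm_zero]; positivity
    push Not at hx
    by_cases hlx : IsUnit (l x)
    · rw [hinner x hlx, mul_zero, norm_zero]; positivity
    · have hmem : φ x ∈ R := by
        rw [isUnit_iff_castHom_ne_zero, not_not] at hlx
        have hne : ∀ i, φ x + m i ≠ 0 := by
          intro i
          have := (isUnit_iff_castHom_ne_zero _).1 (hx i)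
          rwa [map_add, map_intCast] at this
        refine hR _ hne ?_
        rw [← hlx, hl, map_sum]
        refine Finset.sum_congr rfl fun i _ => ?_
        rw [map_mul]
        congr 1
        · split_ifs <;> simp
        · refine inv_eq_of_mul_eq_one_right ?_
          have h1 := congrArg φ (ZMod.mul_inv_of_unit _ (hx i))
          rw [map_mul, map_one, map_add, map_intCast] at h1
          exact h1
      rw [if_pos hmem, norm_mul]
      have h1 : ‖f x‖ ≤ 1 := by
        rw [hf, norm_prod]
        refine Finset.prod_le_one (fun _ _ => norm_nonneg _) fun i _ => ?_
        split_ifs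
        · exact χ.norm_le_one _
        · rw [norm_star]; exact χ.norm_le_one _
      have h2 : ‖∑ t, g (t * l x)‖ ≤ (p : ℝ) ^ 2 := by
        refine (norm_sum_le _ _).trans ?_
        simp only [hg1, Finset.sum_const, Finset.card_univ, nsmul_eq_mul, mul_one]
        exact hcardq.le
      calc _ ≤ 1 * (p : ℝ) ^ 2 := by gcongr
        _ = _ := one_mul _
  have havg : (p : ℂ) ^ 2 * ∑ x, f x = ∑ x, f x * ∑ t, g (t * l x) := by
    simp_rw [Finset.mul_sum, ← hshift]
    rw [Finset.sum_comm]
    have h1 : ∀ t : ZMod (p ^ 2), ∑ x, f (x + (p : ZMod (p ^ 2)) * t) = ∑ x, f x := fun t =>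
      Equiv.sum_comp (Equiv.addRight ((p : ZMod (p ^ 2)) * t)) f
    simp_rw [h1]
    rw [Finset.sum_const, Finset.card_univ, ZMod.card, nsmul_eq_mul, Finset.mul_sum]
    push_cast
    rfl
  have hS : shiftSum χ σ m = ∑ x, f x := rfl
  have hpos : (0 : ℝ) < (p : ℝ) ^ 2 := by have := hp.pos; positivity
  rw [hS]
  refine le_of_mul_le_mul_left ?_ hpos
  calc (p : ℝ) ^ 2 * ‖∑ x, f x‖ = ‖(p : ℂ) ^ 2 * ∑ x, f x‖ := by simp
    _ = ‖∑ x, f x * ∑ t, g (t * l x)‖ := by rw [havg]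
    _ ≤ ∑ x, if φ x ∈ R then (p : ℝ) ^ 2 else 0 := norm_sum_le_of_le _ fun x _ => hterm x
    _ = (Finset.univ.filter fun x => φ x ∈ R).card * (p : ℝ) ^ 2 := by
        rw [← Finset.sum_filter, Finset.sum_const, nsmul_eq_mul]
    _ ≤ (p * Fintype.card ι : ℕ) * (p : ℝ) ^ 2 := by
        gcongr
        exact (card_filter_castHom_mem_le R).trans (Nat.mul_le_mul_left _ hRc)
    _ = (p : ℝ) ^ 2 * (Fintype.card ι * p) := by push_cast; ring

/-- A character mod `q` is locally nontrivial if for each prime `p ∣ q` it is nontrivial on the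
units congruent to `1` mod `q / p`. For primitive characters this always holds. -/
def IsLocallyNontrivial {q : ℕ} (χ : DirichletCharacter ℂ q) : Prop :=
  ∀ p : ℕ, p.Prime → p ∣ q → ∃ t : ZMod q,
    IsUnit (1 + ((q / p : ℕ) : ZMod q) * t) ∧ χ (1 + ((q / p : ℕ) : ZMod q) * t) ≠ 1

theorem DirichletCharacter.IsPrimitive.isLocallyNontrivial {q : ℕ} [NeZero q]
    {χ : DirichletCharacter ℂ q} (hχ : χ.IsPrimitive) : IsLocallyNontrivial χ := by
  intro p hp hpq
  by_contra! h
  have hd : q / p ∣ q := Nat.div_dvd_of_dvd hpq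
  have hfac : χ.FactorsThrough (q / p) := by
    rw [DirichletCharacter.factorsThrough_iff_ker_unitsMap hd]
    intro u hu
    rw [MonoidHom.mem_ker] at hu ⊢
    have h1 : (ZMod.castHom hd (ZMod (q / p))) (u : ZMod q) = 1 := by
      have := congrArg Units.val hu
      simpa [ZMod.unitsMap] using this
    obtain ⟨n, hn⟩ := ZMod.intCast_surjective (u : ZMod q)
    rw [← hn, map_intCast] at h1
    have h2 : ((q / p : ℕ) : ℤ) ∣ n - 1 := by
      rw [← ZMod.intCast_eq_intCast_iff_dvd_sub, h1, Int.cast_one]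
    obtain ⟨t, ht⟩ := h2
    have h3 : (u : ZMod q) = 1 + ((q / p : ℕ) : ZMod q) * (t : ZMod q) := by
      rw [← hn, show n = 1 + ((q / p : ℕ) : ℤ) * t by linarith,
        Int.cast_add, Int.cast_one, Int.cast_mul, Int.cast_natCast]
    have h4 := h t (h3 ▸ u.isUnit)
    rw [← h3] at h4
    ext
    simpa using h4
  have hle := Nat.sInf_le (χ.mem_conductorSet_iff.2 hfac)
  have hq : sInf (χ.conductorSet) = q := hχ
  rw [hq] at hle
  exact absurd (Nat.div_lt_self (NeZero.pos q) hp.one_lt) (by omega)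

theorem exists_shiftSum_eq_mul {q₁ q₂ : ℕ} [NeZero q₁] [NeZero q₂] [NeZero (q₁ * q₂)]
    (h : Nat.Coprime q₁ q₂) {χ : DirichletCharacter ℂ (q₁ * q₂)} (hχ : IsLocallyNontrivial χ) :
    ∃ (χ₁ : DirichletCharacter ℂ q₁) (χ₂ : DirichletCharacter ℂ q₂),
      IsLocallyNontrivial χ₁ ∧ IsLocallyNontrivial χ₂ ∧
      ∀ {ι : Type} [Fintype ι] (σ : ι → Bool) (m : ι → ℤ),
        shiftSum χ σ m = shiftSum χ₁ σ m * shiftSum χ₂ σ m := by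
  set e := ZMod.chineseRemainder h with he
  set χ₁ : DirichletCharacter ℂ q₁ :=
    { toFun := fun y => χ (e.symm (y, 1))
      map_one' := by rw [← Prod.one_eq_mk, map_one, map_one]
      map_mul' := fun a b => by rw [← map_mul, ← map_mul, Prod.mk_mul_mk, one_mul]
      map_nonunit' := fun a ha => χ.map_nonunit fun hu => ha (by
        have := (hu.map e).map (RingHom.fst (ZMod q₁) (ZMod q₂))
        simpa using this) } with hχ₁
  set χ₂ : DirichletCharacter ℂ q₂ :=
    { toFun := fun y => χ (e.symm (1, y))
      map_one' := by rw [← Prod.one_eq_mk, map_one, map_one]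
      map_mul' := fun a b => by rw [← map_mul, ← map_mul, Prod.mk_mul_mk, one_mul]
      map_nonunit' := fun a ha => χ.map_nonunit fun hu => ha (by
        have := (hu.map e).map (RingHom.snd (ZMod q₁) (ZMod q₂))
        simpa using this) } with hχ₂
  have happ₁ : ∀ y, χ₁ y = χ (e.symm (y, 1)) := fun y => rfl
  have happ₂ : ∀ y, χ₂ y = χ (e.symm (1, y)) := fun y => rfl
  have hmul : ∀ x, χ x = χ₁ (e x).1 * χ₂ (e x).2 := by
    intro x
    rw [happ₁, happ₂, ← map_mul, ← map_mul, Prod.mk_mul_mk, one_mul, mul_one, Prod.mk.eta,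
      RingEquiv.symm_apply_apply]
  refine ⟨χ₁, χ₂, ?_, ?_, ?_⟩
  · intro p hp hpq
    obtain ⟨t, hu, ht⟩ := hχ p hp (hpq.mul_right _)
    rw [Nat.mul_div_right_comm hpq, hmul] at ht
    rw [Nat.mul_div_right_comm hpq] at hu
    have h2 : (e (1 + ((q₁ / p * q₂ : ℕ) : ZMod (q₁ * q₂)) * t)).2 = 1 := by
      rw [map_add, map_mul, map_natCast, map_one]
      simp
    have h1 : (e (1 + ((q₁ / p * q₂ : ℕ) : ZMod (q₁ * q₂)) * t)).1 =
        1 + ((q₁ / p : ℕ) : ZMod q₁) * (q₂ * (e t).1) := by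
      rw [map_add, map_mul, map_natCast, map_one]
      simp [mul_assoc]
    refine ⟨q₂ * (e t).1, ?_, ?_⟩
    · rw [← h1]
      exact (hu.map e).map (RingHom.fst (ZMod q₁) (ZMod q₂))
    · rw [h2, h1, map_one, mul_one] at ht
      exact ht
  · intro p hp hpq
    obtain ⟨t, hu, ht⟩ := hχ p hp (hpq.mul_left _)
    rw [Nat.mul_div_assoc _ hpq, hmul] at ht
    rw [Nat.mul_div_assoc _ hpq] at hu
    have h2 : (e (1 + ((q₁ * (q₂ / p) : ℕ) : ZMod (q₁ * q₂)) * t)).1 = 1 := by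
      rw [map_add, map_mul, map_natCast, map_one]
      simp
    have h1 : (e (1 + ((q₁ * (q₂ / p) : ℕ) : ZMod (q₁ * q₂)) * t)).2 =
        1 + ((q₂ / p : ℕ) : ZMod q₂) * (q₁ * (e t).2) := by
      rw [map_add, map_mul, map_natCast, map_one]
      simp only [Nat.cast_mul, Prod.snd_add, Prod.snd_one, Prod.snd_mul, Prod.snd_natCast]
      ring
    refine ⟨q₁ * (e t).2, ?_, ?_⟩
    · rw [← h1]
      exact (hu.map e).map (RingHom.snd (ZMod q₁) (ZMod q₂))
    · rw [h2, h1, map_one, one_mul] at ht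
      exact ht
  · intro ι _ σ m
    simp only [shiftSum]
    rw [Finset.sum_mul_sum, ← Finset.sum_product', Finset.univ_product_univ]
    refine Fintype.sum_equiv e.toEquiv _ _ fun x => ?_
    rw [← Finset.prod_mul_distrib]
    refine Finset.prod_congr rfl fun i _ => ?_
    have h1 : χ (x + m i) = χ₁ ((e x).1 + m i) * χ₂ ((e x).2 + m i) := by
      rw [hmul, map_add, map_intCast]
      rfl
    rw [h1, star_mul']
    split_ifs <;> rfl

/-- The product of the differences `m j - m i₀`. -/
def diffProd {ι : Type*} [Fintype ι] [DecidableEq ι] (m : ι → ℤ) (i₀ : ι) : ℤ :=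
  ∏ j ∈ Finset.univ.erase i₀, (m j - m i₀)

theorem intCast_ne_of_not_dvd_diffProd {ι : Type*} [Fintype ι] [DecidableEq ι] {m : ι → ℤ} {i₀ : ι}
    {p : ℕ} (hp : ¬ p ∣ (diffProd m i₀).natAbs) (j : ι) (hj : j ≠ i₀) :
    (m j : ZMod p) ≠ m i₀ := by
  intro h
  apply hp
  rw [← Int.natCast_dvd]
  refine Dvd.dvd.trans ?_ (Finset.dvd_prod_of_mem _ (Finset.mem_erase.2 ⟨hj, Finset.mem_univ _⟩))
  rw [← ZMod.intCast_eq_intCast_iff_dvd_sub, h]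

theorem norm_shiftSum_prime_pow_le {p k q : ℕ} [NeZero q] (hp : p.Prime) (hk0 : k ≠ 0)
    (hk : k ≤ 2) (hq : q = p ^ k) {χ : DirichletCharacter ℂ q} (hχ : IsLocallyNontrivial χ)
    {ι : Type*} [Fintype ι] [DecidableEq ι] (σ : ι → Bool)
    (hσ : ∑ i, (if σ i then 1 else -1 : ℤ) = 0) (m : ι → ℤ) (i₀ : ι) :
    ‖shiftSum χ σ m‖ ≤ Fintype.card ι * √q * Nat.gcd q (diffProd m i₀).natAbs := by
  have hpF : Fact p.Prime := ⟨hp⟩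
  have hcard : (1 : ℝ) ≤ Fintype.card ι := by exact_mod_cast Fintype.card_pos_iff.2 ⟨i₀⟩
  by_cases hdvd : p ∣ (diffProd m i₀).natAbs
  · have hpg : p ≤ Nat.gcd q (diffProd m i₀).natAbs := by
      refine Nat.le_of_dvd (Nat.gcd_pos_of_pos_left _ (NeZero.pos q)) (Nat.dvd_gcd ?_ hdvd)
      rw [hq]; exact dvd_pow_self p hk0
    have hsq : √(q : ℝ) ≤ p := by
      rw [Real.sqrt_le_left (by positivity), hq]
      have : p ^ k ≤ p ^ 2 := Nat.pow_le_pow_right hp.pos hk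
      exact_mod_cast this
    calc ‖shiftSum χ σ m‖ ≤ q := norm_shiftSum_le χ σ m
      _ = 1 * √q * √q := by rw [one_mul, Real.mul_self_sqrt (by positivity)]
      _ ≤ Fintype.card ι * √q * Nat.gcd q (diffProd m i₀).natAbs := by
          gcongr
          exact hsq.trans (by exact_mod_cast hpg)
  · have hne := intCast_ne_of_not_dvd_diffProd hdvd
    have hg : (1 : ℝ) ≤ Nat.gcd q (diffProd m i₀).natAbs := by
      exact_mod_cast Nat.gcd_pos_of_pos_left _ (NeZero.pos q)
    have hmain : ‖shiftSum χ σ m‖ ≤ Fintype.card ι * √q := by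
      obtain rfl | rfl : k = 1 ∨ k = 2 := by omega
      · rw [pow_one] at hq
        subst hq
        refine norm_shiftSum_prime_le χ ?_ σ hσ m i₀ hne
        rintro rfl
        obtain ⟨t, hu, ht⟩ := hχ q hp dvd_rfl
        exact ht (MulChar.one_apply hu)
      · subst hq
        obtain ⟨t, -, ht⟩ := hχ p hp (dvd_pow_self p two_ne_zero)
        rw [show p ^ 2 / p = p by rw [sq, Nat.mul_div_cancel _ hp.pos]] at ht
        have h1 := norm_shiftSum_prime_sq_le χ ht σ m i₀ hne
        rwa [Nat.cast_pow, Real.sqrt_sq (by positivity)]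
    calc _ ≤ Fintype.card ι * √q * 1 := by rwa [mul_one]
      _ ≤ _ := by gcongr

/-- Complete sums of shifted characters to cube-free moduli exhibit square-root cancellation. -/
theorem norm_shiftSum_cubeFree_le {ι : Type} [Fintype ι] [DecidableEq ι] (σ : ι → Bool)
    (hσ : ∑ i, (if σ i then 1 else -1 : ℤ) = 0) (m : ι → ℤ) (i₀ : ι) (q : ℕ) [NeZero q]
    (hcf : ∀ p : ℕ, p.Prime → ¬ p ^ 3 ∣ q) {χ : DirichletCharacter ℂ q}
    (hχ : IsLocallyNontrivial χ) :
    ‖shiftSum χ σ m‖ ≤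
      (Fintype.card ι : ℝ) ^ q.primeFactors.card * √q * Nat.gcd q (diffProd m i₀).natAbs := by
  suffices H : ∀ q : ℕ, ∀ _ : NeZero q, (∀ p : ℕ, p.Prime → ¬ p ^ 3 ∣ q) →
      ∀ χ : DirichletCharacter ℂ q, IsLocallyNontrivial χ → ‖shiftSum χ σ m‖ ≤
      (Fintype.card ι : ℝ) ^ q.primeFactors.card * √q * Nat.gcd q (diffProd m i₀).natAbs from
    H q _ hcf χ hχ
  clear hχ χ hcf
  intro q
  induction q using Nat.recOnPosPrimePosCoprime with
  | prime_pow p n hp hn =>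
    intro hq hcf χ hχ
    have hn2 : n ≤ 2 := by
      by_contra! h
      exact hcf p hp (pow_dvd_pow p h)
    have := norm_shiftSum_prime_pow_le hp hn.ne' hn2 rfl hχ σ hσ m i₀
    rwa [Nat.primeFactors_prime_pow hn.ne' hp, Finset.card_singleton, pow_one]
  | zero => intro hq; exact absurd rfl hq.out
  | one =>
    intro hq hcf χ hχ
    simpa using norm_shiftSum_le χ σ m
  | coprime a b ha hb hab iha ihb =>
    intro hq hcf χ hχ
    have : NeZero a := ⟨by omega⟩
    have : NeZero b := ⟨by omega⟩
    obtain ⟨χ₁, χ₂, h₁, h₂, hS⟩ := exists_shiftSum_eq_mul hab hχ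
    have h3 := iha ‹_› (fun p hp h => hcf p hp (h.mul_right _)) χ₁ h₁
    have h4 := ihb ‹_› (fun p hp h => hcf p hp (h.mul_left _)) χ₂ h₂
    rw [hS, norm_mul, hab.primeFactors_mul, Finset.card_union_of_disjoint hab.disjoint_primeFactors,
      Nat.gcd_comm (a * b), hab.gcd_mul, Nat.gcd_comm _ a, Nat.gcd_comm _ b, Nat.cast_mul,
      Nat.cast_mul, Real.sqrt_mul (by positivity), pow_add]
    refine (mul_le_mul h3 h4 (norm_nonneg _) (by positivity)).trans (le_of_eq ?_)
    ring

theorem exists_succ_le_mul_rpow {η : ℝ} (hη : 0 < η) :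
    ∃ K : ℝ, 1 ≤ K ∧ ∀ p a : ℕ, 2 ≤ p → (a + 1 : ℝ) ≤ K * ((p : ℝ) ^ a) ^ η := by
  have hlog : 0 < Real.log 2 := Real.log_pos one_lt_two
  refine ⟨1 + (η * Real.log 2)⁻¹, by simp; positivity, fun p a hp => ?_⟩
  have h1 : ((2 : ℝ) ^ a) ^ η ≤ ((p : ℝ) ^ a) ^ η := by
    gcongr
    exact_mod_cast hp
  have h2 : 1 + a * (η * Real.log 2) ≤ ((2 : ℝ) ^ a) ^ η := by
    rw [Real.rpow_def_of_pos (by positivity), Real.log_pow]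
    have := Real.add_one_le_exp (a * Real.log 2 * η)
    linarith
  have hpos : 0 < η * Real.log 2 := by positivity
  calc (a + 1 : ℝ) ≤ (1 + (η * Real.log 2)⁻¹) * (1 + a * (η * Real.log 2)) := by
        have : (η * Real.log 2)⁻¹ * (a * (η * Real.log 2)) = a := by field_simp
        have h3 : 0 ≤ a * (η * Real.log 2) := by positivity
        have h4 : 0 ≤ (η * Real.log 2)⁻¹ := by positivity
        nlinarith
    _ ≤ _ := by gcongr; exact h2.trans h1

/-- The divisor bound. -/
theorem exists_card_divisors_le {η : ℝ} (hη : 0 < η) :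
    ∃ C : ℝ, 1 ≤ C ∧ ∀ n : ℕ, n ≠ 0 → (n.divisors.card : ℝ) ≤ C * (n : ℝ) ^ η := by
  obtain ⟨K, hK1, hK⟩ := exists_succ_le_mul_rpow hη
  set P : ℕ := ⌈(2 : ℝ) ^ η⁻¹⌉₊ with hP
  have hbig : ∀ p a : ℕ, P ≤ p → (a + 1 : ℝ) ≤ ((p : ℝ) ^ a) ^ η := by
    intro p a hp
    have h1 : (2 : ℝ) ≤ (p : ℝ) ^ η := by
      have h2 : (2 : ℝ) ^ η⁻¹ ≤ p := (Nat.le_ceil _).trans (by exact_mod_cast hp)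
      calc (2 : ℝ) = ((2 : ℝ) ^ η⁻¹) ^ η := by
            rw [← Real.rpow_mul two_pos.le, inv_mul_cancel₀ hη.ne', Real.rpow_one]
        _ ≤ _ := by gcongr
    rw [← Real.rpow_pow_comm (by positivity)]
    calc (a + 1 : ℝ) ≤ 2 ^ a := by exact_mod_cast Nat.lt_two_pow_self
      _ ≤ _ := by gcongr
  refine ⟨K ^ P, one_le_pow₀ hK1, fun n hn => ?_⟩
  have hn' : (n : ℝ) ^ η = ∏ p ∈ n.primeFactors, ((p : ℝ) ^ n.factorization p) ^ η := by
    conv_lhs => rw [← Nat.prod_factorization_pow_eq_self hn]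
    rw [Nat.prod_factorization_eq_prod_primeFactors, Nat.cast_prod,
      Real.finsetProd_rpow _ _ (fun _ _ => by positivity)]
    simp
  rw [Nat.card_divisors hn, hn', Nat.cast_prod]
  calc ∏ p ∈ n.primeFactors, ((n.factorization p + 1 : ℕ) : ℝ)
      ≤ ∏ p ∈ n.primeFactors, (if p < P then K else 1) * ((p : ℝ) ^ n.factorization p) ^ η := by
        refine Finset.prod_le_prod (fun _ _ => by positivity) fun p hp => ?_
        push_cast
        split_ifs with h
        · exact hK _ _ (Nat.prime_of_mem_primeFactors hp).two_le
        · rw [one_mul]; exact hbig _ _ (not_lt.1 h)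
    _ ≤ _ := by
        rw [Finset.prod_mul_distrib]
        gcongr
        rw [← Finset.prod_filter, Finset.prod_const]
        refine pow_le_pow_right₀ hK1 ?_
        calc _ ≤ (Finset.range P).card := Finset.card_le_card fun p hp => by
              rw [Finset.mem_range]; exact (Finset.mem_filter.1 hp).2
          _ = P := Finset.card_range P

theorem two_pow_card_primeFactors_le {n : ℕ} (hn : n ≠ 0) :
    2 ^ n.primeFactors.card ≤ n.divisors.card := by
  rw [Nat.card_divisors hn, ← Finset.prod_const]
  refine Finset.prod_le_prod' fun p hp => ?_
  have : n.factorization p ≠ 0 := Finsupp.mem_support_iff.1 (by simpa using hp)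
  omega

theorem exists_pow_card_primeFactors_le (c : ℕ) {η : ℝ} (hη : 0 < η) :
    ∃ C : ℝ, 1 ≤ C ∧ ∀ n : ℕ, n ≠ 0 → (c : ℝ) ^ n.primeFactors.card ≤ C * (n : ℝ) ^ η := by
  obtain ⟨C, hC1, hC⟩ := exists_card_divisors_le (η := η / (c + 1)) (by positivity)
  refine ⟨C ^ (c + 1), one_le_pow₀ hC1, fun n hn => ?_⟩
  have h1 : (c : ℝ) ≤ 2 ^ (c + 1) := by
    have := (Nat.lt_two_pow_self (n := c)).le.trans (Nat.pow_le_pow_right two_pos (Nat.le_succ c))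
    exact_mod_cast this
  have h2 : (2 : ℝ) ^ n.primeFactors.card ≤ n.divisors.card := by
    exact_mod_cast two_pow_card_primeFactors_le hn
  calc (c : ℝ) ^ n.primeFactors.card ≤ (2 ^ (c + 1)) ^ n.primeFactors.card := by gcongr
    _ = (2 ^ n.primeFactors.card) ^ (c + 1) := by rw [← pow_mul, ← pow_mul, mul_comm]
    _ ≤ (C * (n : ℝ) ^ (η / (c + 1))) ^ (c + 1) := by gcongr; exact h2.trans (hC n hn)
    _ = C ^ (c + 1) * (n : ℝ) ^ η := by
        rw [mul_pow, ← Real.rpow_natCast (_ ^ (η / _)), ← Real.rpow_mul (by positivity)]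
        congr 2
        push_cast
        field_simp

theorem sum_gcd_Icc_le {q : ℕ} (hq : q ≠ 0) (B : ℕ) :
    ∑ k ∈ Finset.Ioc 0 B, Nat.gcd q k ≤ q.divisors.card * B := by
  calc ∑ k ∈ Finset.Ioc 0 B, Nat.gcd q k
      ≤ ∑ k ∈ Finset.Ioc 0 B, ∑ d ∈ q.divisors, if d ∣ k then d else 0 := by
        refine Finset.sum_le_sum fun k _ => ?_
        have hmem : Nat.gcd q k ∈ q.divisors := Nat.mem_divisors.2 ⟨Nat.gcd_dvd_left _ _, hq⟩
        refine le_trans ?_ (Finset.single_le_sum (fun _ _ => Nat.zero_le _) hmem)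
        simp [Nat.gcd_dvd_right]
    _ = ∑ d ∈ q.divisors, ∑ k ∈ Finset.Ioc 0 B, if d ∣ k then d else 0 := Finset.sum_comm
    _ ≤ ∑ d ∈ q.divisors, B := by
        refine Finset.sum_le_sum fun d _ => ?_
        rw [← Finset.sum_filter, Finset.sum_const, Nat.Ioc_filter_dvd_card_eq_div, smul_eq_mul]
        exact Nat.div_mul_le_self _ _
    _ = _ := by simp

theorem sum_gcd_natAbs_sub_le {q : ℕ} (hq : q ≠ 0) (B : ℕ) {v : ℤ}
    (hv : v ∈ Finset.Icc (1 : ℤ) B) :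
    ∑ u ∈ (Finset.Icc (1 : ℤ) B).erase v, Nat.gcd q (u - v).natAbs
      ≤ 2 * (q.divisors.card * B) := by
  rw [Finset.mem_Icc] at hv
  have hmap : ∀ u ∈ (Finset.Icc (1 : ℤ) B).erase v, (u - v).natAbs ∈ Finset.Ioc 0 B := by
    intro u hu
    simp only [Finset.mem_erase, Finset.mem_Icc] at hu
    rw [Finset.mem_Ioc]
    omega
  rw [← Finset.sum_fiberwise_of_maps_to hmap]
  refine le_trans ?_ (Nat.mul_le_mul_left 2 (sum_gcd_Icc_le hq B))
  rw [Finset.mul_sum]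
  refine Finset.sum_le_sum fun k _ => ?_
  rw [Finset.sum_congr rfl (g := fun _ => Nat.gcd q k)
    (fun u hu => by rw [(Finset.mem_filter.1 hu).2]), Finset.sum_const, smul_eq_mul]
  refine Nat.mul_le_mul_right _ ?_
  calc _ ≤ ({v + k, v - k} : Finset ℤ).card := Finset.card_le_card fun u hu => by
        have := (Finset.mem_filter.1 hu).2
        simp only [Finset.mem_insert, Finset.mem_singleton]
        omega
    _ ≤ 2 := Finset.card_le_two

theorem natGcd_prod_le {q : ℕ} (hq : q ≠ 0) {ι : Type*} [DecidableEq ι] (s : Finset ι)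
    (f : ι → ℕ) : Nat.gcd q (∏ i ∈ s, f i) ≤ ∏ i ∈ s, Nat.gcd q (f i) := by
  induction s using Finset.induction_on with
  | empty => simp
  | insert a s ha ih =>
    rw [Finset.prod_insert ha, Finset.prod_insert ha]
    refine le_trans (Nat.le_of_dvd ?_ (Nat.gcd_mul_right_dvd_mul_gcd _ _ _))
      (Nat.mul_le_mul_left _ ih)
    exact Nat.mul_pos (Nat.gcd_pos_of_pos_left _ (Nat.pos_of_ne_zero hq))
      (Nat.gcd_pos_of_pos_left _ (Nat.pos_of_ne_zero hq))

/-- Averaging the greatest common divisor with a product of differences over a box. -/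
theorem sum_gcd_diffProd_le {ι : Type} [Fintype ι] [DecidableEq ι] (i₀ : ι) {q : ℕ} (hq : q ≠ 0)
    (B : ℕ) :
    ∑ m ∈ (Fintype.piFinset fun _ : ι => Finset.Icc (1 : ℤ) B).filter
        (fun m => ∀ j, j ≠ i₀ → m j ≠ m i₀), Nat.gcd q (diffProd m i₀).natAbs
      ≤ (2 * (q.divisors.card * B)) ^ Fintype.card ι := by
  set S := Finset.Icc (1 : ℤ) B with hS
  set h : ℤ → ι → ℤ → ℕ := fun v j u =>
    if j = i₀ then (if u = v then 1 else 0) else if u = v then 0 else Nat.gcd q (u - v).natAbs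
  have hτ : 1 ≤ q.divisors.card := Finset.card_pos.2 ⟨1, Nat.one_mem_divisors.2 hq⟩
  calc _ ≤ ∑ m ∈ (Fintype.piFinset fun _ : ι => S).filter
        (fun m => ∀ j, j ≠ i₀ → m j ≠ m i₀), ∑ v ∈ S, ∏ j, h v j (m j) := by
        refine Finset.sum_le_sum fun m hm => ?_
        rw [Finset.mem_filter, Fintype.mem_piFinset] at hm
        refine le_trans ?_ (Finset.single_le_sum (f := fun v => ∏ j, h v j (m j))
          (fun _ _ => Nat.zero_le _) (hm.1 i₀))
        change Nat.gcd q (Int.natAbsHom (∏ j ∈ _, _)) ≤ _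
        rw [map_prod]
        refine (natGcd_prod_le hq _ _).trans (le_of_eq ?_)
        rw [← Finset.mul_prod_erase Finset.univ _ (Finset.mem_univ i₀)]
        simp only [h, if_true, one_mul]
        refine Finset.prod_congr rfl fun j hj => ?_
        have hj' := Finset.ne_of_mem_erase hj
        rw [if_neg hj', if_neg (hm.2 j hj')]
        rfl
    _ ≤ ∑ m ∈ Fintype.piFinset fun _ : ι => S, ∑ v ∈ S, ∏ j, h v j (m j) :=
        Finset.sum_le_sum_of_subset (Finset.filter_subset _ _)
    _ = ∑ v ∈ S, ∏ j, ∑ u ∈ S, h v j u := by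
        rw [Finset.sum_comm]
        simp_rw [Finset.prod_univ_sum]
    _ ≤ ∑ v ∈ S, (2 * (q.divisors.card * B)) ^ (Fintype.card ι - 1) := by
        refine Finset.sum_le_sum fun v hv => ?_
        rw [← Finset.mul_prod_erase Finset.univ _ (Finset.mem_univ i₀)]
        have h1 : ∑ u ∈ S, h v i₀ u = 1 := by simp [h, hv]
        rw [h1, one_mul]
        refine (Finset.prod_le_pow_card _ _ (2 * (q.divisors.card * B)) fun j hj => ?_).trans ?_
        · have hj' := Finset.ne_of_mem_erase hj
          refine le_trans (le_of_eq ?_) (sum_gcd_natAbs_sub_le hq B hv)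
          rw [← Finset.add_sum_erase _ _ hv]
          simp only [h, if_neg hj', if_true, zero_add]
          refine Finset.sum_congr rfl fun u hu => ?_
          rw [if_neg (Finset.ne_of_mem_erase hu)]
        · rw [Finset.card_erase_of_mem (Finset.mem_univ _), Finset.card_univ]
    _ = B * (2 * (q.divisors.card * B)) ^ (Fintype.card ι - 1) := by simp [S]
    _ ≤ (2 * (q.divisors.card * B)) * (2 * (q.divisors.card * B)) ^ (Fintype.card ι - 1) := by
        refine Nat.mul_le_mul_right _ ?_
        nlinarith [Nat.zero_le B]
    _ = _ := mul_pow_sub_one (Fintype.card_pos_iff.2 ⟨i₀⟩).ne' _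

theorem card_filter_image_le {ι α : Type*} [Fintype ι] [Nonempty ι] [DecidableEq ι]
    [DecidableEq α] (s : Finset α) (n : ℕ) :
    ((Fintype.piFinset fun _ : ι => s).filter fun m => (Finset.univ.image m).card ≤ n).card
      ≤ n ^ Fintype.card ι * s.card ^ n := by
  classical
  calc _ ≤ (((Finset.univ : Finset (ι → Fin n)) ×ˢ (Fintype.piFinset fun _ : Fin n => s)).image
        fun x => x.2 ∘ x.1).card := Finset.card_le_card fun m hm => by
          rw [Finset.mem_filter, Fintype.mem_piFinset] at hm
          obtain ⟨hm1, hm2⟩ := hm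
          obtain ⟨i⟩ := ‹Nonempty ι›
          let e := (Finset.univ.image m).equivFin
          have hlt : ∀ j : ι, (e ⟨m j, Finset.mem_image_of_mem _ (Finset.mem_univ j)⟩ : ℕ) < n :=
            fun j => (Fin.is_lt _).trans_le hm2
          rw [Finset.mem_image]
          refine ⟨(fun j => ⟨_, hlt j⟩, fun k => if hk : (k : ℕ) < (Finset.univ.image m).card
            then (e.symm ⟨k, hk⟩ : α) else m i), ?_, ?_⟩
          · rw [Finset.mem_product]
            refine ⟨Finset.mem_univ _, ?_⟩
            rw [Fintype.mem_piFinset]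
            intro k
            dsimp only
            split_ifs with hk
            · have := (e.symm ⟨k, hk⟩).2
              obtain ⟨j, -, hj⟩ := Finset.mem_image.1 this
              rw [← hj]; exact hm1 j
            · exact hm1 i
          · funext j
            simp [e]
    _ ≤ _ := Finset.card_image_le
    _ = _ := by simp

theorem two_mul_card_image_le {ι α : Type*} [Fintype ι] [DecidableEq ι] [DecidableEq α]
    (m : ι → α) (hm : ∀ i, ∃ j, j ≠ i ∧ m j = m i) :
    2 * (Finset.univ.image m).card ≤ Fintype.card ι := by
  rw [← Finset.card_univ (α := ι), mul_comm, ← smul_eq_mul]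
  rw [Finset.card_eq_sum_card_image m]
  refine Finset.card_nsmul_le_sum _ _ _ fun a ha => ?_
  obtain ⟨i, -, rfl⟩ := Finset.mem_image.1 ha
  obtain ⟨j, hj, hji⟩ := hm i
  exact Finset.one_lt_card.2 ⟨j, by simp [hji], i, by simp, hj⟩

theorem sum_norm_pow_eq_sum_shiftSum {q : ℕ} [NeZero q] (χ : DirichletCharacter ℂ q)
    (s : Finset ℤ) (r : ℕ) :
    ((∑ x : ZMod q, ‖∑ b ∈ s, χ (x + b)‖ ^ (2 * r) : ℝ) : ℂ)
      = ∑ m ∈ Fintype.piFinset fun _ : Fin r × Bool => s, shiftSum χ Prod.snd m := by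
  simp only [shiftSum]
  rw [Finset.sum_comm, Complex.ofReal_sum]
  refine Finset.sum_congr rfl fun x _ => ?_
  rw [← Finset.prod_univ_sum (fun _ : Fin r × Bool => s)
    (fun i (b : ℤ) => if i.2 then χ (x + b) else star (χ (x + b)))]
  rw [Fintype.prod_prod_type]
  simp only [Fintype.prod_bool, if_true, Bool.false_eq_true, if_false, Finset.prod_const,
    Finset.card_univ, Fintype.card_fin]
  rw [← star_sum, pow_mul, Complex.ofReal_pow, Complex.ofReal_pow, ← Complex.mul_conj']
  rfl

/-- High moments of short sums of a character to a cube-free modulus. -/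
theorem exists_moment_le {r : ℕ} (hr : 0 < r) {η : ℝ} (hη : 0 < η) :
    ∃ C : ℝ, 1 ≤ C ∧ ∀ (q : ℕ) [NeZero q], (∀ p : ℕ, p.Prime → ¬ p ^ 3 ∣ q) →
      ∀ χ : DirichletCharacter ℂ q, IsLocallyNontrivial χ → ∀ B : ℕ,
      ∑ x : ZMod q, ‖∑ b ∈ Finset.Icc (1 : ℤ) B, χ (x + b)‖ ^ (2 * r)
        ≤ C * ((B : ℝ) ^ r * q + (B : ℝ) ^ (2 * r) * (√q * (q : ℝ) ^ η)) := by
  obtain ⟨C₁, hC₁, hω⟩ := exists_pow_card_primeFactors_le (2 * r) (half_pos hη)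
  obtain ⟨C₂, hC₂, hτ⟩ := exists_card_divisors_le (η := η / 2 / (2 * r)) (by positivity)
  have := Fin.pos_iff_nonempty.1 hr
  refine ⟨(r : ℝ) ^ (2 * r) + 2 * r * (C₁ * (2 * C₂) ^ (2 * r)), ?_, fun q _ hcf χ hχ B => ?_⟩
  · have : (1 : ℝ) ≤ (r : ℝ) ^ (2 * r) := one_le_pow₀ (by exact_mod_cast hr)
    have : 0 ≤ 2 * r * (C₁ * (2 * C₂) ^ (2 * r)) := by positivity
    linarith
  have hq0 : q ≠ 0 := NeZero.ne q
  have hq : (0 : ℝ) < q := by positivity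
  have hcard : Fintype.card (Fin r × Bool) = 2 * r := by simp [mul_comm]
  set S := Finset.Icc (1 : ℤ) B with hS
  set P := Fintype.piFinset fun _ : Fin r × Bool => S with hP
  set G : Fin r × Bool → Finset (Fin r × Bool → ℤ) :=
    fun i => P.filter fun m => ∀ j, j ≠ i → m j ≠ m i with hG
  set D := P.filter fun m => (Finset.univ.image m).card ≤ r with hD
  have hcover : ∀ m ∈ P, m ∈ D ∨ ∃ i, m ∈ G i := by
    intro m hm
    by_cases h : ∀ i, ∃ j, j ≠ i ∧ m j = m i
    · left
      refine Finset.mem_filter.2 ⟨hm, ?_⟩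
      have := two_mul_card_image_le m h
      omega
    · right
      push Not at h
      obtain ⟨i, hi⟩ := h
      exact ⟨i, Finset.mem_filter.2 ⟨hm, hi⟩⟩
  have hσ : ∑ i : Fin r × Bool, (if Prod.snd i then 1 else -1 : ℤ) = 0 := by
    rw [Fintype.sum_prod_type]
    simp
  have hDle : ∑ m ∈ D, ‖shiftSum χ Prod.snd m‖ ≤ (r : ℝ) ^ (2 * r) * ((B : ℝ) ^ r * q) := by
    calc _ ≤ ∑ m ∈ D, (q : ℝ) := Finset.sum_le_sum fun m _ => norm_shiftSum_le _ _ _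
      _ = D.card * q := by simp
      _ ≤ ((r : ℝ) ^ (2 * r) * (B : ℝ) ^ r) * q := by
        gcongr
        have := card_filter_image_le (ι := Fin r × Bool) S r
        rw [hcard, hS, Int.card_Icc] at this
        have h2 : ((B : ℤ) + 1 - 1).toNat = B := by omega
        rw [h2] at this
        exact_mod_cast this
      _ = _ := by ring
  have hGle : ∀ i, ∑ m ∈ G i, ‖shiftSum χ Prod.snd m‖
      ≤ (C₁ * (2 * C₂) ^ (2 * r)) * ((B : ℝ) ^ (2 * r) * (√q * (q : ℝ) ^ η)) := by
    intro i
    calc _ ≤ ∑ m ∈ G i, ((2 * r : ℕ) : ℝ) ^ q.primeFactors.card * √q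
            * Nat.gcd q (diffProd m i).natAbs := by
          refine Finset.sum_le_sum fun m _ => ?_
          rw [← hcard]
          exact norm_shiftSum_cubeFree_le _ hσ m i q hcf hχ
      _ = ((2 * r : ℕ) : ℝ) ^ q.primeFactors.card * √q
            * ((∑ m ∈ G i, Nat.gcd q (diffProd m i).natAbs : ℕ) : ℝ) := by
          rw [← Finset.mul_sum]; push_cast; rfl
      _ ≤ (C₁ * (q : ℝ) ^ (η / 2)) * √q
            * (((2 * (q.divisors.card * B)) ^ (2 * r) : ℕ) : ℝ) := by
          gcongr
          · exact_mod_cast hω q hq0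
          · rw [← hcard]; exact sum_gcd_diffProd_le i hq0 B
      _ ≤ (C₁ * (q : ℝ) ^ (η / 2)) * √q
            * (2 * ((C₂ * (q : ℝ) ^ (η / 2 / (2 * r))) * B)) ^ (2 * r) := by
          push_cast
          gcongr
          exact hτ q hq0
      _ = (C₁ * (2 * C₂) ^ (2 * r)) * ((B : ℝ) ^ (2 * r) * (√q *
            ((q : ℝ) ^ (η / 2) * ((q : ℝ) ^ (η / 2 / (2 * r))) ^ (2 * r)))) := by
          ring
      _ = _ := by
          congr 3
          rw [← Real.rpow_natCast (_ ^ (η / 2 / _)), ← Real.rpow_mul hq.le, ← Real.rpow_add hq]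
          congr 1
          push_cast
          field_simp
          ring
  have hmain : ∑ x : ZMod q, ‖∑ b ∈ S, χ (x + b)‖ ^ (2 * r)
      ≤ ∑ m ∈ P, ‖shiftSum χ Prod.snd m‖ := by
    refine le_trans (le_of_eq ?_) (norm_sum_le P fun m => shiftSum χ Prod.snd m)
    rw [← sum_norm_pow_eq_sum_shiftSum, Complex.norm_of_nonneg (by positivity)]
  calc _ ≤ ∑ m ∈ P, ‖shiftSum χ Prod.snd m‖ := hmain
    _ ≤ ∑ m ∈ P, ((if (Finset.univ.image m).card ≤ r then ‖shiftSum χ Prod.snd m‖ else 0)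
          + ∑ i, if ∀ j, j ≠ i → m j ≠ m i then ‖shiftSum χ Prod.snd m‖ else 0) := by
        refine Finset.sum_le_sum fun m hm => ?_
        have hnn : ∀ i, 0 ≤ if ∀ j, j ≠ i → m j ≠ m i then ‖shiftSum χ Prod.snd m‖ else 0 :=
          fun i => by positivity
        rcases hcover m hm with h | ⟨i, hi⟩
        · rw [if_pos (Finset.mem_filter.1 h).2]
          exact le_add_of_nonneg_right (Finset.sum_nonneg fun i _ => hnn i)
        · refine le_add_of_nonneg_of_le (by positivity) ?_
          refine le_trans ?_ (Finset.single_le_sum (fun i _ => hnn i) (Finset.mem_univ i))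
          rw [if_pos (Finset.mem_filter.1 hi).2]
    _ = ∑ m ∈ D, ‖shiftSum χ Prod.snd m‖ + ∑ i, ∑ m ∈ G i, ‖shiftSum χ Prod.snd m‖ := by
        rw [Finset.sum_add_distrib, Finset.sum_comm (s := P)]
        simp only [hD, hG, Finset.sum_filter]
    _ ≤ (r : ℝ) ^ (2 * r) * ((B : ℝ) ^ r * q)
          + ∑ i : Fin r × Bool, (C₁ * (2 * C₂) ^ (2 * r))
            * ((B : ℝ) ^ (2 * r) * (√q * (q : ℝ) ^ η)) :=
        add_le_add hDle (Finset.sum_le_sum fun i _ => hGle i)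
    _ = (r : ℝ) ^ (2 * r) * ((B : ℝ) ^ r * q)
          + (2 * r * (C₁ * (2 * C₂) ^ (2 * r))) * ((B : ℝ) ^ (2 * r) * (√q * (q : ℝ) ^ η)) := by
        rw [Finset.sum_const, Finset.card_univ, hcard]
        simp [mul_assoc]
    _ ≤ _ := by
        have h1 : 0 ≤ (r : ℝ) ^ (2 * r) := by positivity
        have h2 : 0 ≤ 2 * r * (C₁ * (2 * C₂) ^ (2 * r)) := by positivity
        have h3 : 0 ≤ (B : ℝ) ^ r * q := by positivity
        have h4 : 0 ≤ (B : ℝ) ^ (2 * r) * (√q * (q : ℝ) ^ η) := by positivity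
        nlinarith [mul_nonneg h1 h4, mul_nonneg h2 h3]

/-- The sieve of Eratosthenes, with divisor-bounded error. -/
theorem abs_card_filter_not_dvd_sub_le (P : Finset ℕ) (hP : ∀ p ∈ P, p.Prime) (A : ℕ) :
    |(((Finset.Ioc 0 A).filter fun n => ∀ p ∈ P, ¬ p ∣ n).card : ℝ)
      - A * ∏ p ∈ P, (1 - (p : ℝ)⁻¹)| ≤ 2 ^ P.card - 1 := by
  induction P using Finset.induction_on generalizing A with
  | empty => simp
  | insert p P hp ih =>
    have hP' : ∀ x ∈ P, x.Prime := fun x hx => hP x (Finset.mem_insert_of_mem hx)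
    have hpp : p.Prime := hP p (Finset.mem_insert_self _ _)
    have hp0 : (0 : ℝ) < p := by exact_mod_cast hpp.pos
    have hsplit : ((Finset.Ioc 0 A).filter fun n => ∀ x ∈ P, ¬ x ∣ n).card
        = ((Finset.Ioc 0 A).filter fun n => ∀ x ∈ insert p P, ¬ x ∣ n).card
          + ((Finset.Ioc 0 (A / p)).filter fun n => ∀ x ∈ P, ¬ x ∣ n).card := by
      have himg : (((Finset.Ioc 0 (A / p)).filter fun n => ∀ x ∈ P, ¬ x ∣ n).image
          fun n => p * n) = ((Finset.Ioc 0 A).filter fun n => ∀ x ∈ P, ¬ x ∣ n).filter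
            fun n => p ∣ n := by
        ext n
        simp only [Finset.mem_image, Finset.mem_filter, Finset.mem_Ioc]
        constructor
        · rintro ⟨m, ⟨⟨hm0, hm⟩, hmP⟩, rfl⟩
          refine ⟨⟨⟨Nat.mul_pos hpp.pos hm0, ?_⟩, fun x hx hdvd => ?_⟩, dvd_mul_right _ _⟩
          · rw [mul_comm]; exact (Nat.le_div_iff_mul_le hpp.pos).1 hm
          · rcases (hP' x hx).dvd_mul.1 hdvd with h | h
            · rw [(Nat.prime_dvd_prime_iff_eq (hP' x hx) hpp).1 h] at hx
              exact hp hx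
            · exact hmP x hx h
        · rintro ⟨⟨⟨hn0, hn⟩, hnP⟩, m, rfl⟩
          refine ⟨m, ⟨⟨Nat.pos_of_mul_pos_left hn0, ?_⟩, fun x hx h =>
            hnP x hx (h.mul_left _)⟩, rfl⟩
          exact (Nat.le_div_iff_mul_le hpp.pos).2 (by rwa [mul_comm])
      have hcard := Finset.card_image_of_injective
        ((Finset.Ioc 0 (A / p)).filter fun n => ∀ x ∈ P, ¬ x ∣ n)
        (mul_right_injective₀ hpp.ne_zero)
      rw [← hcard, himg, add_comm, ← Finset.card_filter_add_card_filter_not (fun n => p ∣ n)]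
      congr 2
      rw [Finset.filter_filter]
      refine Finset.filter_congr fun n _ => ?_
      rw [Finset.forall_mem_insert, and_comm]
    have h1 := abs_le.1 (ih hP' A)
    have h2 := abs_le.1 (ih hP' (A / p))
    set Q := ∏ p ∈ P, (1 - (p : ℝ)⁻¹) with hQ
    have hfac : ∀ x ∈ P, 0 ≤ 1 - (x : ℝ)⁻¹ ∧ 1 - (x : ℝ)⁻¹ ≤ 1 := fun x hx => by
      have h : (1 : ℝ) ≤ x := by exact_mod_cast (hP' x hx).one_le
      have := inv_le_one_of_one_le₀ h
      have : 0 ≤ (x : ℝ)⁻¹ := by positivity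
      constructor <;> linarith
    have hQ0 : 0 ≤ Q := Finset.prod_nonneg fun x hx => (hfac x hx).1
    have hQ1 : Q ≤ 1 := Finset.prod_le_one (fun x hx => (hfac x hx).1) fun x hx => (hfac x hx).2
    have hdiv1 : ((A / p : ℕ) : ℝ) ≤ A * (p : ℝ)⁻¹ := by
      rw [← div_eq_mul_inv]; exact Nat.cast_div_le
    have hdiv2 : A * (p : ℝ)⁻¹ ≤ ((A / p : ℕ) : ℝ) + 1 := by
      rw [← div_eq_mul_inv, div_le_iff₀ hp0]
      have := (Nat.lt_mul_div_succ A hpp.pos).le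
      rw [mul_comm]
      exact_mod_cast this
    have h3 : ((A / p : ℕ) : ℝ) * Q ≤ A * (p : ℝ)⁻¹ * Q := by gcongr
    have h4 : A * (p : ℝ)⁻¹ * Q ≤ ((A / p : ℕ) : ℝ) * Q + 1 := by nlinarith
    have hsplit' := congrArg (Nat.cast : ℕ → ℝ) hsplit
    rw [Nat.cast_add] at hsplit'
    rw [Finset.prod_insert hp, Finset.card_insert_of_notMem hp, pow_succ, abs_le, ← hQ]
    have h5 : (A : ℝ) * ((1 - (p : ℝ)⁻¹) * Q) = A * Q - A * (p : ℝ)⁻¹ * Q := by ring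
    rw [h5]
    constructor <;> linarith

theorem div_card_divisors_sub_le_card_coprime {q : ℕ} (hq : q ≠ 0) (A : ℕ) :
    (A : ℝ) / q.divisors.card - q.divisors.card
      ≤ ((Finset.Ioc 0 A).filter fun a => a.Coprime q).card := by
  have hP : ∀ p ∈ q.primeFactors, p.Prime := fun p hp => Nat.prime_of_mem_primeFactors hp
  have h1 := (abs_le.1 (abs_card_filter_not_dvd_sub_le q.primeFactors hP A)).1
  have h2 : (2 : ℝ) ^ q.primeFactors.card ≤ q.divisors.card := by
    exact_mod_cast two_pow_card_primeFactors_le hq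
  have h3 : (q.divisors.card : ℝ)⁻¹ ≤ ∏ p ∈ q.primeFactors, (1 - (p : ℝ)⁻¹) := by
    calc (q.divisors.card : ℝ)⁻¹ ≤ ((2 : ℝ) ^ q.primeFactors.card)⁻¹ := by gcongr
      _ = ∏ p ∈ q.primeFactors, (2 : ℝ)⁻¹ := by simp
      _ ≤ _ := by
        refine Finset.prod_le_prod (fun _ _ => by positivity) fun p hp => ?_
        have h : (2 : ℝ) ≤ p := by exact_mod_cast (hP p hp).two_le
        have : (p : ℝ)⁻¹ ≤ 2⁻¹ := by gcongr
        linarith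
  have h4 : (A : ℝ) / q.divisors.card ≤ A * ∏ p ∈ q.primeFactors, (1 - (p : ℝ)⁻¹) := by
    rw [div_eq_mul_inv]; gcongr
  have h5 : ((Finset.Ioc 0 A).filter fun n => ∀ p ∈ q.primeFactors, ¬ p ∣ n)
      = (Finset.Ioc 0 A).filter fun a => a.Coprime q := by
    refine Finset.filter_congr fun n _ => ?_
    rw [← not_iff_not, Nat.Prime.not_coprime_iff_dvd]
    push Not
    simp only [Nat.mem_primeFactors]
    constructor
    · rintro ⟨p, ⟨hp, hpq, -⟩, hpn⟩
      exact ⟨p, hp, hpn, hpq⟩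
    · rintro ⟨p, hp, hpn, hpq⟩
      exact ⟨p, ⟨hp, hpq, hq⟩, hpn⟩
  rw [h5] at h1
  linarith

open ZMod in
theorem star_stdAddChar {q : ℕ} [NeZero q] (z : ZMod q) :
    star (stdAddChar z : ℂ) = stdAddChar (-z) := by
  rw [stdAddChar_apply, stdAddChar_apply, AddChar.map_neg_eq_inv, Circle.coe_inv_eq_conj]
  rfl

open ZMod in
/-- A mean value estimate for trigonometric polynomials on `ZMod q` with repeated frequencies. -/
theorem sum_norm_sq_stdAddChar_le {q : ℕ} [NeZero q] {ι : Type*} (s : Finset ι)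
    (f : ι → ZMod q) (c : ι → ℂ) :
    ∑ x : ZMod q, ‖∑ i ∈ s, c i * stdAddChar (x * f i)‖ ^ 2
      ≤ q * ∑ i ∈ s, ‖c i‖ ^ 2 * (s.filter fun j => f j = f i).card := by
  have h1 : ((∑ x : ZMod q, ‖∑ i ∈ s, c i * stdAddChar (x * f i)‖ ^ 2 : ℝ) : ℂ)
      = q * ∑ i ∈ s, ∑ j ∈ s, if f j = f i then c i * star (c j) else 0 := by
    rw [Complex.ofReal_sum]
    calc _ = ∑ x : ZMod q, ∑ i ∈ s, ∑ j ∈ s, c i * star (c j) * stdAddChar (x * (f i - f j)) := by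
          refine Finset.sum_congr rfl fun x _ => ?_
          rw [Complex.ofReal_pow, ← Complex.mul_conj', map_sum,
            Finset.sum_mul_sum]
          refine Finset.sum_congr rfl fun i _ => Finset.sum_congr rfl fun j _ => ?_
          rw [starRingEnd_apply, star_mul', star_stdAddChar, mul_sub, sub_eq_add_neg,
            AddChar.map_add_eq_mul]
          ring
      _ = _ := by
          rw [Finset.sum_comm, Finset.mul_sum]
          refine Finset.sum_congr rfl fun i _ => ?_
          rw [Finset.sum_comm, Finset.mul_sum]
          refine Finset.sum_congr rfl fun j _ => ?_
          rw [← Finset.mul_sum, AddChar.sum_mulShift _ (isPrimitive_stdAddChar q), ZMod.card]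
          simp only [sub_eq_zero, eq_comm (a := f i)]
          split_ifs <;> ring
  have h2 : ∑ x : ZMod q, ‖∑ i ∈ s, c i * stdAddChar (x * f i)‖ ^ 2
      ≤ q * ∑ i ∈ s, ∑ j ∈ s, if f j = f i then ‖c i‖ * ‖c j‖ else 0 := by
    calc _ = ‖((∑ x : ZMod q, ‖∑ i ∈ s, c i * stdAddChar (x * f i)‖ ^ 2 : ℝ) : ℂ)‖ := by
          rw [Complex.norm_of_nonneg (by positivity)]
      _ ≤ _ := by
          rw [h1, norm_mul, Complex.norm_natCast]
          gcongr
          refine (norm_sum_le _ _).trans (Finset.sum_le_sum fun i _ =>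
            (norm_sum_le _ _).trans (Finset.sum_le_sum fun j _ => ?_))
          split_ifs <;> simp
  refine h2.trans (mul_le_mul_of_nonneg_left ?_ (Nat.cast_nonneg q))
  have h3 : ∑ i ∈ s, ∑ j ∈ s, (if f j = f i then ‖c i‖ * ‖c j‖ else 0)
      ≤ ∑ i ∈ s, ∑ j ∈ s, ((if f j = f i then ‖c i‖ ^ 2 / 2 else 0)
        + if f j = f i then ‖c j‖ ^ 2 / 2 else 0) := by
    refine Finset.sum_le_sum fun i _ => Finset.sum_le_sum fun j _ => ?_
    split_ifs
    · nlinarith [sq_nonneg (‖c i‖ - ‖c j‖)]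
    · simp
  refine h3.trans (le_of_eq ?_)
  simp only [Finset.sum_add_distrib]
  rw [Finset.sum_comm (f := fun i j => if f j = f i then ‖c j‖ ^ 2 / 2 else 0),
    ← Finset.sum_add_distrib]
  refine Finset.sum_congr rfl fun i _ => ?_
  simp only [eq_comm (a := f i)]
  rw [← Finset.sum_filter, Finset.sum_const, nsmul_eq_mul]
  ring

open ZMod in
theorem half_le_norm_sum_stdAddChar {q : ℕ} [NeZero q] {K : ℕ} {t : ℤ}
    (ht : 6 * ((K - 1 : ℕ) * |(t : ℝ)|) ≤ q) :
    (K : ℝ) / 2 ≤ ‖∑ h ∈ Finset.range K, (stdAddChar ((h : ZMod q) * (t : ZMod q)) : ℂ)‖ := by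
  have hq : (0 : ℝ) < q := by exact_mod_cast Nat.pos_of_ne_zero (NeZero.ne q)
  refine le_trans ?_ ((le_abs_self _).trans (Complex.abs_re_le_norm _))
  rw [Complex.re_sum]
  calc (K : ℝ) / 2 = ∑ h ∈ Finset.range K, (1 / 2 : ℝ) := by simp [div_eq_mul_inv]
    _ ≤ _ := by
      refine Finset.sum_le_sum fun h hh => ?_
      have hh' : h ≤ K - 1 := by have := Finset.mem_range.1 hh; omega
      have h1 : (stdAddChar ((h : ZMod q) * (t : ZMod q)) : ℂ)
          = Complex.exp ((2 * Real.pi * (h * t) / q : ℝ) * Complex.I) := by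
        have := stdAddChar_coe (N := q) (h * t)
        push_cast at this
        rw [this]
        push_cast
        congr 1
        ring
      rw [h1, Complex.exp_ofReal_mul_I_re, ← Real.cos_pi_div_three,
        ← Real.cos_abs (2 * Real.pi * (h * t) / q)]
      have h2 : |(h : ℝ) * t| * 6 ≤ q := by
        rw [abs_mul, Nat.abs_cast]
        have : (h : ℝ) * |(t : ℝ)| ≤ (K - 1 : ℕ) * |(t : ℝ)| := by
          gcongr
        linarith
      have h3 : |2 * Real.pi * (h * t) / q| ≤ Real.pi / 3 := by
        rw [abs_div, abs_mul, abs_of_pos hq, abs_of_pos Real.two_pi_pos, div_le_iff₀ hq]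
        nlinarith [Real.pi_pos]
      exact Real.cos_le_cos_of_nonneg_of_le_pi (abs_nonneg _) (by linarith [Real.pi_pos]) h3

/-- The multiplicity of `k` as a difference of two elements of `{0, …, K - 1}`. -/
def diffCount (K : ℕ) (k : ℤ) : ℕ :=
  ((Finset.range K ×ˢ Finset.range K).filter fun x => (x.1 : ℤ) - x.2 = k).card

theorem diffCount_le (K : ℕ) (k : ℤ) : diffCount K k ≤ K := by
  calc _ ≤ (Finset.range K).card := by
        refine Finset.card_le_card_of_injOn Prod.fst (fun x hx => ?_) fun x hx y hy hxy => ?_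
        · exact (Finset.mem_product.1 (Finset.mem_filter.1 hx).1).1
        · have h1 := (Finset.mem_filter.1 hx).2
          have h2 := (Finset.mem_filter.1 hy).2
          ext
          · exact hxy
          · omega
    _ = K := Finset.card_range K

open ZMod in
theorem norm_sq_sum_stdAddChar {q : ℕ} [NeZero q] (K : ℕ) (z : ZMod q) :
    ((‖∑ h ∈ Finset.range K, (stdAddChar ((h : ZMod q) * z) : ℂ)‖ ^ 2 : ℝ) : ℂ)
      = ∑ k ∈ Finset.Ioo (-K : ℤ) K, diffCount K k * stdAddChar ((k : ZMod q) * z) := by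
  rw [Complex.ofReal_pow, ← Complex.mul_conj', map_sum, Finset.sum_mul_sum,
    ← Finset.sum_product']
  have hmap : ∀ x ∈ Finset.range K ×ˢ Finset.range K,
      (x.1 : ℤ) - x.2 ∈ Finset.Ioo (-K : ℤ) K := by
    intro x hx
    simp only [Finset.mem_product, Finset.mem_range] at hx
    rw [Finset.mem_Ioo]
    omega
  rw [← Finset.sum_fiberwise_of_maps_to hmap]
  refine Finset.sum_congr rfl fun k _ => ?_
  rw [diffCount, ← nsmul_eq_mul, ← Finset.sum_const]
  refine Finset.sum_congr rfl fun x hx => ?_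
  rw [← (Finset.mem_filter.1 hx).2, starRingEnd_apply, star_stdAddChar,
    ← AddChar.map_add_eq_mul]
  congr 1
  push_cast
  ring

open ZMod in
theorem sum_norm_sq_fourier_le {q : ℕ} [NeZero q] (U : Finset (ZMod q)) {K : ℕ}
    (hK : 2 * (K - 1) < q) :
    ∑ k ∈ Finset.Ioo (-K : ℤ) K, ‖∑ u ∈ U, (stdAddChar (-((k : ZMod q) * u)) : ℂ)‖ ^ 2
      ≤ q * U.card := by
  have hinj : Set.InjOn (fun k : ℤ => -(k : ZMod q)) (Finset.Ioo (-K : ℤ) K) := by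
    intro k hk l hl hkl
    have h1 : (k : ZMod q) = l := neg_injective hkl
    rw [ZMod.intCast_eq_intCast_iff_dvd_sub] at h1
    have hk' := Finset.mem_Ioo.1 (Finset.mem_coe.1 hk)
    have hl' := Finset.mem_Ioo.1 (Finset.mem_coe.1 hl)
    have := Int.eq_zero_of_abs_lt_dvd h1 (by rw [abs_lt]; omega)
    omega
  calc _ = ∑ k ∈ Finset.Ioo (-K : ℤ) K,
        ‖∑ u ∈ U, (1 : ℂ) * (stdAddChar (-(k : ZMod q) * u) : ℂ)‖ ^ 2 := by simp
    _ = ∑ x ∈ (Finset.Ioo (-K : ℤ) K).image fun k : ℤ => -(k : ZMod q),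
        ‖∑ u ∈ U, (1 : ℂ) * (stdAddChar (x * u) : ℂ)‖ ^ 2 := by
        rw [Finset.sum_image hinj]
    _ ≤ ∑ x : ZMod q, ‖∑ u ∈ U, (1 : ℂ) * (stdAddChar (x * u) : ℂ)‖ ^ 2 :=
        Finset.sum_le_sum_of_subset_of_nonneg (Finset.subset_univ _) fun _ _ _ => by positivity
    _ ≤ q * ∑ u ∈ U, ‖(1 : ℂ)‖ ^ 2 * (U.filter fun v => v = u).card :=
        sum_norm_sq_stdAddChar_le U (fun u => u) fun _ => 1
    _ ≤ q * ∑ u ∈ U, 1 := by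
        gcongr with u hu
        rw [Finset.filter_eq' U u, if_pos hu]
        simp
    _ = _ := by simp

theorem natCast_card_divisors_natAbs_mul_le {C η : ℝ} (hC : 0 ≤ C) (hη : 0 ≤ η)
    (hτ : ∀ n : ℕ, n ≠ 0 → (n.divisors.card : ℝ) ≤ C * (n : ℝ) ^ η) {q n : ℕ} (hn : n ≠ 0)
    (hnq : n ≤ q) : (n.divisors.card : ℝ) ≤ C * (q : ℝ) ^ η :=
  (hτ n hn).trans (by gcongr)

theorem abs_mul_mul_twelve_le {q : ℕ} {ℓ : ℝ} {K : ℕ}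
    (hK1 : ((K - 1 : ℕ) : ℝ) * (12 * ℓ) ≤ q) {𝒜 : Finset ℕ}
    (h𝒜 : ∀ a ∈ 𝒜, 1 ≤ a ∧ (a : ℝ) ≤ ℓ)
    {i : ℕ × ℤ} (hi : i ∈ 𝒜 ×ˢ Finset.Ioo (-K : ℤ) K) :
    |((i.1 : ℝ) * (i.2 : ℝ))| * 12 ≤ q := by
  rw [Finset.mem_product, Finset.mem_Ioo] at hi
  have h1 := (h𝒜 _ hi.1).2
  have h2 : |(i.2 : ℝ)| ≤ (K - 1 : ℕ) := by
    have : |i.2| ≤ ((K - 1 : ℕ) : ℤ) := by rw [abs_le]; omega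
    exact_mod_cast this
  rw [abs_mul, Nat.abs_cast]
  have hℓ : 0 ≤ ℓ := (Nat.cast_nonneg i.1).trans h1
  have : (i.1 : ℝ) * |(i.2 : ℝ)| ≤ ℓ * (K - 1 : ℕ) := by gcongr
  linarith

theorem mul_eq_mul_of_zmod_mul_eq_mul {q : ℕ} [NeZero q] {ℓ : ℝ} {K : ℕ}
    (hK1 : ((K - 1 : ℕ) : ℝ) * (12 * ℓ) ≤ q) {𝒜 : Finset ℕ}
    (h𝒜 : ∀ a ∈ 𝒜, 1 ≤ a ∧ (a : ℝ) ≤ ℓ)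
    {i j : ℕ × ℤ} (hi : i ∈ 𝒜 ×ˢ Finset.Ioo (-K : ℤ) K)
    (hj : j ∈ 𝒜 ×ˢ Finset.Ioo (-K : ℤ) K)
    (hij : (j.1 : ZMod q) * (j.2 : ZMod q) = (i.1 : ZMod q) * (i.2 : ZMod q)) :
    (j.1 : ℤ) * j.2 = i.1 * i.2 := by
  have hq : (0 : ℝ) < q := by exact_mod_cast Nat.pos_of_ne_zero (NeZero.ne q)
  have h1 : (((j.1 : ℤ) * j.2 : ℤ) : ZMod q) = ((i.1 * i.2 : ℤ) : ZMod q) := by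
    push_cast; exact hij
  rw [ZMod.intCast_eq_intCast_iff_dvd_sub] at h1
  have hlt : |(i.1 * i.2 - (j.1 : ℤ) * j.2 : ℤ)| < q := by
    have h2 := abs_sub ((i.1 : ℝ) * i.2) ((j.1 : ℝ) * j.2)
    have h3 := abs_mul_mul_twelve_le hK1 h𝒜 hi
    have h4 := abs_mul_mul_twelve_le hK1 h𝒜 hj
    have h5 : |(i.1 : ℝ) * i.2 - (j.1 : ℝ) * j.2| < q := by linarith
    exact_mod_cast h5
  have := Int.eq_zero_of_abs_lt_dvd h1 hlt
  linarith

theorem card_filter_mul_eq_zero_le {q : ℕ} [NeZero q] {ℓ : ℝ} {K : ℕ}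
    (hK1 : ((K - 1 : ℕ) : ℝ) * (12 * ℓ) ≤ q) {𝒜 : Finset ℕ}
    (h𝒜 : ∀ a ∈ 𝒜, 1 ≤ a ∧ (a : ℝ) ≤ ℓ)
    {i : ℕ × ℤ} (hi : i ∈ 𝒜 ×ˢ Finset.Ioo (-K : ℤ) K) (hi0 : i.2 = 0) :
    ((𝒜 ×ˢ Finset.Ioo (-K : ℤ) K).filter fun j =>
      (j.1 : ZMod q) * (j.2 : ZMod q) = (i.1 : ZMod q) * (i.2 : ZMod q)).card ≤ 𝒜.card := by
  refine Finset.card_le_card_of_injOn Prod.fst (fun j hj => ?_) fun j hj j' hj' hjj => ?_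
  · exact (Finset.mem_product.1 (Finset.mem_filter.1 hj).1).1
  · have key : ∀ j ∈ (𝒜 ×ˢ Finset.Ioo (-K : ℤ) K).filter (fun j =>
        (j.1 : ZMod q) * (j.2 : ZMod q) = (i.1 : ZMod q) * (i.2 : ZMod q)), j.2 = 0 := by
      intro j hj
      obtain ⟨hj1, hj2⟩ := Finset.mem_filter.1 hj
      have := mul_eq_mul_of_zmod_mul_eq_mul hK1 h𝒜 hi hj1 hj2
      have h1 := (h𝒜 _ (Finset.mem_product.1 hj1).1).1
      rw [hi0, mul_zero] at this
      rcases mul_eq_zero.1 this with h | h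
      · omega
      · exact h
    ext
    · exact hjj
    · rw [key j hj, key j' hj']

theorem card_filter_mul_eq_le {q : ℕ} [NeZero q] {ℓ : ℝ} {K : ℕ}
    (hK1 : ((K - 1 : ℕ) : ℝ) * (12 * ℓ) ≤ q) {𝒜 : Finset ℕ}
    (h𝒜 : ∀ a ∈ 𝒜, 1 ≤ a ∧ (a : ℝ) ≤ ℓ)
    {i : ℕ × ℤ} (hi : i ∈ 𝒜 ×ˢ Finset.Ioo (-K : ℤ) K) (hi0 : i.2 ≠ 0)
    {C η : ℝ} (hC : 0 ≤ C) (hη : 0 ≤ η)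
    (hτ : ∀ n : ℕ, n ≠ 0 → (n.divisors.card : ℝ) ≤ C * (n : ℝ) ^ η) :
    (((𝒜 ×ˢ Finset.Ioo (-K : ℤ) K).filter fun j =>
      (j.1 : ZMod q) * (j.2 : ZMod q) = (i.1 : ZMod q) * (i.2 : ZMod q)).card : ℝ)
        ≤ C * (q : ℝ) ^ η := by
  have hi1 := (h𝒜 _ (Finset.mem_product.1 hi).1).1
  have hne : (i.1 : ℤ) * i.2 ≠ 0 := mul_ne_zero (by omega) hi0
  have hle : ((i.1 : ℤ) * i.2).natAbs ≤ q := by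
    have h3 := abs_mul_mul_twelve_le hK1 h𝒜 hi
    have h4 : |(i.1 : ℝ) * i.2| ≤ q := by linarith [abs_nonneg ((i.1 : ℝ) * i.2)]
    have h5 : |(i.1 : ℤ) * i.2| ≤ q := by exact_mod_cast h4
    rw [Int.abs_eq_natAbs] at h5
    exact_mod_cast h5
  refine le_trans ?_ (natCast_card_divisors_natAbs_mul_le hC hη hτ
    (Int.natAbs_ne_zero.2 hne) hle)
  rw [Nat.cast_le]
  refine Finset.card_le_card_of_injOn Prod.fst (fun j hj => ?_) fun j hj j' hj' hjj => ?_
  · obtain ⟨hj1, hj2⟩ := Finset.mem_filter.1 hj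
    have := mul_eq_mul_of_zmod_mul_eq_mul hK1 h𝒜 hi hj1 hj2
    rw [Finset.mem_coe, Nat.mem_divisors]
    refine ⟨?_, Int.natAbs_ne_zero.2 hne⟩
    rw [← this, Int.natAbs_mul, Int.natAbs_natCast]
    exact dvd_mul_right _ _
  · obtain ⟨hj1, hj2⟩ := Finset.mem_filter.1 hj
    obtain ⟨hj1', hj2'⟩ := Finset.mem_filter.1 hj'
    have h1 := mul_eq_mul_of_zmod_mul_eq_mul hK1 h𝒜 hi hj1 hj2
    have h2 := mul_eq_mul_of_zmod_mul_eq_mul hK1 h𝒜 hi hj1' hj2'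
    have h3 := (h𝒜 _ (Finset.mem_product.1 hj1).1).1
    rw [← h2, ← hjj] at h1
    ext
    · exact hjj
    · exact mul_left_cancel₀ (by omega) h1

theorem sum_product_ite_add_mul_sq (𝒜 : Finset ℕ) {I : Finset ℤ} (hI : 0 ∈ I) (f : ℤ → ℝ)
    (P K Q : ℝ) :
    ∑ i ∈ 𝒜 ×ˢ I, ((if i.2 = 0 then P else 0) + (K * f i.2) ^ 2 * Q)
      = 𝒜.card * (P + K ^ 2 * Q * ∑ k ∈ I, f k ^ 2) := by
  rw [Finset.sum_product]
  simp only [Finset.sum_add_distrib, Finset.sum_ite_eq', Finset.sum_const, nsmul_eq_mul,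
    mul_pow, ← Finset.sum_mul, ← Finset.mul_sum, if_pos hI]
  ring

theorem le_of_mul_sq_le_mul {S ℓ K q C Q X : ℝ} (hS : 0 ≤ S) (hq : 0 < q)
    (hK : 0 < K) (hqK : q ≤ K * (12 * ℓ)) (hC : 1 ≤ C)
    (h : S * (ℓ * K ^ 2 / 4) ^ 2 ≤ q * (K ^ 2 * (X ^ 2 + C * Q * (q * X)))) :
    S ≤ 2304 * C * (Q * X + X ^ 2 / q) := by
  have h1 : S * (ℓ * K) ^ 2 ≤ 16 * q * (X ^ 2 + C * Q * (q * X)) := by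
    have h3 : S * (ℓ * K) ^ 2 * K ^ 2 ≤ 16 * q * (X ^ 2 + C * Q * (q * X)) * K ^ 2 := by
      nlinarith
    exact le_of_mul_le_mul_right h3 (by positivity)
  have h2 : S * q ^ 2 ≤ 2304 * q * (X ^ 2 + C * Q * (q * X)) := by
    calc S * q ^ 2 ≤ S * (K * (12 * ℓ)) ^ 2 := by gcongr
      _ = 144 * (S * (ℓ * K) ^ 2) := by ring
      _ ≤ 144 * (16 * q * (X ^ 2 + C * Q * (q * X))) := by gcongr
      _ = _ := by ring
  refine le_of_mul_le_mul_right (h2.trans ?_) (show 0 < q ^ 2 by positivity)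
  have h5 : 2304 * C * (Q * X + X ^ 2 / q) * q ^ 2
      = 2304 * q * (C * X ^ 2 + C * Q * (q * X)) := by
    field_simp
    ring
  rw [h5]
  gcongr
  exact le_mul_of_one_le_left (sq_nonneg _) hC

open ZMod in
set_option maxHeartbeats 800000 in
/-- The second moment of the number of ways to represent a residue as a quotient of an element of
a union of intervals of length about `ℓ` by a small integer. -/
theorem exists_sum_sq_card_mul_mem_le {η : ℝ} (hη : 0 < η) :
    ∃ C : ℝ, 1 ≤ C ∧ ∀ (q : ℕ) [NeZero q] (ℓ : ℝ), 1 ≤ ℓ → ℓ ≤ q → ∀ U : Finset (ZMod q),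
      (∀ y ∈ U, ∃ V ⊆ U, ℓ ≤ V.card ∧ ∀ u ∈ V, ∃ t : ℤ, |(t : ℝ)| ≤ 2 * ℓ ∧ y - u = t) →
      ∀ 𝒜 : Finset ℕ, (∀ a ∈ 𝒜, 1 ≤ a ∧ (a : ℝ) ≤ ℓ) →
      ∑ x : ZMod q, ((𝒜.filter fun a : ℕ => (a : ZMod q) * x ∈ U).card : ℝ) ^ 2
        ≤ C * ((q : ℝ) ^ η * (𝒜.card * U.card) + (𝒜.card * U.card : ℝ) ^ 2 / q) := by
  obtain ⟨C, hC1, hτ⟩ := exists_card_divisors_le hη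
  refine ⟨2304 * C, by linarith, fun q _ ℓ hℓ1 hℓq U hU 𝒜 h𝒜 => ?_⟩
  have hq : (0 : ℝ) < q := by exact_mod_cast Nat.pos_of_ne_zero (NeZero.ne q)
  have hℓ0 : 0 < ℓ := by linarith
  set K : ℕ := ⌊(q : ℝ) / (12 * ℓ)⌋₊ + 1 with hK
  have hK1 : ((K - 1 : ℕ) : ℝ) * (12 * ℓ) ≤ q := by
    rw [← le_div_iff₀ (by positivity)]
    exact Nat.floor_le (by positivity)
  have hK2 : (q : ℝ) ≤ K * (12 * ℓ) := by
    rw [← div_le_iff₀ (by positivity), hK]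
    push_cast
    exact (Nat.lt_floor_add_one _).le
  have hKpos : (0 : ℝ) < K := by positivity
  have hK1' : ((K - 1 : ℕ) : ℝ) * 12 ≤ q := by
    refine le_trans ?_ hK1
    gcongr
    linarith
  have hKq : 2 * (K - 1) < q := by
    have : ((K - 1 : ℕ) : ℝ) * 2 < q := by linarith
    rw [mul_comm]
    exact_mod_cast this
  set ν : ZMod q → ℝ := fun x => (𝒜.filter fun a : ℕ => (a : ZMod q) * x ∈ U).card with hν
  set W : ZMod q → ℝ := fun x => ∑ a ∈ 𝒜, ∑ u ∈ U,
    ‖∑ h ∈ Finset.range K, (stdAddChar ((h : ZMod q) * ((a : ZMod q) * x - u)) : ℂ)‖ ^ 2 with hW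
  set c : ℤ → ℂ := fun k => diffCount K k *
    ∑ u ∈ U, (stdAddChar (-((k : ZMod q) * u)) : ℂ) with hc
  have hνW : ∀ x, ν x * (ℓ * K ^ 2 / 4) ≤ W x := by
    intro x
    calc ν x * (ℓ * K ^ 2 / 4)
        = ∑ a ∈ 𝒜.filter fun a : ℕ => (a : ZMod q) * x ∈ U, ℓ * K ^ 2 / 4 := by
          rw [Finset.sum_const, nsmul_eq_mul]
      _ ≤ ∑ a ∈ 𝒜.filter fun a : ℕ => (a : ZMod q) * x ∈ U, ∑ u ∈ U,
          ‖∑ h ∈ Finset.range K, (stdAddChar ((h : ZMod q) * ((a : ZMod q) * x - u)) : ℂ)‖ ^ 2 := by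
          refine Finset.sum_le_sum fun a ha => ?_
          have hax := (Finset.mem_filter.1 ha).2
          obtain ⟨V, hVU, hVcard, hV⟩ := hU _ hax
          refine le_trans ?_ (Finset.sum_le_sum_of_subset_of_nonneg hVU
            fun _ _ _ => by positivity)
          calc ℓ * K ^ 2 / 4 ≤ V.card * ((K : ℝ) / 2) ^ 2 := by
                have h2 : ℓ * K ^ 2 / 4 = ℓ * ((K : ℝ) / 2) ^ 2 := by ring
                rw [h2]
                gcongr
            _ ≤ _ := by
                rw [← nsmul_eq_mul, ← Finset.sum_const]
                refine Finset.sum_le_sum fun u hu => ?_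
                obtain ⟨t, ht, htu⟩ := hV u hu
                rw [htu]
                gcongr
                refine half_le_norm_sum_stdAddChar ?_
                have : ((K - 1 : ℕ) : ℝ) * |(t : ℝ)| ≤ (K - 1 : ℕ) * (2 * ℓ) := by gcongr
                linarith
      _ ≤ W x := Finset.sum_le_sum_of_subset_of_nonneg (Finset.filter_subset _ _)
          fun _ _ _ => by positivity
  have hWc : ∀ x, W x = ‖∑ i ∈ 𝒜 ×ˢ Finset.Ioo (-K : ℤ) K,
      c i.2 * stdAddChar (x * ((i.1 : ZMod q) * (i.2 : ZMod q)))‖ := by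
    intro x
    have hWx : (W x : ℂ) = ∑ i ∈ 𝒜 ×ˢ Finset.Ioo (-K : ℤ) K,
        c i.2 * stdAddChar (x * ((i.1 : ZMod q) * (i.2 : ZMod q))) := by
      rw [hW, Complex.ofReal_sum, Finset.sum_product]
      refine Finset.sum_congr rfl fun a _ => ?_
      rw [Complex.ofReal_sum]
      simp only [norm_sq_sum_stdAddChar]
      rw [Finset.sum_comm]
      refine Finset.sum_congr rfl fun k _ => ?_
      simp only [hc]
      rw [mul_assoc, Finset.sum_mul, Finset.mul_sum]
      refine Finset.sum_congr rfl fun u _ => ?_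
      rw [← AddChar.map_add_eq_mul]
      congr 2
      ring
    rw [← hWx, Complex.norm_of_nonneg]
    exact Finset.sum_nonneg fun _ _ => Finset.sum_nonneg fun _ _ => by positivity
  have hcU : ∀ k, ‖c k‖ ≤ K * ‖∑ u ∈ U, (stdAddChar (-((k : ZMod q) * u)) : ℂ)‖ := by
    intro k
    rw [hc, norm_mul, Complex.norm_natCast]
    gcongr
    exact_mod_cast diffCount_le K k
  have hc0 : ‖c 0‖ ≤ K * U.card := by
    refine (hcU 0).trans ?_
    simp
  have hsum : ∑ x : ZMod q, W x ^ 2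
      ≤ q * (K ^ 2 * ((𝒜.card * U.card : ℝ) ^ 2 + C * (q : ℝ) ^ η * (𝒜.card * (q * U.card)))) := by
    calc ∑ x : ZMod q, W x ^ 2 ≤ q * ∑ i ∈ 𝒜 ×ˢ Finset.Ioo (-K : ℤ) K, ‖c i.2‖ ^ 2 *
            ((𝒜 ×ˢ Finset.Ioo (-K : ℤ) K).filter fun j =>
              (j.1 : ZMod q) * (j.2 : ZMod q) = (i.1 : ZMod q) * (i.2 : ZMod q)).card := by
          simp_rw [hWc]
          exact sum_norm_sq_stdAddChar_le _ (fun i : ℕ × ℤ => (i.1 : ZMod q) * (i.2 : ZMod q))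
            fun i => c i.2
      _ ≤ q * ∑ i ∈ 𝒜 ×ˢ Finset.Ioo (-K : ℤ) K,
            ((if i.2 = 0 then (K * U.card : ℝ) ^ 2 * 𝒜.card else 0)
              + (K * ‖∑ u ∈ U, (stdAddChar (-((i.2 : ZMod q) * u)) : ℂ)‖) ^ 2
                * (C * (q : ℝ) ^ η)) := by
          gcongr with i hi
          by_cases hi0 : i.2 = 0
          · rw [if_pos hi0]
            refine le_add_of_le_of_nonneg ?_ (by positivity)
            have hci : ‖c i.2‖ ≤ K * U.card := by rw [hi0]; exact hc0
            gcongr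
            exact card_filter_mul_eq_zero_le hK1 h𝒜 hi hi0
          · rw [if_neg hi0, zero_add]
            gcongr
            · exact hcU _
            · exact card_filter_mul_eq_le hK1 h𝒜 hi hi0 (by linarith) hη.le hτ
      _ = q * (K ^ 2 * ((𝒜.card * U.card : ℝ) ^ 2 + C * (q : ℝ) ^ η * (𝒜.card *
            ∑ k ∈ Finset.Ioo (-K : ℤ) K,
              ‖∑ u ∈ U, (stdAddChar (-((k : ZMod q) * u)) : ℂ)‖ ^ 2))) := by
          rw [sum_product_ite_add_mul_sq 𝒜 (by rw [Finset.mem_Ioo]; omega)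
            fun k => ‖∑ u ∈ U, (stdAddChar (-((k : ZMod q) * u)) : ℂ)‖]
          ring
      _ ≤ _ := by
          gcongr
          exact sum_norm_sq_fourier_le U hKq
  have hνsum : (∑ x : ZMod q, ν x ^ 2) * (ℓ * K ^ 2 / 4) ^ 2 ≤ ∑ x : ZMod q, W x ^ 2 := by
    rw [Finset.sum_mul]
    refine Finset.sum_le_sum fun x _ => ?_
    rw [← mul_pow]
    exact pow_le_pow_left₀ (by positivity) (hνW x) 2
  have h4 : (𝒜.card * (q * U.card) : ℝ) = q * (𝒜.card * U.card) := by ring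
  rw [h4] at hsum
  exact le_of_mul_sq_le_mul (Finset.sum_nonneg fun x _ => sq_nonneg (ν x)) hq hKpos hK2 hC1
    (hνsum.trans hsum)

theorem pow_sum_mul_le {ι : Type*} (s : Finset ι) {ν T : ι → ℝ} (hν : ∀ i, 0 ≤ ν i)
    (hT : ∀ i, 0 ≤ T i) {r : ℕ} (hr : 0 < r) :
    (∑ i ∈ s, ν i * T i) ^ (2 * r)
      ≤ (∑ i ∈ s, ν i) ^ (2 * (r - 1)) * ((∑ i ∈ s, ν i ^ 2) * ∑ i ∈ s, T i ^ (2 * r)) := by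
  have hr0 : (r : ℝ) ≠ 0 := by positivity
  have hν0 : 0 ≤ ∑ i ∈ s, ν i := Finset.sum_nonneg fun i _ => hν i
  have h1 : (∑ i ∈ s, ν i * T i) ^ r ≤ (∑ i ∈ s, ν i) ^ (r - 1) * ∑ i ∈ s, ν i * T i ^ r := by
    have h := Real.inner_le_weight_mul_Lp_of_nonneg s (p := r) (by exact_mod_cast hr) ν T hν hT
    have h0 : 0 ≤ ∑ i ∈ s, ν i * T i := Finset.sum_nonneg fun i _ => mul_nonneg (hν i) (hT i)
    have h2 := pow_le_pow_left₀ h0 h r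
    refine h2.trans (le_of_eq ?_)
    have h3 : 0 ≤ ∑ i ∈ s, ν i * T i ^ (r : ℝ) :=
      Finset.sum_nonneg fun i _ => mul_nonneg (hν i) (Real.rpow_nonneg (hT i) _)
    rw [mul_pow, ← Real.rpow_natCast, ← Real.rpow_natCast, ← Real.rpow_mul hν0,
      ← Real.rpow_mul h3, inv_mul_cancel₀ hr0, Real.rpow_one,
      ← Real.rpow_natCast (∑ i ∈ s, ν i) (r - 1), Nat.cast_pred hr, sub_mul,
      inv_mul_cancel₀ hr0, one_mul]
    simp only [Real.rpow_natCast]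
  have h2 : (∑ i ∈ s, ν i * T i ^ r) ^ 2 ≤ (∑ i ∈ s, ν i ^ 2) * ∑ i ∈ s, T i ^ (2 * r) := by
    refine (Finset.sum_mul_sq_le_sq_mul_sq s ν fun i => T i ^ r).trans (le_of_eq ?_)
    simp only [← pow_mul, mul_comm r 2]
  calc (∑ i ∈ s, ν i * T i) ^ (2 * r) = ((∑ i ∈ s, ν i * T i) ^ r) ^ 2 := by
        rw [← pow_mul, mul_comm]
    _ ≤ ((∑ i ∈ s, ν i) ^ (r - 1) * ∑ i ∈ s, ν i * T i ^ r) ^ 2 := by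
        refine pow_le_pow_left₀ (pow_nonneg (Finset.sum_nonneg fun i _ =>
          mul_nonneg (hν i) (hT i)) _) h1 2
    _ = (∑ i ∈ s, ν i) ^ (2 * (r - 1)) * (∑ i ∈ s, ν i * T i ^ r) ^ 2 := by
        rw [mul_pow, ← pow_mul, mul_comm 2]
    _ ≤ _ := by gcongr

theorem norm_sum_shift_sub_le {f : ℕ → ℂ} (hf : ∀ n, ‖f n‖ ≤ 1) (N L h : ℕ) :
    ‖∑ n ∈ Finset.Ioc N (N + L), f (n + h) - ∑ n ∈ Finset.Ioc N (N + L), f n‖ ≤ 2 * h := by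
  induction h with
  | zero => simp
  | succ h ih =>
    have hstep : ∑ n ∈ Finset.Ioc N (N + L), f (n + (h + 1)) - ∑ n ∈ Finset.Ioc N (N + L), f (n + h)
        = f (N + L + (h + 1)) - f (N + 1 + h) := by
      clear ih
      induction L with
      | zero =>
        have e : N + 0 + (h + 1) = N + 1 + h := by ring
        rw [e]
        simp
      | succ L ih =>
        rw [← add_assoc N L 1, Finset.sum_Ioc_succ_top (by omega),
          Finset.sum_Ioc_succ_top (by omega)]
        have e : N + L + (h + 1) = N + L + 1 + h := by ring
        rw [e] at ih
        linear_combination ih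
    calc _ = ‖(f (N + L + (h + 1)) - f (N + 1 + h)) + (∑ n ∈ Finset.Ioc N (N + L), f (n + h)
          - ∑ n ∈ Finset.Ioc N (N + L), f n)‖ := by rw [← hstep]; congr 1; ring
      _ ≤ (1 + 1) + 2 * h :=
        (norm_add_le _ _).trans (add_le_add ((norm_sub_le _ _).trans (add_le_add (hf _) (hf _))) ih)
      _ = _ := by push_cast; ring

/-- Shifting by products reduces a character sum to short sums weighted by a representation
count. -/
theorem norm_sum_shift_le {q : ℕ} [NeZero q] (χ : DirichletCharacter ℂ q) (U : Finset (ZMod q))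
    (𝒜 : Finset ℕ) (h𝒜 : ∀ a ∈ 𝒜, a.Coprime q) (S : Finset ℤ) :
    ‖∑ a ∈ 𝒜, ∑ b ∈ S, ∑ u ∈ U, χ (u + (a : ZMod q) * (b : ZMod q))‖
      ≤ ∑ x : ZMod q, ((𝒜.filter fun a : ℕ => (a : ZMod q) * x ∈ U).card : ℝ)
          * ‖∑ b ∈ S, χ (x + b)‖ := by
  calc _ ≤ ∑ a ∈ 𝒜, ∑ x : ZMod q, if (a : ZMod q) * x ∈ U then ‖∑ b ∈ S, χ (x + b)‖ else 0 := by
        refine (norm_sum_le _ _).trans (Finset.sum_le_sum fun a ha => ?_)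
        have hu : IsUnit (a : ZMod q) := (ZMod.isUnit_iff_coprime a q).2 (h𝒜 a ha)
        obtain ⟨v, hv⟩ := hu
        rw [Finset.sum_comm]
        refine (norm_sum_le _ _).trans ?_
        have h1 : ∀ u, ‖∑ b ∈ S, χ (u + (a : ZMod q) * (b : ZMod q))‖
            ≤ ‖∑ b ∈ S, χ ((v⁻¹ : (ZMod q)ˣ) * u + b)‖ := by
          intro u
          have : ∑ b ∈ S, χ (u + (a : ZMod q) * (b : ZMod q))
              = χ a * ∑ b ∈ S, χ ((v⁻¹ : (ZMod q)ˣ) * u + b) := by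
            rw [Finset.mul_sum]
            refine Finset.sum_congr rfl fun b _ => ?_
            rw [← map_mul, mul_add, ← hv, Units.mul_inv_cancel_left]
          rw [this, norm_mul]
          exact mul_le_of_le_one_left (norm_nonneg _) (χ.norm_le_one _)
        refine (Finset.sum_le_sum fun u _ => h1 u).trans (le_of_eq ?_)
        rw [← Finset.sum_filter]
        refine Finset.sum_bij (fun u _ => (v⁻¹ : (ZMod q)ˣ) * u) ?_ ?_ ?_ ?_
        · intro u hu
          rw [Finset.mem_filter, ← hv, Units.mul_inv_cancel_left]
          exact ⟨Finset.mem_univ _, hu⟩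
        · intro u _ u' _ h
          exact (Units.mul_right_inj _).1 h
        · intro x hx
          refine ⟨_, (Finset.mem_filter.1 hx).2, ?_⟩
          rw [← hv, Units.inv_mul_cancel_left]
        · intro u _
          rfl
    _ = _ := by
        rw [Finset.sum_comm]
        refine Finset.sum_congr rfl fun x _ => ?_
        rw [← Finset.sum_filter, Finset.sum_const, nsmul_eq_mul]

theorem sum_card_filter_mul_mem {q : ℕ} [NeZero q] (U : Finset (ZMod q))
    (𝒜 : Finset ℕ) (h𝒜 : ∀ a ∈ 𝒜, a.Coprime q) :
    ∑ x : ZMod q, ((𝒜.filter fun a : ℕ => (a : ZMod q) * x ∈ U).card : ℝ) = 𝒜.card * U.card := by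
  have h1 : ∀ a ∈ 𝒜, ((Finset.univ : Finset (ZMod q)).filter fun x => (a : ZMod q) * x ∈ U).card
      = U.card := by
    intro a ha
    obtain ⟨v, hv⟩ := (ZMod.isUnit_iff_coprime a q).2 (h𝒜 a ha)
    refine Finset.card_bij (fun x _ => (v : ZMod q) * x) ?_ ?_ ?_
    · intro x hx
      rw [hv]
      exact (Finset.mem_filter.1 hx).2
    · intro x _ x' _ h
      exact (Units.mul_right_inj _).1 h
    · intro u hu
      refine ⟨(v⁻¹ : (ZMod q)ˣ) * u, ?_, Units.mul_inv_cancel_left _ _⟩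
      rw [Finset.mem_filter, ← hv, Units.mul_inv_cancel_left]
      exact ⟨Finset.mem_univ _, hu⟩
  have h2 : ∑ x : ZMod q, (𝒜.filter fun a : ℕ => (a : ZMod q) * x ∈ U).card
      = 𝒜.card * U.card := by
    simp only [Finset.card_filter]
    rw [Finset.sum_comm]
    simp only [← Finset.card_filter]
    rw [Finset.sum_congr rfl h1, Finset.sum_const, smul_eq_mul]
  exact_mod_cast h2

/-- The residue classes covered by disjoint intervals in `[1, q]`. -/
theorem exists_residues_of_intervals {q : ℕ} [NeZero q] {ℓ : ℝ} {J : ℕ} {N L : ℕ → ℕ}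
    (hL : ∀ j, 1 ≤ j → j ≤ J → ℓ ≤ (L j : ℝ) ∧ (L j : ℝ) ≤ 2 * ℓ)
    (hNL : ∀ j, 1 ≤ j → j ≤ J → N j + L j ≤ q)
    (hdisj : ∀ i j, 1 ≤ i → i < j → j ≤ J →
      Disjoint (Finset.Ioc (N i) (N i + L i)) (Finset.Ioc (N j) (N j + L j))) :
    ∃ U : Finset (ZMod q),
      (∀ f : ZMod q → ℂ, ∑ u ∈ U, f u
        = ∑ j ∈ Finset.Icc 1 J, ∑ n ∈ Finset.Ioc (N j) (N j + L j), f n) ∧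
      J * ℓ ≤ U.card ∧ (U.card : ℝ) ≤ J * (2 * ℓ) ∧
      ∀ y ∈ U, ∃ V ⊆ U, ℓ ≤ V.card ∧ ∀ u ∈ V, ∃ t : ℤ, |(t : ℝ)| ≤ 2 * ℓ ∧ y - u = t := by
  have hpd : Set.PairwiseDisjoint (Finset.Icc 1 J : Set ℕ)
      fun j => Finset.Ioc (N j) (N j + L j) := by
    intro i hi j hj hij
    have hi' := Finset.mem_Icc.1 (Finset.mem_coe.1 hi)
    have hj' := Finset.mem_Icc.1 (Finset.mem_coe.1 hj)
    rcases lt_or_gt_of_ne hij with h | h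
    · exact hdisj i j hi'.1 h hj'.2
    · exact (hdisj j i hj'.1 h hi'.2).symm
  set I := (Finset.Icc 1 J).biUnion fun j => Finset.Ioc (N j) (N j + L j) with hI
  have hinj : Set.InjOn (fun n : ℕ => (n : ZMod q)) (Finset.Ioc 0 q) := by
    intro m hm n hn hmn
    have hm' := Finset.mem_Ioc.1 (Finset.mem_coe.1 hm)
    have hn' := Finset.mem_Ioc.1 (Finset.mem_coe.1 hn)
    have h1 : ((m : ℤ) : ZMod q) = (n : ℤ) := by exact_mod_cast hmn
    rw [ZMod.intCast_eq_intCast_iff_dvd_sub] at h1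
    have := Int.eq_zero_of_abs_lt_dvd h1 (by rw [abs_lt]; omega)
    omega
  have hsub : ∀ j ∈ Finset.Icc 1 J, Finset.Ioc (N j) (N j + L j) ⊆ Finset.Ioc 0 q := by
    intro j hj
    have hj' := Finset.mem_Icc.1 hj
    exact Finset.Ioc_subset_Ioc (Nat.zero_le _) (hNL j hj'.1 hj'.2)
  have hIsub : I ⊆ Finset.Ioc 0 q := Finset.biUnion_subset.2 hsub
  have hinjI : Set.InjOn (fun n : ℕ => (n : ZMod q)) I := hinj.mono (Finset.coe_subset.2 hIsub)
  have hcard : ((I.image fun n : ℕ => (n : ZMod q)).card : ℝ)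
      = ∑ j ∈ Finset.Icc 1 J, (L j : ℝ) := by
    rw [Finset.card_image_of_injOn hinjI, Finset.card_biUnion hpd]
    push_cast
    simp
  refine ⟨I.image fun n : ℕ => (n : ZMod q), fun f => ?_, ?_, ?_, ?_⟩
  · rw [Finset.sum_image hinjI, Finset.sum_biUnion hpd]
  · rw [hcard]
    calc (J : ℝ) * ℓ = ∑ j ∈ Finset.Icc 1 J, ℓ := by simp
      _ ≤ _ := Finset.sum_le_sum fun j hj =>
        (hL j (Finset.mem_Icc.1 hj).1 (Finset.mem_Icc.1 hj).2).1
  · rw [hcard]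
    calc _ ≤ ∑ j ∈ Finset.Icc 1 J, 2 * ℓ := Finset.sum_le_sum fun j hj =>
        (hL j (Finset.mem_Icc.1 hj).1 (Finset.mem_Icc.1 hj).2).2
      _ = _ := by simp
  · intro y hy
    obtain ⟨n, hn, rfl⟩ := Finset.mem_image.1 hy
    obtain ⟨j, hj, hnj⟩ := Finset.mem_biUnion.1 hn
    have hLj := hL j (Finset.mem_Icc.1 hj).1 (Finset.mem_Icc.1 hj).2
    refine ⟨(Finset.Ioc (N j) (N j + L j)).image fun n : ℕ => (n : ZMod q),
      Finset.image_subset_image (Finset.subset_biUnion_of_mem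
        (fun j => Finset.Ioc (N j) (N j + L j)) hj), ?_, fun u hu => ?_⟩
    · rw [Finset.card_image_of_injOn (hinj.mono (Finset.coe_subset.2 (hsub j hj)))]
      simpa using hLj.1
    · obtain ⟨m, hm, rfl⟩ := Finset.mem_image.1 hu
      refine ⟨(n : ℤ) - m, ?_, by push_cast; rfl⟩
      have h1 : |(n : ℤ) - m| ≤ L j := by
        rw [Finset.mem_Ioc] at hm hnj
        rw [abs_le]
        omega
      have h2 : |(((n : ℤ) - m : ℤ) : ℝ)| ≤ L j := by exact_mod_cast h1
      exact h2.trans hLj.2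

/-- The Hölder inequality combined with the moment bounds. -/
theorem exists_weighted_sum_pow_le {r : ℕ} (hr : 0 < r) {η : ℝ} (hη : 0 < η) :
    ∃ C : ℝ, 1 ≤ C ∧ ∀ (q : ℕ) [NeZero q], (∀ p : ℕ, p.Prime → ¬ p ^ 3 ∣ q) →
      ∀ χ : DirichletCharacter ℂ q, IsLocallyNontrivial χ → ∀ B : ℕ, √q ≤ (B : ℝ) ^ r →
      ∀ ℓ : ℝ, 1 ≤ ℓ → ℓ ≤ q → ∀ U : Finset (ZMod q),
      (∀ y ∈ U, ∃ V ⊆ U, ℓ ≤ V.card ∧ ∀ u ∈ V, ∃ t : ℤ, |(t : ℝ)| ≤ 2 * ℓ ∧ y - u = t) →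
      ∀ 𝒜 : Finset ℕ, (∀ a ∈ 𝒜, 1 ≤ a ∧ (a : ℝ) ≤ ℓ) → (∀ a ∈ 𝒜, a.Coprime q) →
      0 < (𝒜.card * U.card : ℝ) →
      ‖∑ a ∈ 𝒜, ∑ b ∈ Finset.Icc (1 : ℤ) B, ∑ u ∈ U, χ (u + (a : ZMod q) * (b : ZMod q))‖ ^ (2 * r)
        ≤ C * (𝒜.card * U.card * B : ℝ) ^ (2 * r)
          * ((q : ℝ) ^ (1 / 2 + 2 * η) / (𝒜.card * U.card) + (q : ℝ) ^ (-1 / 2 + η)) := by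
  obtain ⟨C₁, hC₁, h₁⟩ := exists_sum_sq_card_mul_mem_le hη
  obtain ⟨C₂, hC₂, h₂⟩ := exists_moment_le hr hη
  refine ⟨2 * C₁ * C₂, by nlinarith, fun q _ hcf χ hχ B hB ℓ hℓ1 hℓq U hU 𝒜 h𝒜 hco hX => ?_⟩
  have hq1 : (1 : ℝ) ≤ q := by exact_mod_cast Nat.pos_of_ne_zero (NeZero.ne q)
  have hq : (0 : ℝ) < q := by linarith
  have hν := h₁ q ℓ hℓ1 hℓq U hU 𝒜 h𝒜
  have hT := h₂ q hcf χ hχ B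
  have hsum := sum_card_filter_mul_mem U 𝒜 hco
  have hH := pow_sum_mul_le (Finset.univ : Finset (ZMod q))
    (ν := fun x => ((𝒜.filter fun a : ℕ => (a : ZMod q) * x ∈ U).card : ℝ))
    (T := fun x => ‖∑ b ∈ Finset.Icc (1 : ℤ) B, χ (x + b)‖)
    (fun _ => Nat.cast_nonneg _) (fun _ => norm_nonneg _) hr
  have hshift := pow_le_pow_left₀ (norm_nonneg _)
    (norm_sum_shift_le χ U 𝒜 hco (Finset.Icc (1 : ℤ) B)) (2 * r)
  set X : ℝ := 𝒜.card * U.card with hXdef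
  rw [hsum] at hH
  have hQ : 1 ≤ (q : ℝ) ^ η := Real.one_le_rpow hq1 hη.le
  have hT' : (B : ℝ) ^ r * q + (B : ℝ) ^ (2 * r) * (√q * (q : ℝ) ^ η)
      ≤ 2 * ((B : ℝ) ^ (2 * r) * (√q * (q : ℝ) ^ η)) := by
    have h1 : (B : ℝ) ^ r * q ≤ (B : ℝ) ^ (2 * r) * (√q * (q : ℝ) ^ η) := by
      calc (B : ℝ) ^ r * q = (B : ℝ) ^ r * (√q * √q) * 1 := by
            rw [Real.mul_self_sqrt hq.le, mul_one]
        _ ≤ (B : ℝ) ^ r * ((B : ℝ) ^ r * √q) * (q : ℝ) ^ η := by gcongr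
        _ = _ := by rw [two_mul, pow_add]; ring
    linarith
  have hXpow : X ^ (2 * (r - 1)) * X ^ 2 = X ^ (2 * r) := by
    rw [← pow_add]
    congr 1
    omega
  have e1 : √q * (q : ℝ) ^ η * (q : ℝ) ^ η = (q : ℝ) ^ (1 / 2 + 2 * η) := by
    rw [Real.sqrt_eq_rpow, ← Real.rpow_add hq, ← Real.rpow_add hq]
    congr 1
    ring
  have e2 : √q * (q : ℝ) ^ η / q = (q : ℝ) ^ (-1 / 2 + η) := by
    rw [Real.sqrt_eq_rpow, ← Real.rpow_add hq, ← Real.rpow_sub_one hq.ne']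
    congr 1
    ring
  calc _ ≤ _ := hshift
    _ ≤ _ := hH
    _ ≤ X ^ (2 * (r - 1)) * ((C₁ * ((q : ℝ) ^ η * X + X ^ 2 / q))
        * (C₂ * (2 * ((B : ℝ) ^ (2 * r) * (√q * (q : ℝ) ^ η))))) := by
        gcongr
        exact hT.trans (by gcongr)
    _ = 2 * C₁ * C₂ * (X ^ (2 * (r - 1)) * X ^ 2 * (B : ℝ) ^ (2 * r))
          * (√q * (q : ℝ) ^ η * (q : ℝ) ^ η / X + √q * (q : ℝ) ^ η / q) := by
        field_simp
    _ = _ := by rw [hXpow, e1, e2, mul_pow X]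

theorem norm_sum_add_sub_sum_le {q : ℕ} (χ : DirichletCharacter ℂ q) {J : ℕ} {N L : ℕ → ℕ}
    {U : Finset (ZMod q)}
    (hU : ∀ f : ZMod q → ℂ, ∑ u ∈ U, f u
      = ∑ j ∈ Finset.Icc 1 J, ∑ n ∈ Finset.Ioc (N j) (N j + L j), f n) (h : ℕ) :
    ‖∑ u ∈ U, χ (u + (h : ZMod q)) - ∑ u ∈ U, χ u‖ ≤ J * (2 * h) := by
  rw [hU, hU, ← Finset.sum_sub_distrib]
  refine (norm_sum_le _ _).trans ?_
  calc _ ≤ ∑ j ∈ Finset.Icc 1 J, (2 * h : ℝ) := Finset.sum_le_sum fun j _ => by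
        simpa using norm_sum_shift_sub_le (f := fun n : ℕ => χ (n : ZMod q))
          (fun n => χ.norm_le_one _) (N j) (L j) h
    _ = _ := by simp

theorem card_mul_norm_le_of_norm_sub_le {α β : Type*} (s : Finset α) (t : Finset β)
    (F : α → β → ℂ) (z : ℂ) {D : ℝ} (h : ∀ a ∈ s, ∀ b ∈ t, ‖F a b - z‖ ≤ D) :
    s.card * t.card * ‖z‖ ≤ ‖∑ a ∈ s, ∑ b ∈ t, F a b‖ + s.card * t.card * D := by
  have h1 : ‖∑ a ∈ s, ∑ b ∈ t, (F a b - z)‖ ≤ s.card * t.card * D := by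
    calc _ ≤ ∑ a ∈ s, ∑ b ∈ t, D := (norm_sum_le _ _).trans <| Finset.sum_le_sum fun a ha =>
          (norm_sum_le _ _).trans <| Finset.sum_le_sum fun b hb => h a ha b hb
      _ = _ := by simp [mul_assoc]
  have h2 : ∑ a ∈ s, ∑ b ∈ t, F a b
      = ∑ a ∈ s, ∑ b ∈ t, (F a b - z) + (s.card * t.card : ℂ) * z := by
    simp [Finset.sum_sub_distrib, mul_assoc]
  have h3 : ‖(s.card * t.card : ℂ) * z‖ = s.card * t.card * ‖z‖ := by simp
  rw [← h3]
  calc _ = ‖∑ a ∈ s, ∑ b ∈ t, F a b - ∑ a ∈ s, ∑ b ∈ t, (F a b - z)‖ := by rw [h2]; ring_nf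
    _ ≤ _ := (norm_sub_le _ _).trans (by linarith)

set_option maxHeartbeats 1000000 in
theorem exists_norm_sum_le_of_lt_one {ε : ℝ} (hε : 0 < ε) (hε1 : ε < 1) :
    ∃ δ : ℝ, 0 < δ ∧ ∃ C : ℝ, 0 < C ∧
      ∀ (q : ℕ) [NeZero q], (∀ p : ℕ, p.Prime → ¬ p ^ 3 ∣ q) →
      ∀ (χ : DirichletCharacter ℂ q), IsLocallyNontrivial χ →
      ∀ ℓ : ℝ, (q : ℝ) ^ ε ≤ ℓ → ℓ ≤ q → ∀ (J : ℕ) (N L : ℕ → ℕ) (U : Finset (ZMod q)),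
        (∀ f : ZMod q → ℂ, ∑ u ∈ U, f u
          = ∑ j ∈ Finset.Icc 1 J, ∑ n ∈ Finset.Ioc (N j) (N j + L j), f n) →
        J * ℓ ≤ U.card → (U.card : ℝ) ≤ J * (2 * ℓ) →
        (∀ y ∈ U, ∃ V ⊆ U, ℓ ≤ V.card ∧ ∀ u ∈ V, ∃ t : ℤ, |(t : ℝ)| ≤ 2 * ℓ ∧ y - u = t) →
        (q : ℝ) ^ ((1 : ℝ) / 4 + ε / 2) ≤ ℓ * √J →
        ‖∑ u ∈ U, χ u‖ ≤ C * ℓ * J * (q : ℝ) ^ (-δ) := by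
  set η := ε / 20 with hη
  have hη0 : 0 < η := by positivity
  set r := ⌈10 / ε⌉₊ with hrdef
  have hrε : 10 ≤ r * ε := by
    have := Nat.le_ceil (10 / ε)
    rwa [div_le_iff₀ hε] at this
  have hr0 : 0 < r := Nat.ceil_pos.2 (by positivity)
  have hrR : (10 : ℝ) ≤ r := by
    have : (0 : ℝ) < r := by exact_mod_cast hr0
    nlinarith
  obtain ⟨C₃, hC₃, h₃⟩ := exists_card_divisors_le hη0
  obtain ⟨C, hC, h₁⟩ := exists_weighted_sum_pow_le hr0 hη0
  refine ⟨ε / (8 * r), by positivity, 10 * C * C₃ + 4 + 8 * C₃ ^ 2, by positivity, ?_⟩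
  intro q _ hcf χ hχ ℓ hℓ hℓq J N L U hU hU1 hU2 hV hbig
  have hq1 : (1 : ℝ) ≤ q := by exact_mod_cast Nat.pos_of_ne_zero (NeZero.ne q)
  have hq : (0 : ℝ) < q := by linarith
  set E := (q : ℝ) ^ (-(ε / (8 * r))) with hE
  have hE0 : 0 < E := by positivity
  set s := (q : ℝ) ^ η with hs
  have hs0 : 0 < s := by positivity
  have hs1 : 1 ≤ s := Real.one_le_rpow hq1 hη0.le
  have hspow : ∀ k : ℕ, s ^ k = (q : ℝ) ^ (k * η) := fun k => by
    rw [hs, ← Real.rpow_natCast, ← Real.rpow_mul hq.le, mul_comm]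
  have hsE : 1 ≤ E * s := by
    rw [hE, hs, ← Real.rpow_add hq]
    refine Real.one_le_rpow hq1 ?_
    have : ε / (8 * r) ≤ η := by
      rw [hη]; exact div_le_div_of_nonneg_left hε.le (by norm_num) (by linarith)
    linarith
  have hℓs : s ^ 20 ≤ ℓ := by
    rw [hspow]; convert hℓ using 2; rw [hη]; push_cast; ring
  have hℓ1 : 1 ≤ ℓ := (one_le_pow₀ hs1).trans hℓs
  have hℓ0 : 0 < ℓ := by linarith
  have hJ : 0 < J := by
    rcases Nat.eq_zero_or_pos J with rfl | h
    · simp only [Nat.cast_zero, Real.sqrt_zero, mul_zero] at hbig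
      exact absurd hbig (not_le.2 (by positivity))
    · exact h
  have hJR : (0 : ℝ) < J := by exact_mod_cast hJ
  have hS : ‖∑ u ∈ U, χ u‖ ≤ U.card := by
    refine (norm_sum_le _ _).trans ?_
    simpa using Finset.sum_le_sum fun u (_ : u ∈ U) => χ.norm_le_one u
  rcases lt_or_ge (s ^ 16) (4 * C₃ ^ 2) with hsmall | hlarge
  · have h1 : 1 ≤ E * (4 * C₃ ^ 2) :=
      hsE.trans (mul_le_mul_of_nonneg_left
        ((le_self_pow₀ hs1 (by norm_num)).trans hsmall.le) hE0.le)
    calc _ ≤ J * (2 * ℓ) * 1 := by rw [mul_one]; exact hS.trans hU2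
      _ ≤ J * (2 * ℓ) * (E * (4 * C₃ ^ 2)) := by gcongr
      _ = 8 * C₃ ^ 2 * ℓ * J * E := by ring
      _ ≤ _ := by gcongr; nlinarith
  set A := ⌊ℓ / s ^ 2⌋₊ with hA
  set B := ⌈s⌉₊ with hB
  have hℓs2 : s ^ 18 ≤ ℓ / s ^ 2 := by
    rw [le_div_iff₀ (by positivity), ← pow_add]; exact hℓs
  have hℓs2' : 1 ≤ ℓ / s ^ 2 := (one_le_pow₀ hs1).trans hℓs2
  have hAle : (A : ℝ) ≤ ℓ / s ^ 2 := Nat.floor_le (by linarith)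
  have hAge : ℓ / s ^ 2 / 2 ≤ A := by
    have h1 := Nat.lt_floor_add_one (ℓ / s ^ 2)
    have h2 : (1 : ℝ) ≤ A := by exact_mod_cast (Nat.one_le_floor_iff _).2 hℓs2'
    rw [← hA] at h1
    linarith
  have hAℓ : (A : ℝ) ≤ ℓ := hAle.trans (div_le_self hℓ0.le (one_le_pow₀ hs1))
  have hBs : s ≤ B := Nat.le_ceil s
  have hB0 : (0 : ℝ) < B := hs0.trans_le hBs
  have hBle : (B : ℝ) ≤ 2 * s := by
    have := Nat.ceil_lt_add_one hs0.le
    rw [← hB] at this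
    linarith
  have hBr : √q ≤ (B : ℝ) ^ r := by
    refine le_trans ?_ (pow_le_pow_left₀ hs0.le hBs r)
    rw [hspow, Real.sqrt_eq_rpow]
    refine Real.rpow_le_rpow_of_exponent_le hq1 ?_
    rw [hη]; linarith
  set 𝒜 := (Finset.Ioc 0 A).filter fun a => a.Coprime q with h𝒜
  have h𝒜1 : ∀ a ∈ 𝒜, 1 ≤ a ∧ (a : ℝ) ≤ A := fun a ha => by
    have := Finset.mem_Ioc.1 (Finset.mem_filter.1 ha).1
    exact ⟨this.1, by exact_mod_cast this.2⟩
  have h𝒜2 : ∀ a ∈ 𝒜, a.Coprime q := fun a ha => (Finset.mem_filter.1 ha).2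
  have hcard : ℓ / (4 * C₃ * s ^ 3) ≤ 𝒜.card := by
    have hd := h₃ q (NeZero.ne q)
    have hd0 : (0 : ℝ) < q.divisors.card := by
      exact_mod_cast Finset.card_pos.2 ⟨1, Nat.one_mem_divisors.2 (NeZero.ne q)⟩
    have h1 := div_card_divisors_sub_le_card_coprime (NeZero.ne q) A
    have h2 : (A : ℝ) / (C₃ * s) ≤ A / q.divisors.card :=
      div_le_div_of_nonneg_left (Nat.cast_nonneg _) hd0 hd
    have h3 : C₃ * s ≤ A / (C₃ * s) / 2 := by
      rw [div_div, le_div_iff₀ (by positivity)]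
      have : s ^ 2 * (4 * C₃ ^ 2) ≤ s ^ 2 * s ^ 16 := by gcongr
      nlinarith
    have h4 : ℓ / (4 * C₃ * s ^ 3) = ℓ / s ^ 2 / 2 / (C₃ * s) / 2 := by
      field_simp; norm_num
    have h5 : ℓ / s ^ 2 / 2 / (C₃ * s) / 2 ≤ A / (C₃ * s) / 2 := by gcongr
    rw [h4]
    linarith
  have h𝒜0 : (0 : ℝ) < 𝒜.card := lt_of_lt_of_le (by positivity) hcard
  set X : ℝ := 𝒜.card * U.card with hX
  clear_value X 𝒜 A B s E r η
  have hU0 : (0 : ℝ) < U.card := lt_of_lt_of_le (by positivity) hU1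
  have hX0 : 0 < X := hX ▸ mul_pos h𝒜0 hU0
  have hXge : (q : ℝ) ^ (1 / 2 + ε) / (4 * C₃ * s ^ 3) ≤ X := by
    have h1 : (q : ℝ) ^ (1 / 2 + ε) ≤ ℓ ^ 2 * J := by
      have := pow_le_pow_left₀ (by positivity) hbig 2
      rwa [mul_pow, Real.sq_sqrt hJR.le, ← Real.rpow_natCast, ← Real.rpow_mul hq.le,
        show (1 / 4 + ε / 2) * ((2 : ℕ) : ℝ) = 1 / 2 + ε by push_cast; ring] at this
    calc _ ≤ ℓ ^ 2 * J / (4 * C₃ * s ^ 3) := by gcongr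
      _ = ℓ / (4 * C₃ * s ^ 3) * (J * ℓ) := by ring
      _ ≤ _ := by rw [hX]; gcongr
  have hEpow : E ^ (2 * r) = (q : ℝ) ^ (-(ε / 4)) := by
    rw [hE, ← Real.rpow_natCast, ← Real.rpow_mul hq.le]
    congr 1
    push_cast
    field_simp
    norm_num
  have hmain := h₁ q hcf χ hχ B hBr ℓ hℓ1 hℓq U hV 𝒜
    (fun a ha => ⟨(h𝒜1 a ha).1, (h𝒜1 a ha).2.trans hAℓ⟩)
    h𝒜2 (hX ▸ hX0)
  rw [← hX] at hmain
  have hfirst : (q : ℝ) ^ (1 / 2 + 2 * η) / X ≤ 4 * C₃ * E ^ (2 * r) := by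
    rw [div_le_iff₀ hX0, hEpow]
    calc (q : ℝ) ^ (1 / 2 + 2 * η)
        ≤ (q : ℝ) ^ (-(ε / 4) + (1 / 2 + ε) - (3 : ℕ) * η) :=
          Real.rpow_le_rpow_of_exponent_le hq1 (by rw [hη]; push_cast; linarith)
      _ = (q : ℝ) ^ (-(ε / 4)) * (q : ℝ) ^ (1 / 2 + ε) / s ^ 3 := by
          rw [hspow, Real.rpow_sub hq, Real.rpow_add hq]
      _ = 4 * C₃ * (q : ℝ) ^ (-(ε / 4)) * ((q : ℝ) ^ (1 / 2 + ε) / (4 * C₃ * s ^ 3)) := by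
          field_simp
      _ ≤ _ := by gcongr
  have hsecond : (q : ℝ) ^ (-1 / 2 + η) ≤ E ^ (2 * r) := by
    rw [hEpow]
    exact Real.rpow_le_rpow_of_exponent_le hq1 (by rw [hη]; linarith)
  set Y := ‖∑ a ∈ 𝒜, ∑ b ∈ Finset.Icc (1 : ℤ) B, ∑ u ∈ U, χ (u + (a : ZMod q) * (b : ZMod q))‖
  have hY : Y ≤ 5 * C * C₃ * (X * B * E) := by
    refine le_of_pow_le_pow_left₀ (n := 2 * r) (by omega) (by positivity) ?_
    have hK : 1 ≤ 5 * C * C₃ := by nlinarith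
    calc Y ^ (2 * r) ≤ _ := hmain
      _ ≤ C * (X * B) ^ (2 * r) * (5 * C₃ * E ^ (2 * r)) := by
          gcongr
          have : E ^ (2 * r) ≤ C₃ * E ^ (2 * r) := le_mul_of_one_le_left (by positivity) hC₃
          linarith
      _ = 5 * C * C₃ * (X * B * E) ^ (2 * r) := by rw [mul_pow (X * B) E]; ring
      _ ≤ (5 * C * C₃) ^ (2 * r) * (X * B * E) ^ (2 * r) := by
          gcongr
          exact le_self_pow₀ hK (by omega)
      _ = _ := (mul_pow _ _ _).symm
  have hcardB : ((Finset.Icc (1 : ℤ) B).card : ℝ) = B := by simp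
  have hav := card_mul_norm_le_of_norm_sub_le 𝒜 (Finset.Icc (1 : ℤ) B)
    (fun a b => ∑ u ∈ U, χ (u + (a : ZMod q) * (b : ZMod q))) (∑ u ∈ U, χ u)
    (D := J * (2 * (A * B))) fun a ha b hb => by
      obtain ⟨hb1, hb2⟩ := Finset.mem_Icc.1 hb
      lift b to ℕ using by omega
      refine le_trans ?_ ((norm_sum_add_sub_sum_le χ hU (a * b)).trans ?_)
      · simp
      · have h1 := (h𝒜1 a ha).2
        have h2 : (b : ℝ) ≤ B := by exact_mod_cast hb2
        push_cast
        gcongr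
  rw [hcardB] at hav
  have hAB : (A : ℝ) * B ≤ 2 * ℓ * E := by
    calc (A : ℝ) * B ≤ ℓ / s ^ 2 * (2 * s) := by gcongr
      _ = 2 * ℓ * (1 / s) := by field_simp
      _ ≤ 2 * ℓ * E := by
          gcongr
          rw [div_le_iff₀ hs0]; exact hsE
  have hfin : ‖∑ u ∈ U, χ u‖ ≤ 5 * C * C₃ * (U.card * E) + J * (2 * (A * B)) := by
    refine le_of_mul_le_mul_left ?_ (mul_pos h𝒜0 hB0)
    calc _ ≤ _ := hav
      _ ≤ 5 * C * C₃ * (X * B * E) + 𝒜.card * B * (J * (2 * (A * B))) := by gcongr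
      _ = _ := by rw [hX]; ring
  calc _ ≤ _ := hfin
    _ ≤ 5 * C * C₃ * (J * (2 * ℓ) * E) + J * (2 * (2 * ℓ * E)) := by gcongr
    _ = (10 * C * C₃ + 4) * ℓ * J * E := by ring
    _ ≤ _ := by
        gcongr ?_ * ℓ * J * E
        linarith [sq_nonneg C₃]

/-- Dyadic-block case of the corollary: for `q` cube-free, `χ` primitive mod `q`, a real
`ℓ` with `q^ε ≤ ℓ ≤ q/2`, and pairwise disjoint intervals of integers in `[1, q]` each of
length between `ℓ` and `2ℓ`, with `ℓ √J ≥ q^{1/4 + ε/2}`, we have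
`|∑_j ∑_{n ∈ I'_j} χ(n)| ≤ C(ε) ℓ J q^{-δ(ε)}`. -/
theorem stmt_13 (ε : ℝ) (hε : 0 < ε) :
    ∃ δ : ℝ, 0 < δ ∧ ∃ C : ℝ, 0 < C ∧
      ∀ (q : ℕ), 0 < q → (∀ p : ℕ, p.Prime → ¬ p ^ 3 ∣ q) →
      ∀ (χ : DirichletCharacter ℂ q), DirichletCharacter.IsPrimitive χ →
      ∀ (ℓ : ℝ), (q : ℝ) ^ ε ≤ ℓ → ℓ ≤ (q : ℝ) / 2 →
      ∀ (J : ℕ) (N L : ℕ → ℕ),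
        (∀ j, 1 ≤ j → j ≤ J → ℓ ≤ (L j : ℝ) ∧ (L j : ℝ) ≤ 2 * ℓ) →
        (∀ j, 1 ≤ j → j ≤ J → N j + L j ≤ q) →
        (∀ i j, 1 ≤ i → i < j → j ≤ J →
          Disjoint (Finset.Ioc (N i) (N i + L i)) (Finset.Ioc (N j) (N j + L j))) →
        (q : ℝ) ^ ((1 : ℝ) / 4 + ε / 2) ≤ ℓ * Real.sqrt J →
        ‖∑ j ∈ Finset.Icc 1 J, ∑ n ∈ Finset.Ioc (N j) (N j + L j), χ (n : ZMod q)‖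
          ≤ C * ℓ * (J : ℝ) * (q : ℝ) ^ (-δ) := by
  rcases le_or_gt 1 ε with hε1 | hε1
  · refine ⟨1, one_pos, 1, one_pos, fun q hq _ χ _ ℓ hℓ hℓ2 => ?_⟩
    have hq1 : (1 : ℝ) ≤ q := by exact_mod_cast hq
    have := Real.rpow_le_rpow_of_exponent_le hq1 hε1
    rw [Real.rpow_one] at this
    linarith
  obtain ⟨δ, hδ, C, hC, h⟩ := exists_norm_sum_le_of_lt_one hε hε1
  refine ⟨δ, hδ, C, hC, fun q hq hcf χ hχ ℓ hℓ hℓ2 J N L hL hNL hdisj hbig => ?_⟩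
  have : NeZero q := ⟨hq.ne'⟩
  have hq1 : (1 : ℝ) ≤ q := by exact_mod_cast hq
  obtain ⟨U, hU, hU1, hU2, hV⟩ := exists_residues_of_intervals hL hNL hdisj
  rw [← hU fun x => χ x]
  exact h q hcf χ hχ.isLocallyNontrivial ℓ hℓ (by linarith) J N L U hU hU1 hU2 hV hbig
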